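/- Let Ω ⊂ ℝ^d (d ≥ 2) be a bounded domain, let I and J be open intervals of ℝ, and let a ∈ C^∞(Ω×I×J, ℝ) and b ∈ C^∞(Ω×I×J, ℝ^d) be bounded. Let v = v(x,t,τ) satisfy, for every τ ∈ J, the equation ∂_t v = Δ_x v + a v + b·∇_x v on Ω×I, extend continuously to the closure of Ω with v = 0 on ∂Ω×I for every τ ∈ J, be C^∞ in (x,t) and of class C^r in τ for some r ≥ 1. Assume there exist no t ∈ I and τ ∈ J such that v(·,t,τ) ≡ 0 on Ω. Then the singular nodal set M = {(x,t,τ) ∈ Ω×I×J : v(x,t,τ) = 0 and ∇_x v(x,t,τ) = 0} is contained in a countable union of d-dimensional embedded C^r submanifolds of Ω×I×J, each of which is either the graph of a C^r map expressing two coordinates (x_i, x_j) as functions of (t, τ) and the remaining d−2 coordinates of x, or the graph of a C^r map expressing (x_i, t) as functions of τ and the remaining d−1 coordinates of x. -/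

import Mathlib

open Set MeasureTheory

/-- The partial derivative of `f` in the `i`-th coordinate direction. -/
noncomputable def pd {d : ℕ} (i : Fin d) (f : (Fin d → ℝ) → ℝ) (x : Fin d → ℝ) : ℝ :=
  fderiv ℝ f x (Pi.single i 1)

/-- The Laplacian of `f`. -/
noncomputable def lap {d : ℕ} (f : (Fin d → ℝ) → ℝ) (x : Fin d → ℝ) : ℝ :=
  ∑ i, pd i (pd i f) x

namespace SN
open Filter Topology

section calculus
variable {X : Type} [NormedAddCommGroup X] [NormedSpace ℝ X]

/-- Directional derivative. -/
noncomputable def dd (e : X) (f : X → ℝ) (q : X) : ℝ := fderiv ℝ f q e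

/-- Smooth on a set. -/
abbrev Sm (U : Set X) (f : X → ℝ) : Prop := ContDiffOn ℝ (⊤ : ℕ∞) f U

theorem Sm.dd {U : Set X} (hU : IsOpen U) {f : X → ℝ} (hf : Sm U f) (e : X) :
    Sm U (dd e f) := by
  have h := hf.fderiv_of_isOpen (m := (⊤ : ℕ∞)) hU (by simp)
  exact h.clm_apply contDiffOn_const

theorem Sm.diffAt {U : Set X} (hU : IsOpen U) {f : X → ℝ} (hf : Sm U f) {q : X} (hq : q ∈ U) :
    DifferentiableAt ℝ f q :=
  (hf.differentiableOn (by simp)).differentiableAt (hU.mem_nhds hq)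

theorem Sm.contAt {U : Set X} (hU : IsOpen U) {f : X → ℝ} (hf : Sm U f) {q : X} (hq : q ∈ U) :
    ContinuousAt f q := (hf.diffAt hU hq).continuousAt

theorem Sm.mul {U : Set X} {f g : X → ℝ} (hf : Sm U f) (hg : Sm U g) :
    Sm U (fun x => f x * g x) := ContDiffOn.mul hf hg
theorem Sm.add {U : Set X} {f g : X → ℝ} (hf : Sm U f) (hg : Sm U g) :
    Sm U (fun x => f x + g x) := ContDiffOn.add hf hg
theorem Sm.sub {U : Set X} {f g : X → ℝ} (hf : Sm U f) (hg : Sm U g) :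
    Sm U (fun x => f x - g x) := ContDiffOn.sub hf hg
theorem Sm.const {U : Set X} (c : ℝ) : Sm U (fun _ : X => c) := contDiffOn_const
theorem Sm.sum {ι : Type} {U : Set X} {s : Finset ι} {f : ι → X → ℝ}
    (hf : ∀ i ∈ s, Sm U (f i)) : Sm U (fun x => ∑ i ∈ s, f i x) := ContDiffOn.sum hf
theorem Sm.congr {U : Set X} {f g : X → ℝ} (hf : Sm U f) (h : EqOn g f U) :
    Sm U g := ContDiffOn.congr hf h

theorem dd_congr {U : Set X} (hU : IsOpen U) {f g : X → ℝ} (h : EqOn f g U) (e : X) :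
    EqOn (dd e f) (dd e g) U := by
  intro q hq
  have : f =ᶠ[𝓝 q] g := h.eventuallyEq_of_mem (hU.mem_nhds hq)
  simp only [dd, this.fderiv_eq]

theorem dd_add {f g : X → ℝ} {q : X} (hf : DifferentiableAt ℝ f q) (hg : DifferentiableAt ℝ g q)
    (e : X) : dd e (fun x => f x + g x) q = dd e f q + dd e g q := by
  simp only [dd]
  rw [fderiv_fun_add hf hg]; rfl

theorem dd_sub {f g : X → ℝ} {q : X} (hf : DifferentiableAt ℝ f q) (hg : DifferentiableAt ℝ g q)
    (e : X) : dd e (fun x => f x - g x) q = dd e f q - dd e g q := by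
  simp only [dd]
  rw [fderiv_fun_sub hf hg]; rfl

theorem dd_mul {f g : X → ℝ} {q : X} (hf : DifferentiableAt ℝ f q) (hg : DifferentiableAt ℝ g q)
    (e : X) : dd e (fun x => f x * g x) q = dd e f q * g q + f q * dd e g q := by
  simp only [dd]
  rw [fderiv_fun_mul hf hg]; simp; ring

theorem dd_const_mul {f : X → ℝ} {q : X} (c : ℝ) (hf : DifferentiableAt ℝ f q)
    (e : X) : dd e (fun x => c * f x) q = c * dd e f q := by
  simp only [dd]
  rw [fderiv_const_mul hf]; simp

theorem dd_const (c : ℝ) (q : X) (e : X) : dd e (fun _ => c) q = 0 := by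
  simp [dd]

theorem dd_sum {ι : Type} (s : Finset ι) {f : ι → X → ℝ} {q : X}
    (hf : ∀ i ∈ s, DifferentiableAt ℝ (f i) q)
    (e : X) : dd e (fun x => ∑ i ∈ s, f i x) q = ∑ i ∈ s, dd e (f i) q := by
  simp only [dd]
  rw [fderiv_fun_sum hf]; simp

theorem dd_comm {U : Set X} (hU : IsOpen U) {f : X → ℝ} (hf : Sm U f) (e e' : X) :
    EqOn (dd e (dd e' f)) (dd e' (dd e f)) U := by
  intro q hq
  have hs : IsSymmSndFDerivAt ℝ f q :=
    (hf.contDiffAt (hU.mem_nhds hq)).isSymmSndFDerivAt (by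
      simp only [minSmoothness_of_isRCLikeNormedField]
      exact WithTop.coe_le_coe.2 le_top)
  have hd : DifferentiableAt ℝ (fderiv ℝ f) q :=
    ((hf.fderiv_of_isOpen (m := (⊤ : ℕ∞)) hU (by simp)).differentiableOn
      (by simp)).differentiableAt (hU.mem_nhds hq)
  have key : ∀ a b : X, SN.dd a (SN.dd b f) q = fderiv ℝ (fderiv ℝ f) q a b := by
    intro a b
    have : SN.dd b f = fun x => (fderiv ℝ f x) b := rfl
    rw [this]
    simp only [SN.dd]
    rw [fderiv_clm_apply hd (by fun_prop)]
    simp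
  rw [key, key]
  exact hs e e'

theorem hasDerivAt_line {f : X → ℝ} {q e : X} {s : ℝ} (hf : DifferentiableAt ℝ f (q + s • e)) :
    HasDerivAt (fun s : ℝ => f (q + s • e)) (dd e f (q + s • e)) s := by
  have h1 : HasDerivAt (fun s : ℝ => q + s • e) e s := by
    simpa using ((hasDerivAt_id s).smul_const e).const_add q
  exact hf.hasFDerivAt.comp_hasDerivAt s h1

/-- Iterated directional derivatives. -/
noncomputable def dw {ι : Type} (b : ι → X) (l : List ι) (f : X → ℝ) : X → ℝ :=
  l.foldr (fun j g => dd (b j) g) f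

@[simp] theorem dw_nil {ι : Type} (b : ι → X) (f : X → ℝ) : dw b [] f = f := rfl
@[simp] theorem dw_cons {ι : Type} (b : ι → X) (j : ι) (l : List ι) (f : X → ℝ) :
    dw b (j :: l) f = dd (b j) (dw b l f) := rfl
theorem dw_append {ι : Type} (b : ι → X) (l l' : List ι) (f : X → ℝ) :
    dw b (l ++ l') f = dw b l (dw b l' f) := by
  simp [dw]
theorem dw_snoc {ι : Type} (b : ι → X) (l : List ι) (j : ι) (f : X → ℝ) :
    dw b (l ++ [j]) f = dw b l (dd (b j) f) := by
  simp [dw]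

theorem Sm.dw {ι : Type} {b : ι → X} {U : Set X} (hU : IsOpen U) {f : X → ℝ} (hf : Sm U f)
    (l : List ι) : Sm U (dw b l f) := by
  induction l with
  | nil => exact hf
  | cons j l ih => exact ih.dd hU _

theorem dw_congr {ι : Type} {b : ι → X} {U : Set X} (hU : IsOpen U) {f g : X → ℝ}
    (h : EqOn f g U) (l : List ι) : EqOn (dw b l f) (dw b l g) U := by
  induction l with
  | nil => exact h
  | cons j l ih => exact dd_congr hU ih _

theorem dw_dd {ι : Type} {b : ι → X} {U : Set X} (hU : IsOpen U) {f : X → ℝ} (hf : Sm U f)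
    (l : List ι) (e : X) : EqOn (dw b l (dd e f)) (dd e (dw b l f)) U := by
  induction l with
  | nil => exact fun _ _ => rfl
  | cons j l ih =>
    intro q hq
    simp only [dw_cons]
    rw [dd_congr hU ih (b j) hq]
    exact dd_comm hU (hf.dw hU l) _ _ hq

theorem dw_add {ι : Type} {b : ι → X} {U : Set X} (hU : IsOpen U) {f g : X → ℝ} (hf : Sm U f)
    (hg : Sm U g) (l : List ι) :
    EqOn (dw b l (fun x => f x + g x)) (fun x => dw b l f x + dw b l g x) U := by
  induction l with
  | nil => exact fun _ _ => rfl
  | cons j l ih =>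
    intro q hq
    simp only [dw_cons]
    rw [dd_congr hU ih (b j) hq]
    exact dd_add ((hf.dw hU l).diffAt hU hq) ((hg.dw hU l).diffAt hU hq) _

theorem dw_const_mul {ι : Type} {b : ι → X} {U : Set X} (hU : IsOpen U) {f : X → ℝ} (c : ℝ)
    (hf : Sm U f) (l : List ι) :
    EqOn (dw b l (fun x => c * f x)) (fun x => c * dw b l f x) U := by
  induction l with
  | nil => exact fun _ _ => rfl
  | cons j l ih =>
    intro q hq
    simp only [dw_cons]
    rw [dd_congr hU ih (b j) hq]
    exact dd_const_mul c ((hf.dw hU l).diffAt hU hq) _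

theorem dw_snoc_mul {ι : Type} {b : ι → X} {U : Set X} (hU : IsOpen U) {f g : X → ℝ} (hf : Sm U f)
    (hg : Sm U g) (l : List ι) (j : ι) :
    EqOn (dw b (l ++ [j]) (fun x => f x * g x))
      (fun x => dw b l (fun x => dd (b j) f x * g x) x + dw b l (fun x => f x * dd (b j) g x) x)
      U := by
  intro q hq
  rw [dw_snoc]
  have h1 : EqOn (dd (b j) (fun x => f x * g x))
      (fun x => dd (b j) f x * g x + f x * dd (b j) g x) U := fun x hx =>
    dd_mul (hf.diffAt hU hx) (hg.diffAt hU hx) _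
  rw [dw_congr hU h1 l hq]
  exact dw_add hU ((hf.dd hU _).mul hg) (hf.mul (hg.dd hU _)) l hq

/-- Continuous partial derivatives along a basis give the Fréchet derivative. -/
theorem hasFDerivAt_of_partials {ι : Type} [Fintype ι] (b : Module.Basis ι ℝ X)
    [FiniteDimensional ℝ X]
    {U : Set X} (hU : IsOpen U) {f : X → ℝ} {G : ι → X → ℝ}
    (hG : ∀ i, ContinuousOn (G i) U)
    (hf : ∀ q ∈ U, ∀ i, HasDerivAt (fun s : ℝ => f (q + s • b i)) (G i q) 0)
    {q : X} (hq : q ∈ U) :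
    HasFDerivAt f (∑ i, G i q • (LinearMap.toContinuousLinearMap (b.coord i))) q := by
  classical
  have claim : ∀ s : Finset ι, ∀ ε > 0, ∃ δ > 0, ∀ q' ∈ Metric.ball q δ, ∀ c : ι → ℝ,
      (∀ i, |c i| < δ) →
      |f (q' + ∑ i ∈ s, c i • b i) - f q' - ∑ i ∈ s, c i * G i q| ≤ ε * ∑ i ∈ s, |c i| := by
    intro s
    induction s using Finset.induction_on with
    | empty =>
      intro ε hε
      exact ⟨1, one_pos, by intros; simp⟩
    | insert i s his ih =>
      intro ε hε
      obtain ⟨δ₁, hδ₁, h1⟩ := ih ε hε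
      have hc : ContinuousAt (G i) q := (hG i).continuousAt (hU.mem_nhds hq)
      obtain ⟨η, hη, h2⟩ := Metric.continuousAt_iff.1 hc ε hε
      obtain ⟨η', hη', h3⟩ := Metric.isOpen_iff.1 hU q hq
      set B : ℝ := 1 + ∑ j ∈ s, ‖b j‖ + ‖b i‖ with hB
      have hsum0 : 0 ≤ ∑ j ∈ s, ‖b j‖ := Finset.sum_nonneg fun _ _ => norm_nonneg _
      have hB1 : 1 ≤ B := by have := norm_nonneg (b i); linarith
      set m := min η η' with hm
      have hm0 : 0 < m := lt_min hη hη'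
      refine ⟨min δ₁ (m / B), lt_min hδ₁ (by positivity), ?_⟩
      intro q' hq' c hcs
      have hcs' : ∀ j, |c j| < m / B := fun j => (hcs j).trans_le (min_le_right _ _)
      have A := h1 q' (Metric.ball_subset_ball (min_le_left _ _) hq') c
        (fun j => (hcs j).trans_le (min_le_left _ _))
      set q'' := q' + ∑ j ∈ s, c j • b j with hq''
      have hdist : ∀ r : ℝ, |r| ≤ |c i| → dist (q'' + r • b i) q < m := by
        intro r hr
        have e1 : q'' + r • b i - q = (q' - q) + ∑ j ∈ s, c j • b j + r • b i := by
          rw [hq'']; abel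
        rw [dist_eq_norm, e1]
        have n1 : ‖q' - q‖ < m / B := by
          rw [← dist_eq_norm]; exact (Metric.mem_ball.1 hq').trans_le (min_le_right _ _)
        have n2 : ‖∑ j ∈ s, c j • b j‖ ≤ ∑ j ∈ s, (m / B) * ‖b j‖ := by
          refine norm_sum_le_of_le _ fun j _ => ?_
          rw [norm_smul]
          exact mul_le_mul_of_nonneg_right (by simpa using (hcs' j).le) (norm_nonneg _)
        have n3 : ‖r • b i‖ ≤ (m / B) * ‖b i‖ := by
          rw [norm_smul]
          exact mul_le_mul_of_nonneg_right (by simpa using hr.trans (hcs' i).le) (norm_nonneg _)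
        rw [← Finset.mul_sum] at n2
        have : m / B * B = m := by field_simp
        calc _ ≤ ‖q' - q‖ + ‖∑ j ∈ s, c j • b j‖ + ‖r • b i‖ := norm_add₃_le
          _ < m / B + m / B * ∑ j ∈ s, ‖b j‖ + (m / B) * ‖b i‖ := by linarith
          _ = m / B * B := by rw [hB]; ring
          _ = m := this
      have hmv : |f (q'' + c i • b i) - f q'' - c i * G i q| ≤ ε * |c i| := by
        have hder : ∀ r ∈ Icc (-|c i|) (|c i|),
            HasDerivWithinAt (fun r : ℝ => f (q'' + r • b i) - r * G i q)
              (G i (q'' + r • b i) - G i q) (Icc (-|c i|) (|c i|)) r := by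
          intro r hr
          have hin : q'' + r • b i ∈ U := h3 ((hdist r (abs_le.2 hr)).trans_le (min_le_right _ _))
          have h := hf _ hin i
          have h' : HasDerivAt (fun s : ℝ => f (q'' + s • b i)) (G i (q'' + r • b i)) r := by
            have hh : HasDerivAt (fun s : ℝ => s - r) 1 r := by
              simpa using (hasDerivAt_id r).sub_const r
            have := HasDerivAt.comp (𝕜 := ℝ) r
              (h₂ := fun s : ℝ => f (q'' + r • b i + s • b i)) (h := fun s : ℝ => s - r)
              (h₂' := G i (q'' + r • b i)) (by simpa using h) hh
            simp only [mul_one] at this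
            have e6 : ((fun s : ℝ => f (q'' + r • b i + s • b i)) ∘ fun s => s - r)
                = fun s : ℝ => f (q'' + s • b i) := by
              funext s
              change f (q'' + r • b i + (s - r) • b i) = _
              congr 1
              rw [sub_smul]; abel
            rw [e6] at this
            exact this
          have h'' := h'.sub ((hasDerivAt_id r).mul_const (G i q))
          simp only [one_mul] at h''
          exact h''.hasDerivWithinAt
        have hbd : ∀ r ∈ Icc (-|c i|) (|c i|), ‖G i (q'' + r • b i) - G i q‖ ≤ ε := by
          intro r hr
          rw [← dist_eq_norm]
          exact (h2 ((hdist r (abs_le.2 hr)).trans_le (min_le_left _ _))).le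
        have := Convex.norm_image_sub_le_of_norm_hasDerivWithin_le hder hbd (convex_Icc _ _)
          (x := 0) (y := c i) ⟨by simp, by simp⟩ (abs_le.1 le_rfl)
        simp only [zero_smul, add_zero, zero_mul, sub_zero, Real.norm_eq_abs] at this
        have e5 : f (q'' + c i • b i) - f q'' - c i * G i q
            = f (q'' + c i • b i) - c i * G i q - f q'' := by ring
        rw [e5]; exact this
      rw [Finset.sum_insert his, Finset.sum_insert his, Finset.sum_insert his]
      have e2 : q' + (c i • b i + ∑ j ∈ s, c j • b j) = q'' + c i • b i := by
        rw [hq'']; abel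
      rw [e2]
      rw [abs_le] at *
      constructor <;> nlinarith [hmv.1, hmv.2, A.1, A.2]
  rw [hasFDerivAt_iff_isLittleO_nhds_zero, Asymptotics.isLittleO_iff]
  intro ε hε
  set L : ι → ℝ := fun i => ‖LinearMap.toContinuousLinearMap (b.coord i)‖
  set S : ℝ := 1 + ∑ i, L i with hS
  have hL0 : ∀ i, 0 ≤ L i := fun i => norm_nonneg _
  have hS0 : 0 < S := by have : 0 ≤ ∑ i, L i := Finset.sum_nonneg fun i _ => hL0 i
                         positivity
  obtain ⟨δ, hδ, h⟩ := claim Finset.univ (ε / S) (by positivity)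
  have : Metric.ball (0 : X) (δ / S) ∈ 𝓝 (0 : X) := Metric.ball_mem_nhds _ (by positivity)
  filter_upwards [this] with h0 hh0
  have hco : ∀ i, |b.coord i h0| ≤ L i * ‖h0‖ := fun i =>
    (LinearMap.toContinuousLinearMap (b.coord i)).le_opNorm h0
  have hn : ‖h0‖ < δ / S := by simpa using hh0
  have hLS : ∀ i, L i ≤ S := fun i => by
    have := Finset.single_le_sum (f := L) (fun i _ => hL0 i) (Finset.mem_univ i)
    linarith
  have h' := h q (Metric.mem_ball_self hδ) (fun i => b.coord i h0) (by
    intro i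
    calc _ ≤ L i * ‖h0‖ := hco i
      _ ≤ S * ‖h0‖ := by gcongr; exact hLS i
      _ < S * (δ / S) := by gcongr
      _ = δ := by field_simp)
  have e3 : ∑ i, b.coord i h0 • b i = h0 := by simp [b.sum_repr h0]
  rw [e3] at h'
  have e4 : (∑ i, G i q • LinearMap.toContinuousLinearMap (b.coord i)) h0
      = ∑ i, b.coord i h0 * G i q := by
    simp [mul_comm]
  rw [e4, Real.norm_eq_abs]
  refine h'.trans ?_
  have : ∑ i, |b.coord i h0| ≤ S * ‖h0‖ := by
    calc _ ≤ ∑ i, L i * ‖h0‖ := Finset.sum_le_sum fun i _ => hco i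
      _ = (∑ i, L i) * ‖h0‖ := by rw [Finset.sum_mul]
      _ ≤ S * ‖h0‖ := by gcongr; linarith
  calc _ ≤ ε / S * (S * ‖h0‖) := by gcongr
    _ = _ := by field_simp

end calculus
end SN

open Set MeasureTheory
namespace SN
open Filter Topology

section heat
variable {X : Type} [NormedAddCommGroup X] [NormedSpace ℝ X]
variable {ι : Type} [Fintype ι]

/-- The heat operator `∂_t - Δ`. -/
noncomputable def heat (ex : ι → X) (et : X) (f : X → ℝ) (q : X) : ℝ :=
  dd et f q - ∑ i, dd (ex i) (dd (ex i) f) q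

variable {ex : ι → X} {et : X} {U : Set X}

theorem heat_congr (hU : IsOpen U) {f g : X → ℝ} (h : EqOn f g U) :
    EqOn (heat ex et f) (heat ex et g) U := by
  intro q hq
  simp only [heat]
  rw [dd_congr hU h et hq]
  congr 1
  exact Finset.sum_congr rfl fun i _ => dd_congr hU (dd_congr hU h (ex i)) (ex i) hq

theorem Sm.heat (hU : IsOpen U) {f : X → ℝ} (hf : Sm U f) : Sm U (heat ex et f) :=
  (hf.dd hU et).sub (Sm.sum fun i _ => (hf.dd hU (ex i)).dd hU (ex i))

theorem heat_add (hU : IsOpen U) {f g : X → ℝ} (hf : Sm U f) (hg : Sm U g) {q : X} (hq : q ∈ U) :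
    heat ex et (fun x => f x + g x) q = heat ex et f q + heat ex et g q := by
  have key : ∀ i, dd (ex i) (dd (ex i) (fun x => f x + g x)) q
      = dd (ex i) (dd (ex i) f) q + dd (ex i) (dd (ex i) g) q := by
    intro i
    exact dw_add (b := ex) hU hf hg [i, i] hq
  simp only [heat, key, Finset.sum_add_distrib, dd_add (hf.diffAt hU hq) (hg.diffAt hU hq)]
  ring

theorem heat_const_mul (hU : IsOpen U) {f : X → ℝ} (c : ℝ) (hf : Sm U f) {q : X} (hq : q ∈ U) :
    heat ex et (fun x => c * f x) q = c * heat ex et f q := by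
  have key : ∀ i, dd (ex i) (dd (ex i) (fun x => c * f x)) q
      = c * dd (ex i) (dd (ex i) f) q := by
    intro i
    exact dw_const_mul (b := ex) hU c hf [i, i] hq
  simp only [heat, key, ← Finset.mul_sum, dd_const_mul c (hf.diffAt hU hq)]
  ring

theorem heat_sub (hU : IsOpen U) {f g : X → ℝ} (hf : Sm U f) (hg : Sm U g) {q : X} (hq : q ∈ U) :
    heat ex et (fun x => f x - g x) q = heat ex et f q - heat ex et g q := by
  have h1 : (fun x => f x - g x) = fun x => f x + (-1) * g x := by funext x; ring
  rw [h1, heat_add hU hf ((Sm.const _).mul hg) hq, heat_const_mul hU _ hg hq]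
  ring

theorem heat_sum (hU : IsOpen U) {κ : Type} (s : Finset κ) {f : κ → X → ℝ}
    (hf : ∀ k, Sm U (f k)) {q : X} (hq : q ∈ U) :
    heat ex et (fun x => ∑ k ∈ s, f k x) q = ∑ k ∈ s, heat ex et (f k) q := by
  classical
  induction s using Finset.induction_on with
  | empty =>
    have : dd et (fun _ : X => (0 : ℝ)) q = 0 := dd_const 0 q et
    have h2 : ∀ i, dd (ex i) (dd (ex i) (fun _ : X => (0 : ℝ))) q = 0 := by
      intro i
      have : dd (ex i) (fun _ : X => (0 : ℝ)) = fun _ => 0 := by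
        funext x; exact dd_const 0 x _
      rw [this]; exact dd_const 0 q _
    simp [heat, this, h2]
  | insert k s hk ih =>
    simp only [Finset.sum_insert hk]
    rw [heat_add hU (hf k) (Sm.sum fun k _ => hf k) hq, ih]

theorem heat_mul (hU : IsOpen U) {f g : X → ℝ} (hf : Sm U f) (hg : Sm U g) {q : X} (hq : q ∈ U) :
    heat ex et (fun x => f x * g x) q = f q * heat ex et g q + g q * heat ex et f q
      - 2 * ∑ i, dd (ex i) f q * dd (ex i) g q := by
  have key : ∀ i, dd (ex i) (dd (ex i) (fun x => f x * g x)) q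
      = dd (ex i) (dd (ex i) f) q * g q + f q * dd (ex i) (dd (ex i) g) q
        + 2 * (dd (ex i) f q * dd (ex i) g q) := by
    intro i
    have h1 : EqOn (dd (ex i) (fun x => f x * g x))
        (fun x => dd (ex i) f x * g x + f x * dd (ex i) g x) U := fun x hx =>
      dd_mul (hf.diffAt hU hx) (hg.diffAt hU hx) _
    rw [dd_congr hU h1 (ex i) hq]
    have hf' := hf.dd hU (ex i)
    have hg' := hg.dd hU (ex i)
    rw [dd_add ((hf'.mul hg).diffAt hU hq) ((hf.mul hg').diffAt hU hq),
      dd_mul (hf'.diffAt hU hq) (hg.diffAt hU hq), dd_mul (hf.diffAt hU hq) (hg'.diffAt hU hq)]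
    ring
  simp only [heat, key, Finset.sum_add_distrib, ← Finset.mul_sum, ← Finset.sum_mul,
    dd_mul (hf.diffAt hU hq) (hg.diffAt hU hq)]
  ring

theorem heat_dd (hU : IsOpen U) {f : X → ℝ} (hf : Sm U f) (e : X) :
    EqOn (heat ex et (dd e f)) (dd e (heat ex et f)) U := by
  intro q hq
  have h1 : dd e (heat ex et f) q
      = dd e (dd et f) q - ∑ i, dd e (dd (ex i) (dd (ex i) f)) q := by
    have hs : ∀ i, Sm U (dd (ex i) (dd (ex i) f)) := fun i => (hf.dd hU _).dd hU _
    have : heat ex et f = fun x => dd et f x - ∑ i, dd (ex i) (dd (ex i) f) x := rfl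
    rw [this, dd_sub ((hf.dd hU et).diffAt hU hq)
      ((Sm.sum (s := Finset.univ) fun i _ => hs i).diffAt hU hq), dd_sum _ fun i _ => (hs i).diffAt hU hq]
  rw [h1]
  simp only [heat]
  rw [dd_comm hU hf et e hq]
  congr 1
  refine Finset.sum_congr rfl fun i _ => ?_
  exact dw_dd (b := ex) hU hf [i, i] e hq

theorem heat_nonneg_of_isLocalMax (hU : IsOpen U) {Z : X → ℝ} (hZ : Sm U Z) {q : X} (hq : q ∈ U)
    (hm : IsLocalMax Z q) : 0 ≤ heat ex et Z q := by
  have h0 : fderiv ℝ Z q = 0 := hm.fderiv_eq_zero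
  have h1 : ∀ e, dd e Z q = 0 := fun e => by simp [dd, h0]
  have h2 : ∀ e, dd e (dd e Z) q ≤ 0 := by
    intro e
    by_contra hpos
    push Not at hpos
    set φ : ℝ → ℝ := fun s => Z (q + s • e) with hφ
    have hcont : Continuous fun s : ℝ => q + s • e := by fun_prop
    have hev : ∀ᶠ s in 𝓝 (0 : ℝ), q + s • e ∈ U :=
      hcont.continuousAt.eventually_mem (by simpa using hU.mem_nhds hq)
    have hd1 : deriv φ =ᶠ[𝓝 (0 : ℝ)] fun s => dd e Z (q + s • e) := by
      filter_upwards [hev] with s hs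
      exact (hasDerivAt_line (hZ.diffAt hU hs)).deriv
    have hq0 : q + (0 : ℝ) • e ∈ U := by simpa using hq
    have hd2 : deriv (deriv φ) 0 = dd e (dd e Z) q := by
      rw [hd1.deriv_eq]
      have := (hasDerivAt_line (s := 0) (e := e) ((hZ.dd hU e).diffAt hU hq0)).deriv
      simpa using this
    have hφmax : IsLocalMax φ 0 := by
      have : Tendsto (fun s : ℝ => q + s • e) (𝓝 0) (𝓝 q) := by
        simpa using hcont.tendsto 0
      have := this.eventually hm
      filter_upwards [this] with s hs
      simpa [hφ] using hs
    have hφmin : IsLocalMin φ 0 := by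
      refine isLocalMin_of_deriv_deriv_pos (by rw [hd2]; exact hpos) hφmax.deriv_eq_zero ?_
      exact (hasDerivAt_line (s := 0) (e := e) (hZ.diffAt hU hq0)).continuousAt
    have hconst : φ =ᶠ[𝓝 0] fun _ => φ 0 := by
      filter_upwards [hφmax, hφmin] with s h1 h2
      exact le_antisymm h1 h2
    have : deriv (deriv φ) 0 = 0 := by
      have h3 : deriv φ =ᶠ[𝓝 0] fun _ => 0 := by
        have := hconst.deriv
        simpa using this
      rw [h3.deriv_eq]; simp
    rw [hd2] at this
    linarith
  simp only [heat, h1, zero_sub, neg_nonneg]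
  exact Finset.sum_nonpos fun i _ => h2 _

theorem dd_clm (T : X →L[ℝ] ℝ) (e : X) : dd e (fun x => T x) = fun _ => T e := by
  funext q
  simp only [dd]
  rw [show (fun x => T x) = T from rfl, T.fderiv]

theorem heat_clm (T : X →L[ℝ] ℝ) (hT : T et = 1) (q : X) :
    heat ex et (fun x => T x) q = 1 := by
  have : ∀ i, dd (ex i) (dd (ex i) fun x => T x) q = 0 := by
    intro i
    rw [dd_clm]; exact dd_const _ _ _
  simp [heat, dd_clm, hT]
  exact Finset.sum_eq_zero fun i _ => by rw [← dd_clm T (ex i)]; exact this i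

/-- `heat` of `(ζ s)^2`. -/
theorem heat_cut_sq (hU : IsOpen U) {ζ s : X → ℝ} (hζ : Sm U ζ) (hs : Sm U s) {q : X}
    (hq : q ∈ U) :
    heat ex et (fun x => (ζ x * s x) * (ζ x * s x)) q
      ≤ 2 * ζ q ^ 2 * (s q * heat ex et s q)
        + s q ^ 2 * (2 * (ζ q * heat ex et ζ q) + 14 * ∑ i, dd (ex i) ζ q ^ 2)
        - ζ q ^ 2 * ∑ i, dd (ex i) s q ^ 2 := by
  have hp : Sm U (fun x => ζ x * s x) := hζ.mul hs
  rw [heat_mul hU hp hp hq, heat_mul hU hζ hs hq]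
  have h1 : ∀ i, dd (ex i) (fun x => ζ x * s x) q = dd (ex i) ζ q * s q + ζ q * dd (ex i) s q :=
    fun i => dd_mul (hζ.diffAt hU hq) (hs.diffAt hU hq) _
  simp only [h1]
  have h2 : -(4 * (ζ q * s q) * ∑ i, dd (ex i) ζ q * dd (ex i) s q)
      - 2 * ∑ i, (dd (ex i) ζ q * s q + ζ q * dd (ex i) s q) *
          (dd (ex i) ζ q * s q + ζ q * dd (ex i) s q)
      ≤ s q ^ 2 * (14 * ∑ i, dd (ex i) ζ q ^ 2) - ζ q ^ 2 * ∑ i, dd (ex i) s q ^ 2 := by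
    simp only [Finset.mul_sum]
    rw [← Finset.sum_neg_distrib, ← Finset.sum_sub_distrib, ← Finset.sum_sub_distrib]
    refine Finset.sum_le_sum fun i _ => ?_
    nlinarith [sq_nonneg (ζ q * dd (ex i) s q + 4 * (s q * dd (ex i) ζ q))]
  nlinarith [h2]

set_option maxHeartbeats 1000000 in
/-- The Bernstein gradient estimate. -/
theorem bernstein (hU : IsOpen U) {κ : Type} [Fintype κ] {Kc : Set X} (hK : IsCompact Kc)
    (hKU : Kc ⊆ U)
    {ζ : X → ℝ} (hζ : Sm U ζ) (hζ1 : ∀ q ∈ Kc, |ζ q| ≤ 1)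
    (hζ0 : ∀ q ∈ Kc, q ∉ interior Kc → ζ q = 0)
    (T : X →L[ℝ] ℝ) (hT : T et = 1)
    {C M : ℝ} (hC : 0 ≤ C) (hM : 0 ≤ M) :
    ∃ B : ℝ, ∀ u : κ → X → ℝ, (∀ k, Sm U (u k)) → (∀ k, ∀ q ∈ Kc, |u k q| ≤ M) →
      (∀ k, ∀ q ∈ Kc, |heat ex et (u k) q| ≤ C * (1 + ∑ p : κ × ι, |dd (ex p.2) (u p.1) q|)) →
      (∀ k j, ∀ q ∈ Kc, |dd (ex j) (heat ex et (u k)) q| ≤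
        C * (1 + ∑ p : κ × ι, |dd (ex p.2) (u p.1) q|
          + ∑ p : (κ × ι) × ι, |dd (ex p.2) (dd (ex p.1.2) (u p.1.1)) q|)) →
      ∀ q ∈ Kc, ∀ k j, |ζ q * dd (ex j) (u k) q| ≤ B := by
  classical
  obtain ⟨T0, hT0⟩ : ∃ T0, ∀ q ∈ Kc, |T q| ≤ T0 := by
    obtain ⟨c, hc⟩ := hK.exists_bound_of_continuousOn (f := T) T.continuous.continuousOn
    exact ⟨c, hc⟩
  obtain ⟨C0', hC0'⟩ : ∃ C0, ∀ q ∈ Kc,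
      ‖2 * (ζ q * heat ex et ζ q) + 14 * ∑ i, dd (ex i) ζ q ^ 2‖ ≤ C0 := by
    refine hK.exists_bound_of_continuousOn ?_
    have h1 : ContinuousOn ζ Kc := hζ.continuousOn.mono hKU
    have h2 : ContinuousOn (heat ex et ζ) Kc := (hζ.heat hU).continuousOn.mono hKU
    have h3 : ∀ i, ContinuousOn (dd (ex i) ζ) Kc := fun i => (hζ.dd hU _).continuousOn.mono hKU
    exact (continuousOn_const.mul (h1.mul h2)).add
      (continuousOn_const.mul (continuousOn_finsetSum _ fun i _ => (h3 i).pow 2))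
  set C0 := max C0' 0
  have hC00 : 0 ≤ C0 := le_max_right _ _
  set n : ℝ := (Fintype.card (κ × ι) : ℝ) + 1 with hn
  set m : ℝ := (Fintype.card ((κ × ι) × ι) : ℝ) + 1 with hm
  set N : ℝ := (Fintype.card κ : ℝ) with hN
  have hn1 : 1 ≤ n := by rw [hn]; linarith [Nat.cast_nonneg (α := ℝ) (Fintype.card (κ × ι))]
  have hm1 : 1 ≤ m := by
    rw [hm]; linarith [Nat.cast_nonneg (α := ℝ) (Fintype.card ((κ × ι) × ι))]
  have hN0 : 0 ≤ N := Nat.cast_nonneg _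
  set lam : ℝ := (1 + 2 * C + m * C ^ 2) * n + C0 with hlam
  have hlam0 : 0 ≤ lam := by positivity
  set KK : ℝ := C ^ 2 + lam * (2 * M * C * N + n * (M * C * N) ^ 2) + 1 with hKK
  have hKK0 : 0 ≤ KK := by positivity
  refine ⟨Real.sqrt (lam * (N * M ^ 2) + 2 * KK * T0), ?_⟩
  intro u hu huM hg hdg q hq k j
  set s : κ × ι → X → ℝ := fun p => dd (ex p.2) (u p.1) with hs
  have hsS : ∀ p, Sm U (s p) := fun p => (hu p.1).dd hU _
  set Z1 : X → ℝ := fun x => ∑ p, (ζ x * s p x) * (ζ x * s p x) with hZ1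
  set Z2 : X → ℝ := fun x => ∑ k, u k x * u k x with hZ2
  set Z : X → ℝ := fun x => (Z1 x + lam * Z2 x) - KK * T x with hZ
  have hZ1S : Sm U Z1 := Sm.sum fun p _ => (hζ.mul (hsS p)).mul (hζ.mul (hsS p))
  have hZ2S : Sm U Z2 := Sm.sum fun p _ => (hu p).mul (hu p)
  have hTS : Sm U (fun x => T x) := T.contDiff.contDiffOn
  have hZS : Sm U Z := (hZ1S.add ((Sm.const _).mul hZ2S)).sub ((Sm.const _).mul hTS)
  obtain ⟨q', hq', hmax⟩ := hK.exists_isMaxOn ⟨q, hq⟩ (hZS.continuousOn.mono hKU)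
  have hq'U := hKU hq'
  have hζq' : ζ q' = 0 := by
    by_cases hh_in : q' ∈ interior Kc
    swap
    · exact hζ0 q' hq' hh_in
    exfalso
    have hloc : IsLocalMax Z q' := by
      have : Kc ∈ 𝓝 q' := mem_interior_iff_mem_nhds.1 hh_in
      exact hmax.isLocalMax this
    have hpos := heat_nonneg_of_isLocalMax (ex := ex) (et := et) hU hZS hq'U hloc
    have e1 : heat ex et Z q' = heat ex et Z1 q' + lam * heat ex et Z2 q' - KK := by
      rw [hZ, heat_sub hU (hZ1S.add ((Sm.const _).mul hZ2S)) ((Sm.const _).mul hTS) hq'U,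
        heat_add hU hZ1S ((Sm.const _).mul hZ2S) hq'U, heat_const_mul hU _ hZ2S hq'U,
        heat_const_mul hU _ hTS hq'U, heat_clm T hT]
      ring
    set A : ℝ := ∑ p, |s p q'| with hA
    set Bq : ℝ := ∑ p : (κ × ι) × ι, |dd (ex p.2) (s p.1) q'| with hBq
    set S : ℝ := ∑ p, s p q' ^ 2 with hS
    set S2 : ℝ := ∑ p : (κ × ι) × ι, dd (ex p.2) (s p.1) q' ^ 2 with hS2
    have hA0 : 0 ≤ A := Finset.sum_nonneg fun _ _ => abs_nonneg _
    have hB0 : 0 ≤ Bq := Finset.sum_nonneg fun _ _ => abs_nonneg _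
    have hS0 : 0 ≤ S := Finset.sum_nonneg fun _ _ => sq_nonneg _
    have hS20 : 0 ≤ S2 := Finset.sum_nonneg fun _ _ => sq_nonneg _
    have hAS : A ^ 2 ≤ n * S := by
      have := sq_sum_le_card_mul_sum_sq (s := Finset.univ) (f := fun p => |s p q'|)
      simp only [sq_abs, Finset.card_univ] at this
      nlinarith
    have hBS : Bq ^ 2 ≤ m * S2 := by
      have := sq_sum_le_card_mul_sum_sq (s := Finset.univ)
        (f := fun p : (κ × ι) × ι => |dd (ex p.2) (s p.1) q'|)
      simp only [sq_abs, Finset.card_univ] at this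
      nlinarith
    have hz2 : ζ q' ^ 2 ≤ 1 := by
      have := hζ1 q' hq'
      rw [← sq_abs]; nlinarith [abs_nonneg (ζ q')]
    have hz0 : 0 ≤ ζ q' ^ 2 := sq_nonneg _
    have b1 : heat ex et Z1 q' ≤ 2 * ζ q' ^ 2 * (A * (C * (1 + A + Bq))) + C0 * S
        - ζ q' ^ 2 * S2 := by
      rw [hZ1, heat_sum hU _ (fun p => (hζ.mul (hsS p)).mul (hζ.mul (hsS p))) hq'U]
      have : ∀ p ∈ (Finset.univ : Finset (κ × ι)),
          heat ex et (fun x => (ζ x * s p x) * (ζ x * s p x)) q' ≤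
          2 * ζ q' ^ 2 * (|s p q'| * (C * (1 + A + Bq))) + C0 * s p q' ^ 2
            - ζ q' ^ 2 * ∑ i, dd (ex i) (s p) q' ^ 2 := by
        intro p _
        refine (heat_cut_sq hU hζ (hsS p) hq'U).trans ?_
        have h1 : s p q' * heat ex et (s p) q' ≤ |s p q'| * (C * (1 + A + Bq)) := by
          refine (le_abs_self _).trans ?_
          rw [abs_mul]
          refine mul_le_mul_of_nonneg_left ?_ (abs_nonneg _)
          rw [hs]
          simp only
          rw [heat_dd hU (hu p.1) _ hq'U]
          exact hdg p.1 p.2 q' hq'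
        have h2 : 2 * (ζ q' * heat ex et ζ q') + 14 * ∑ i, dd (ex i) ζ q' ^ 2 ≤ C0 :=
          (le_abs_self _).trans ((hC0' q' hq').trans (le_max_left _ _))
        have h3 := mul_le_mul_of_nonneg_left h1 (by positivity : 0 ≤ 2 * ζ q' ^ 2)
        have h4 := mul_le_mul_of_nonneg_left h2 (sq_nonneg (s p q'))
        linarith
      refine (Finset.sum_le_sum this).trans (le_of_eq ?_)
      have e8 : S2 = ∑ p, ∑ i, dd (ex i) (s p) q' ^ 2 := by
        rw [hS2]; exact Fintype.sum_prod_type _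
      rw [Finset.sum_sub_distrib, Finset.sum_add_distrib, ← Finset.mul_sum, ← Finset.sum_mul,
        ← Finset.mul_sum, ← Finset.mul_sum, e8]
    have b2 : heat ex et Z2 q' ≤ 2 * M * C * N * (1 + A) - 2 * S := by
      rw [hZ2, heat_sum hU _ (fun p => (hu p).mul (hu p)) hq'U]
      have : ∀ k ∈ (Finset.univ : Finset κ), heat ex et (fun x => u k x * u k x) q' ≤
          2 * (M * (C * (1 + A))) - 2 * ∑ i, s (k, i) q' ^ 2 := by
        intro k _
        rw [heat_mul hU (hu k) (hu k) hq'U]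
        have h1 : u k q' * heat ex et (u k) q' ≤ M * (C * (1 + A)) := by
          refine (le_abs_self _).trans ?_
          rw [abs_mul]
          exact mul_le_mul (huM k q' hq') (hg k q' hq') (abs_nonneg _) hM
        have h2 : ∑ i, dd (ex i) (u k) q' * dd (ex i) (u k) q' = ∑ i, s (k, i) q' ^ 2 :=
          Finset.sum_congr rfl fun i _ => by rw [hs]; ring
        rw [h2]
        linarith
      refine (Finset.sum_le_sum this).trans (le_of_eq ?_)
      rw [Finset.sum_sub_distrib, Finset.sum_const, Finset.card_univ, nsmul_eq_mul,
        ← Finset.mul_sum, hS, Fintype.sum_prod_type, ← hN]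
      ring
    have c1 : 2 * C * (A * Bq) ≤ S2 + m * C ^ 2 * A ^ 2 := by
      have h1 : 0 ≤ (Bq - m * (C * A)) ^ 2 := sq_nonneg _
      have h2 : m * (2 * C * (A * Bq)) ≤ m * (S2 + m * C ^ 2 * A ^ 2) := by nlinarith
      exact le_of_mul_le_mul_left h2 (by linarith)
    have c2 : 2 * (A * (C * (1 + A + Bq))) - S2 ≤ C ^ 2 + (1 + 2 * C + m * C ^ 2) * A ^ 2 := by
      nlinarith [sq_nonneg (C - A)]
    have hX0 : 0 ≤ C ^ 2 + (1 + 2 * C + m * C ^ 2) * A ^ 2 := by positivity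
    have c3 : 2 * ζ q' ^ 2 * (A * (C * (1 + A + Bq))) - ζ q' ^ 2 * S2
        ≤ C ^ 2 + (1 + 2 * C + m * C ^ 2) * A ^ 2 := by
      calc _ = ζ q' ^ 2 * (2 * (A * (C * (1 + A + Bq))) - S2) := by ring
        _ ≤ ζ q' ^ 2 * (C ^ 2 + (1 + 2 * C + m * C ^ 2) * A ^ 2) :=
            mul_le_mul_of_nonneg_left c2 hz0
        _ ≤ 1 * (C ^ 2 + (1 + 2 * C + m * C ^ 2) * A ^ 2) :=
            mul_le_mul_of_nonneg_right hz2 hX0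
        _ = _ := one_mul _
    have c4 : (1 + 2 * C + m * C ^ 2) * A ^ 2 ≤ (1 + 2 * C + m * C ^ 2) * (n * S) :=
      mul_le_mul_of_nonneg_left hAS (by positivity)
    have c5 : 2 * M * C * N * A ≤ S + n * (M * C * N) ^ 2 := by
      have h1 : 0 ≤ (A - n * (M * C * N)) ^ 2 := sq_nonneg _
      have h2 : n * (2 * M * C * N * A) ≤ n * (S + n * (M * C * N) ^ 2) := by nlinarith
      exact le_of_mul_le_mul_left h2 (by linarith)
    have c6 : heat ex et Z2 q' ≤ 2 * M * C * N + n * (M * C * N) ^ 2 - S := by linarith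
    have c7 := mul_le_mul_of_nonneg_left c6 hlam0
    have : heat ex et Z q' ≤ -1 := by
      rw [e1, hKK]
      have : heat ex et Z1 q' ≤ C ^ 2 + lam * S := by rw [hlam]; linarith
      linarith
    linarith
  have hZq' : Z q' ≤ lam * (N * M ^ 2) + KK * T0 := by
    have h1 : Z1 q' = 0 := by simp [hZ1, hζq']
    have h2 : Z2 q' ≤ N * M ^ 2 := by
      calc Z2 q' ≤ ∑ _k : κ, M ^ 2 := Finset.sum_le_sum fun k _ => by
            have := huM k q' hq'
            rw [← sq, ← sq_abs]; gcongr
        _ = _ := by simp [hN]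
    have h3 := (abs_le.1 (hT0 q' hq')).1
    simp only [hZ, h1]
    nlinarith [mul_le_mul_of_nonneg_left h2 hlam0, mul_le_mul_of_nonneg_left h3 hKK0]
  have hZq : (ζ q * s (k, j) q) ^ 2 - KK * T0 ≤ Z q := by
    have h1 : (ζ q * s (k, j) q) ^ 2 ≤ Z1 q := by
      rw [sq]
      exact Finset.single_le_sum (f := fun p => (ζ q * s p q) * (ζ q * s p q))
        (fun p _ => mul_self_nonneg _) (Finset.mem_univ (k, j))
    have h2 : 0 ≤ Z2 q := Finset.sum_nonneg fun k _ => mul_self_nonneg _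
    have h3 := (abs_le.1 (hT0 q hq)).2
    simp only [hZ]
    nlinarith [mul_nonneg hlam0 h2, mul_le_mul_of_nonneg_left h3 hKK0]
  have hfin := hmax hq
  simp only [mem_setOf_eq] at hfin
  refine Real.abs_le_sqrt ?_
  have : (ζ q * s (k, j) q) ^ 2 ≤ lam * (N * M ^ 2) + 2 * KK * T0 := by linarith
  exact this

end heat
end SN

open Set MeasureTheory
set_option linter.unusedSectionVars false
set_option linter.unusedVariables false
namespace SN
open Filter Topology

section sys
variable {X : Type} [NormedAddCommGroup X] [NormedSpace ℝ X]
variable {P : Type}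

/-- Local boundedness uniformly in the parameter. -/
def LBd (U : Set X) (g : P → X → ℝ) : Prop :=
  ∀ q ∈ U, ∃ C : ℝ, ∀ᶠ q' in 𝓝 q, ∀ p, |g p q'| ≤ C

variable {U : Set X}

theorem LBd.compact {g : P → X → ℝ} (hg : LBd U g) {K : Set X} (hK : IsCompact K) (hKU : K ⊆ U) :
    ∃ C : ℝ, 0 ≤ C ∧ ∀ q ∈ K, ∀ p, |g p q| ≤ C := by
  refine hK.induction_on (p := fun s => ∃ C : ℝ, 0 ≤ C ∧ ∀ q ∈ s, ∀ p, |g p q| ≤ C)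
    ⟨0, le_rfl, by simp⟩ ?_ ?_ ?_
  · rintro s t hst ⟨C, hC, h⟩
    exact ⟨C, hC, fun q hq => h q (hst hq)⟩
  · rintro s t ⟨C, hC, h⟩ ⟨C', hC', h'⟩
    refine ⟨max C C', hC.trans (le_max_left _ _), ?_⟩
    rintro q (hq | hq) p
    · exact (h q hq p).trans (le_max_left _ _)
    · exact (h' q hq p).trans (le_max_right _ _)
  · intro q hq
    obtain ⟨C, hC⟩ := hg q (hKU hq)
    exact ⟨_, mem_nhdsWithin_of_mem_nhds hC, max C 0, le_max_right _ _,
      fun q' hq' p => (hq' p).trans (le_max_left _ _)⟩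

theorem LBd.congr (hU : IsOpen U) {f g : P → X → ℝ} (hf : LBd U f)
    (h : ∀ p, EqOn (g p) (f p) U) : LBd U g := by
  intro q hq
  obtain ⟨C, hC⟩ := hf q hq
  refine ⟨C, ?_⟩
  filter_upwards [hC, hU.mem_nhds hq] with q' h1 h2 p
  rw [h p h2]; exact h1 p

theorem LBd.add {f g : P → X → ℝ} (hf : LBd U f) (hg : LBd U g) :
    LBd U (fun p q => f p q + g p q) := by
  intro q hq
  obtain ⟨C, hC⟩ := hf q hq
  obtain ⟨C', hC'⟩ := hg q hq
  refine ⟨C + C', ?_⟩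
  filter_upwards [hC, hC'] with q' h1 h2 p
  exact (abs_add_le _ _).trans (add_le_add (h1 p) (h2 p))

theorem LBd.mul {f g : P → X → ℝ} (hf : LBd U f) (hg : LBd U g) :
    LBd U (fun p q => f p q * g p q) := by
  intro q hq
  obtain ⟨C, hC⟩ := hf q hq
  obtain ⟨C', hC'⟩ := hg q hq
  refine ⟨|C| * |C'|, ?_⟩
  filter_upwards [hC, hC'] with q' h1 h2 p
  rw [abs_mul]
  exact mul_le_mul ((h1 p).trans (le_abs_self _)) ((h2 p).trans (le_abs_self _)) (abs_nonneg _)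
    (abs_nonneg _)

theorem LBd.const (c : ℝ) : LBd U (fun (_ : P) _ => c) :=
  fun _ _ => ⟨|c|, Eventually.of_forall fun _ _ => le_rfl⟩

theorem LBd.sum {κ : Type} (s : Finset κ) {f : κ → P → X → ℝ} (hf : ∀ k, LBd U (f k)) :
    LBd U (fun p q => ∑ k ∈ s, f k p q) := by
  classical
  induction s using Finset.induction_on with
  | empty => simpa using LBd.const 0
  | insert k s hk ih =>
    simp only [Finset.sum_insert hk]
    exact (hf k).add ih

variable {ι : Type} [Fintype ι]

/-- All coordinate directions. -/
def bs (ex : ι → X) (et : X) : ι ⊕ Unit → X := Sum.elim ex (fun _ => et)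

variable {ex : ι → X} {et : X}

/-- All derivatives locally bounded, uniformly in the parameter. -/
def BB (U : Set X) (ex : ι → X) (et : X) (g : P → X → ℝ) : Prop :=
  (∀ p, Sm U (g p)) ∧ ∀ l : List (ι ⊕ Unit), LBd U (fun p => dw (bs ex et) l (g p))

theorem BB.lbd {g : P → X → ℝ} (hg : BB U ex et g) : LBd U g := hg.2 []

theorem BB.dd (hU : IsOpen U) {g : P → X → ℝ} (hg : BB U ex et g) (j : ι ⊕ Unit) :
    BB U ex et (fun p => dd (bs ex et j) (g p)) := by
  refine ⟨fun p => (hg.1 p).dd hU _, fun l => ?_⟩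
  have := hg.2 (l ++ [j])
  simpa only [dw_snoc] using this

theorem BB.congr (hU : IsOpen U) {f g : P → X → ℝ} (hf : BB U ex et f)
    (h : ∀ p, EqOn (g p) (f p) U) : BB U ex et g :=
  ⟨fun p => (hf.1 p).congr (h p), fun l => (hf.2 l).congr hU fun p => dw_congr hU (h p) l⟩

theorem BB.add (hU : IsOpen U) {f g : P → X → ℝ} (hf : BB U ex et f) (hg : BB U ex et g) :
    BB U ex et (fun p q => f p q + g p q) :=
  ⟨fun p => (hf.1 p).add (hg.1 p), fun l => ((hf.2 l).add (hg.2 l)).congr hU fun p =>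
    dw_add hU (hf.1 p) (hg.1 p) l⟩

theorem BB.mul (hU : IsOpen U) {f g : P → X → ℝ} (hf : BB U ex et f) (hg : BB U ex et g) :
    BB U ex et (fun p q => f p q * g p q) := by
  refine ⟨fun p => (hf.1 p).mul (hg.1 p), fun l => ?_⟩
  induction l using List.reverseRecOn generalizing f g with
  | nil => exact hf.lbd.mul hg.lbd
  | append_singleton l j ih =>
    exact ((ih (hf.dd hU j) hg).add (ih hf (hg.dd hU j))).congr hU fun p =>
      dw_snoc_mul hU (hf.1 p) (hg.1 p) l j

theorem BB.const (hU : IsOpen U) (c : ℝ) : BB U ex et (fun (_ : P) _ => c) := by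
  refine ⟨fun p => Sm.const c, fun l => ?_⟩
  induction l using List.reverseRecOn generalizing c with
  | nil => exact LBd.const c
  | append_singleton l j ih =>
    simp only [dw_snoc]
    have : SN.dd (bs ex et j) (fun _ : X => c) = fun _ => 0 := by
      funext x; exact dd_const c x _
    rw [this]; exact ih 0

theorem BB.sum (hU : IsOpen U) {κ : Type} (s : Finset κ) {f : κ → P → X → ℝ}
    (hf : ∀ k, BB U ex et (f k)) : BB U ex et (fun p q => ∑ k ∈ s, f k p q) := by
  classical
  induction s using Finset.induction_on with
  | empty => simpa using BB.const hU 0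
  | insert k s hk ih =>
    simp only [Finset.sum_insert hk]
    exact (hf k).add hU ih

/-- Linear first order expressions in the family `u` with nice coefficients. -/
inductive Lin {κ : Type} (U : Set X) (ex : ι → X) (et : X) (u : κ → P → X → ℝ) :
    (P → X → ℝ) → Prop
  | bb (f : P → X → ℝ) : BB U ex et f → Lin U ex et u f
  | mu (c : P → X → ℝ) (k : κ) : BB U ex et c → Lin U ex et u (fun p q => c p q * u k p q)
  | mdu (c : P → X → ℝ) (k : κ) (i : ι) : BB U ex et c →
      Lin U ex et u (fun p q => c p q * dd (ex i) (u k p) q)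
  | add (f g : P → X → ℝ) : Lin U ex et u f → Lin U ex et u g →
      Lin U ex et u (fun p q => f p q + g p q)

theorem Lin.sm (hU : IsOpen U) {κ : Type} {u : κ → P → X → ℝ} (hu : ∀ k p, Sm U (u k p))
    {g : P → X → ℝ} (hg : Lin U ex et u g) (p : P) : Sm U (g p) := by
  induction hg with
  | bb f hf => exact hf.1 p
  | mu c k hc => exact (hc.1 p).mul (hu k p)
  | mdu c k i hc => exact (hc.1 p).mul ((hu k p).dd hU _)
  | add f g _ _ h1 h2 => exact h1.add h2

theorem Lin.lbd {κ : Type} {u : κ → P → X → ℝ} (hu : ∀ k, LBd U (u k))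
    (hdu : ∀ k i, LBd U (fun p => dd (ex i) (u k p)))
    {g : P → X → ℝ} (hg : Lin U ex et u g) : LBd U g := by
  induction hg with
  | bb f hf => exact hf.lbd
  | mu c k hc => exact hc.lbd.mul (hu k)
  | mdu c k i hc => exact hc.lbd.mul (hdu k i)
  | add f g _ _ h1 h2 => exact h1.add h2

theorem Lin.bound (hU : IsOpen U) {κ : Type} [Fintype κ] {u : κ → P → X → ℝ}
    (hu : ∀ k p, Sm U (u k p)) (hub : ∀ k, LBd U (u k)) {K : Set X} (hK : IsCompact K)
    (hKU : K ⊆ U) {g : P → X → ℝ} (hg : Lin U ex et u g) :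
    ∃ C : ℝ, 0 ≤ C ∧ ∀ p, ∀ q ∈ K,
      |g p q| ≤ C * (1 + ∑ r : κ × ι, |dd (ex r.2) (u r.1 p) q|) ∧
      ∀ j, |dd (ex j) (g p) q| ≤ C * (1 + ∑ r : κ × ι, |dd (ex r.2) (u r.1 p) q|
          + ∑ r : (κ × ι) × ι, |dd (ex r.2) (dd (ex r.1.2) (u r.1.1 p)) q|) := by
  classical
  have hA0 : ∀ p q, 0 ≤ ∑ r : κ × ι, |dd (ex r.2) (u r.1 p) q| :=
    fun p q => Finset.sum_nonneg fun _ _ => abs_nonneg _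
  have hB0 : ∀ p q, 0 ≤ ∑ r : (κ × ι) × ι, |dd (ex r.2) (dd (ex r.1.2) (u r.1.1 p)) q| :=
    fun p q => Finset.sum_nonneg fun _ _ => abs_nonneg _
  have hA1 : ∀ k i p q, |dd (ex i) (u k p) q| ≤ ∑ r : κ × ι, |dd (ex r.2) (u r.1 p) q| :=
    fun k i p q => Finset.single_le_sum (f := fun r : κ × ι => |dd (ex r.2) (u r.1 p) q|)
      (fun _ _ => abs_nonneg _) (Finset.mem_univ (k, i))
  have hB1 : ∀ k i j p q, |dd (ex j) (dd (ex i) (u k p)) q| ≤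
      ∑ r : (κ × ι) × ι, |dd (ex r.2) (dd (ex r.1.2) (u r.1.1 p)) q| :=
    fun k i j p q => Finset.single_le_sum
      (f := fun r : (κ × ι) × ι => |dd (ex r.2) (dd (ex r.1.2) (u r.1.1 p)) q|)
      (fun _ _ => abs_nonneg _) (Finset.mem_univ ((k, i), j))
  -- bounds of a coefficient and its derivatives
  have hcoef : ∀ c : P → X → ℝ, BB U ex et c → ∃ C : ℝ, 0 ≤ C ∧ ∀ q ∈ K, ∀ p,
      |c p q| ≤ C ∧ ∀ j, |dd (ex j) (c p) q| ≤ C := by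
    intro c hc
    obtain ⟨C1, hC1, h1⟩ := hc.lbd.compact hK hKU
    have : LBd U (fun p q => ∑ j, |dd (ex j) (c p) q|) := by
      refine LBd.sum Finset.univ fun j => ?_
      intro q hq
      obtain ⟨C, hC⟩ := (hc.dd hU (Sum.inl j)).lbd q hq
      refine ⟨C, ?_⟩
      filter_upwards [hC] with q' h p
      rw [abs_abs]; exact h p
    obtain ⟨C2, hC2, h2⟩ := this.compact hK hKU
    refine ⟨C1 + C2, by positivity, fun q hq p => ⟨by linarith [h1 q hq p], fun j => ?_⟩⟩
    have h3 := (le_abs_self _).trans (h2 q hq p)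
    have h4 := Finset.single_le_sum (f := fun j => |dd (ex j) (c p) q|)
      (fun _ _ => abs_nonneg _) (Finset.mem_univ j)
    linarith
  induction hg with
  | bb f hf =>
    obtain ⟨C, hC, h⟩ := hcoef f hf
    refine ⟨C, hC, fun p q hq => ⟨?_, fun j => ?_⟩⟩
    · nlinarith [(h q hq p).1, hA0 p q]
    · nlinarith [(h q hq p).2 j, mul_nonneg hC (hA0 p q), mul_nonneg hC (hB0 p q)]
  | mu c k hc =>
    obtain ⟨C, hC, h⟩ := hcoef c hc
    obtain ⟨M, hM, hb⟩ := (hub k).compact hK hKU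
    have hCM := mul_nonneg hC hM
    refine ⟨C * M + C, by positivity, fun p q hq => ⟨?_, fun j => ?_⟩⟩
    · rw [abs_mul]
      have := mul_le_mul (h q hq p).1 (hb q hq p) (abs_nonneg _) hC
      nlinarith [mul_nonneg hCM (hA0 p q), mul_nonneg hC (hA0 p q)]
    · rw [dd_mul ((hc.1 p).diffAt hU (hKU hq)) ((hu k p).diffAt hU (hKU hq))]
      refine (abs_add_le _ _).trans ?_
      rw [abs_mul, abs_mul]
      have h1 := mul_le_mul ((h q hq p).2 j) (hb q hq p) (abs_nonneg _) hC
      have h2 := mul_le_mul (h q hq p).1 (hA1 k j p q) (abs_nonneg _) hC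
      nlinarith [mul_nonneg hCM (hA0 p q), mul_nonneg hC (hB0 p q), mul_nonneg hCM (hB0 p q)]
  | mdu c k i hc =>
    obtain ⟨C, hC, h⟩ := hcoef c hc
    refine ⟨C, hC, fun p q hq => ⟨?_, fun j => ?_⟩⟩
    · rw [abs_mul]
      have := mul_le_mul (h q hq p).1 (hA1 k i p q) (abs_nonneg _) hC
      nlinarith
    · rw [dd_mul ((hc.1 p).diffAt hU (hKU hq)) (((hu k p).dd hU _).diffAt hU (hKU hq))]
      refine (abs_add_le _ _).trans ?_
      rw [abs_mul, abs_mul]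
      have h1 := mul_le_mul ((h q hq p).2 j) (hA1 k i p q) (abs_nonneg _) hC
      have h2 := mul_le_mul (h q hq p).1 (hB1 k i j p q) (abs_nonneg _) hC
      nlinarith
  | add f g hf hg h1 h2 =>
    obtain ⟨C, hC, h⟩ := h1
    obtain ⟨C', hC', h'⟩ := h2
    refine ⟨C + C', by positivity, fun p q hq => ⟨?_, fun j => ?_⟩⟩
    · refine (abs_add_le _ _).trans ?_
      have := (h p q hq).1
      have := (h' p q hq).1
      linarith
    · rw [dd_add ((hf.sm hU hu p).diffAt hU (hKU hq)) ((hg.sm hU hu p).diffAt hU (hKU hq))]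
      refine (abs_add_le _ _).trans ?_
      have := (h p q hq).2 j
      have := (h' p q hq).2 j
      linarith

/-- A finite family of functions solving a linear parabolic system. -/
structure Sys {κ : Type} (U : Set X) (ex : ι → X) (et : X) (u : κ → P → X → ℝ) : Prop where
  sm : ∀ k p, Sm U (u k p)
  bd : ∀ k, LBd U (u k)
  eq : ∀ k, ∃ g, Lin U ex et u g ∧ ∀ p, EqOn (heat ex et (u k p)) (g p) U

theorem Sys.bern [FiniteDimensional ℝ X] (hU : IsOpen U) {κ : Type} [Fintype κ]
    {u : κ → P → X → ℝ} (T : X →L[ℝ] ℝ) (hT : T et = 1)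
    (hu : Sys U ex et u) (k : κ) (i : ι) : LBd U (fun p => dd (ex i) (u k p)) := by
  intro q hq
  obtain ⟨R, hR, hRU⟩ := Metric.isOpen_iff.1 hU q hq
  set Kc := Metric.closedBall q (R / 2) with hKc
  have hK : IsCompact Kc := isCompact_closedBall _ _
  have hKU : Kc ⊆ U := (Metric.closedBall_subset_ball (by linarith)).trans hRU
  let ζ : ContDiffBump q := ⟨R / 4, R / 2, by positivity, by linarith⟩
  choose g hg hgeq using hu.eq
  choose C hC hCb using fun k => (hg k).bound hU hu.sm hu.bd hK hKU
  choose M hM hMb using fun k => (hu.bd k).compact hK hKU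
  have hCle : ∀ k, C k ≤ ∑ k, C k := fun k =>
    Finset.single_le_sum (fun k _ => hC k) (Finset.mem_univ k)
  have hMle : ∀ k, M k ≤ ∑ k, M k := fun k =>
    Finset.single_le_sum (fun k _ => hM k) (Finset.mem_univ k)
  obtain ⟨B, hB⟩ := bernstein (ex := ex) (et := et) (κ := κ) hU hK hKU (ζ := ζ)
    ζ.contDiff.contDiffOn
    (fun q' _ => by rw [abs_of_nonneg ζ.nonneg]; exact ζ.le_one)
    (fun q' hq' hni => by
      refine ζ.zero_of_le_dist ?_
      by_contra hlt
      push Not at hlt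
      exact hni (Metric.ball_subset_interior_closedBall hlt)) T hT
    (C := ∑ k, C k) (M := ∑ k, M k) (Finset.sum_nonneg fun k _ => hC k)
    (Finset.sum_nonneg fun k _ => hM k)
  refine ⟨B, ?_⟩
  filter_upwards [Metric.ball_mem_nhds q (by positivity : (0 : ℝ) < R / 4)] with q' hq' p
  have hq'K : q' ∈ Kc := Metric.ball_subset_closedBall (Metric.ball_subset_ball (by linarith) hq')
  have := hB (fun k => u k p) (fun k => hu.sm k p)
    (fun k x hx => (hMb k x hx p).trans (hMle k))
    (fun k x hx => by
      rw [hgeq k p (hKU hx)]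
      refine ((hCb k p x hx).1).trans (mul_le_mul_of_nonneg_right (hCle k) ?_)
      have : 0 ≤ ∑ r : κ × ι, |dd (ex r.2) (u r.1 p) x| :=
        Finset.sum_nonneg fun _ _ => abs_nonneg _
      linarith)
    (fun k j x hx => by
      rw [dd_congr hU (hgeq k p) (ex j) (hKU hx)]
      refine ((hCb k p x hx).2 j).trans (mul_le_mul_of_nonneg_right (hCle k) ?_)
      have : 0 ≤ ∑ r : κ × ι, |dd (ex r.2) (u r.1 p) x| :=
        Finset.sum_nonneg fun _ _ => abs_nonneg _
      have : 0 ≤ ∑ r : (κ × ι) × ι, |dd (ex r.2) (dd (ex r.1.2) (u r.1.1 p)) x| :=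
        Finset.sum_nonneg fun _ _ => abs_nonneg _
      linarith)
    q' hq'K k i
  rwa [ζ.one_of_mem_closedBall (Metric.ball_subset_closedBall hq'), one_mul] at this

/-- Adjoin derivatives to a family. -/
noncomputable def uext {κ α : Type} (ex : ι → X) (et : X) (A : α → ι ⊕ Unit) (u : κ → P → X → ℝ) :
    κ × Option α → P → X → ℝ
  | (k, none) => u k
  | (k, some a) => fun p => dd (bs ex et (A a)) (u k p)

theorem Lin.ext1 {κ α : Type} {u : κ → P → X → ℝ} (A : α → ι ⊕ Unit)
    {g : P → X → ℝ} (hg : Lin U ex et u g) : Lin U ex et (uext ex et A u) g := by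
  induction hg with
  | bb f hf => exact .bb f hf
  | mu c k hc => exact .mu c (k, none) hc
  | mdu c k i hc => exact .mdu c (k, none) i hc
  | add f g _ _ h1 h2 => exact .add _ _ h1 h2

theorem Lin.ext2 (hU : IsOpen U) {κ α : Type} {u : κ → P → X → ℝ} (hu : ∀ k p, Sm U (u k p))
    (A : α → ι ⊕ Unit) (a : α)
    {g : P → X → ℝ} (hg : Lin U ex et u g) :
    ∃ g', Lin U ex et (uext ex et A u) g' ∧ ∀ p, EqOn (dd (bs ex et (A a)) (g p)) (g' p) U := by
  induction hg with
  | bb f hf => exact ⟨_, .bb _ (hf.dd hU (A a)), fun p x _ => rfl⟩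
  | mu c k hc =>
    refine ⟨_, .add _ _ (.mu _ (k, none) (hc.dd hU (A a))) (.mu c (k, some a) hc), ?_⟩
    intro p x hx
    exact dd_mul ((hc.1 p).diffAt hU hx) ((hu k p).diffAt hU hx) _
  | mdu c k i hc =>
    refine ⟨_, .add _ _ (.mdu _ (k, none) i (hc.dd hU (A a))) (.mdu c (k, some a) i hc), ?_⟩
    intro p x hx
    rw [dd_mul ((hc.1 p).diffAt hU hx) (((hu k p).dd hU _).diffAt hU hx)]
    simp only [uext]
    rw [dd_comm hU (hu k p) _ _ hx]
  | add f g hf hg h1 h2 =>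
    obtain ⟨f', hf', e1⟩ := h1
    obtain ⟨g', hg', e2⟩ := h2
    refine ⟨_, .add _ _ hf' hg', ?_⟩
    intro p x hx
    rw [dd_add ((hf.sm hU hu p).diffAt hU hx) ((hg.sm hU hu p).diffAt hU hx), e1 p hx, e2 p hx]

theorem Sys.ext (hU : IsOpen U) {κ α : Type} {u : κ → P → X → ℝ} (hu : Sys U ex et u)
    (A : α → ι ⊕ Unit) (hA : ∀ k a, LBd U (fun p => dd (bs ex et (A a)) (u k p))) :
    Sys U ex et (uext ex et A u) := by
  refine ⟨?_, ?_, ?_⟩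
  · rintro ⟨k, _ | a⟩ p
    · exact hu.sm k p
    · exact (hu.sm k p).dd hU _
  · rintro ⟨k, _ | a⟩
    · exact hu.bd k
    · exact hA k a
  · rintro ⟨k, _ | a⟩
    · obtain ⟨g, hg, e⟩ := hu.eq k
      exact ⟨g, hg.ext1 A, e⟩
    · obtain ⟨g, hg, e⟩ := hu.eq k
      obtain ⟨g', hg', e'⟩ := hg.ext2 hU hu.sm A a
      refine ⟨g', hg', fun p x hx => ?_⟩
      simp only [uext]
      rw [heat_dd hU (hu.sm k p) _ hx, dd_congr hU (e p) _ hx, e' p hx]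

theorem Sys.all [FiniteDimensional ℝ X] (hU : IsOpen U) {κ : Type} [Fintype κ]
    {u : κ → P → X → ℝ} (T : X →L[ℝ] ℝ) (hT : T et = 1)
    (hu : Sys U ex et u) (k : κ) (j : ι ⊕ Unit) : LBd U (fun p => dd (bs ex et j) (u k p)) := by
  rcases j with i | ⟨⟩
  · exact hu.bern hU T hT k i
  · have h1 : ∀ k i, LBd U (fun p => dd (ex i) (u k p)) := fun k i => hu.bern hU T hT k i
    have hs := hu.ext hU (A := fun i : ι => (Sum.inl i : ι ⊕ Unit)) h1
    have h2 : ∀ i, LBd U (fun p => dd (ex i) (dd (ex i) (u k p))) := fun i =>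
      hs.bern hU T hT (k, some i) i
    obtain ⟨g, hg, e⟩ := hu.eq k
    refine ((hg.lbd hu.bd h1).add (LBd.sum Finset.univ h2)).congr hU fun p x hx => ?_
    have e1 := e p hx
    simp only [heat] at e1
    simp only [bs, Sum.elim_inr]
    linarith

theorem Sys.words [FiniteDimensional ℝ X] (hU : IsOpen U) (T : X →L[ℝ] ℝ) (hT : T et = 1)
    (l : List (ι ⊕ Unit)) : ∀ {κ : Type} [Fintype κ]
    {u : κ → P → X → ℝ}, Sys U ex et u → ∀ k, LBd U (fun p => dw (bs ex et) l (u k p)) := by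
  induction l using List.reverseRecOn with
  | nil => exact fun hu k => hu.bd k
  | append_singleton l j ih =>
    intro κ _ u hu k
    have := ih (hu.ext hU (A := fun j : ι ⊕ Unit => j) (hu.all hU T hT)) (k, some j)
    simp only [dw_snoc]
    exact this

/-- Interior regularity, uniformly in the parameter. -/
theorem BB_of_eq [FiniteDimensional ℝ X] (hU : IsOpen U) (T : X →L[ℝ] ℝ) (hT : T et = 1)
    {v a f : P → X → ℝ} {b : ι → P → X → ℝ} (hv : ∀ p, Sm U (v p)) (hvb : LBd U v)
    (ha : BB U ex et a) (hb : ∀ i, BB U ex et (b i)) (hf : BB U ex et f)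
    (heq : ∀ p, ∀ q ∈ U, heat ex et (v p) q
      = a p q * v p q + ∑ i, b i p q * dd (ex i) (v p) q + f p q) :
    BB U ex et v := by
  classical
  refine ⟨hv, fun l => ?_⟩
  have : Sys U ex et (fun (_ : Unit) => v) := by
    refine ⟨fun _ => hv, fun _ => hvb, fun _ => ?_⟩
    have hsum : ∀ s : Finset ι, Lin U ex et (fun (_ : Unit) => v)
        (fun p q => ∑ i ∈ s, b i p q * dd (ex i) (v p) q) := by
      intro s
      induction s using Finset.induction_on with
      | empty => simpa using Lin.bb _ (BB.const hU 0)
      | insert k s hk ih =>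
        simp only [Finset.sum_insert hk]
        exact .add _ _ (.mdu (b k) () k (hb k)) ih
    exact ⟨_, .add _ _ (.add _ _ (.mu a () ha) (hsum Finset.univ)) (.bb f hf),
      fun p q hq => heq p q hq⟩
  exact this.words hU T hT l ()

end sys
end SN

open Set MeasureTheory
set_option linter.unusedSectionVars false
set_option linter.unusedVariables false
namespace SN
open Filter Topology

section lim
variable {X : Type} [NormedAddCommGroup X] [NormedSpace ℝ X] [FiniteDimensional ℝ X]
variable {κ : Type} [Fintype κ] (b : Module.Basis κ ℝ X) {U : Set X}

/-- A tower of words closed under partial derivatives gives smooth functions. -/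
theorem contDiffOn_of_words (hU : IsOpen U) {W : List κ → X → ℝ}
    (hc : ∀ l, ContinuousOn (W l) U)
    (hd : ∀ l, ∀ q ∈ U, ∀ j, HasDerivAt (fun s : ℝ => W l (q + s • b j)) (W (j :: l) q) 0) :
    (∀ l, Sm U (W l)) ∧ ∀ l, EqOn (dw b l (W [])) (W l) U := by
  have hF : ∀ l, ∀ q ∈ U, HasFDerivAt (W l)
      (∑ j, W (j :: l) q • (LinearMap.toContinuousLinearMap (b.coord j))) q := fun l q hq =>
    hasFDerivAt_of_partials b hU (G := fun j q => W (j :: l) q) (fun j => hc (j :: l)) (hd l) hq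
  have hn : ∀ n : ℕ, ∀ l, ContDiffOn ℝ n (W l) U := by
    intro n
    induction n with
    | zero => intro l; exact contDiffOn_zero.2 (hc l)
    | succ n ih =>
      intro l
      have := (contDiffOn_succ_iff_fderiv_of_isOpen (𝕜 := ℝ) (n := (n : WithTop ℕ∞))
        (f := W l) hU).2
        ⟨fun q hq => (hF l q hq).differentiableAt.differentiableWithinAt, by simp, ?_⟩
      · exact_mod_cast this
      · have h2 : ContDiffOn ℝ n (fun q => ∑ j, W (j :: l) q •
            (LinearMap.toContinuousLinearMap (b.coord j))) U :=
          ContDiffOn.sum fun j _ => (ih (j :: l)).smul contDiffOn_const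
        exact h2.congr fun q hq => (hF l q hq).fderiv
  have hs : ∀ l, Sm U (W l) := fun l => contDiffOn_infty.2 fun n => hn n l
  refine ⟨hs, fun l => ?_⟩
  induction l with
  | nil => exact fun _ _ => rfl
  | cons j l ih =>
    intro q hq
    rw [dw_cons, dd_congr hU ih _ hq]
    have h1 := hasDerivAt_line (f := W l) (q := q) (e := b j) (s := 0)
      (by simpa using (hs l).diffAt hU hq)
    have := h1.unique (hd l q hq j)
    simpa using this

/-- second order Taylor estimate on a line -/
theorem taylor_line (hU : IsOpen U) {f : X → ℝ} (hf : Sm U f) (e : X) {C h : ℝ} (q : X)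
    (hseg : ∀ s ∈ Set.uIcc 0 h, q + s • e ∈ U)
    (hC : ∀ s ∈ Set.uIcc 0 h, |dd e (dd e f) (q + s • e)| ≤ C) :
    |f (q + h • e) - f q - h * dd e f q| ≤ C * |h| * |h| := by
  have hconv : Convex ℝ (Set.uIcc (0:ℝ) h) := convex_uIcc 0 h
  have h0 : (0:ℝ) ∈ Set.uIcc (0:ℝ) h := Set.left_mem_uIcc
  have hh : h ∈ Set.uIcc (0:ℝ) h := Set.right_mem_uIcc
  have hC0 : 0 ≤ C := (abs_nonneg _).trans (hC 0 h0)
  have h1 : ∀ s ∈ Set.uIcc 0 h, |dd e f (q + s • e) - dd e f q| ≤ C * |h| := by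
    intro s hs
    have := hconv.norm_image_sub_le_of_norm_hasDerivWithin_le
      (f := fun s : ℝ => dd e f (q + s • e)) (f' := fun s => dd e (dd e f) (q + s • e)) (C := C)
      (fun s hs => (hasDerivAt_line ((hf.dd hU e).diffAt hU (hseg s hs))).hasDerivWithinAt)
      (fun s hs => hC s hs) h0 hs
    simp only [zero_smul, add_zero, sub_zero, Real.norm_eq_abs] at this
    refine this.trans (mul_le_mul_of_nonneg_left ?_ hC0)
    have := Set.abs_sub_left_of_mem_uIcc hs
    simpa using this
  have := hconv.norm_image_sub_le_of_norm_hasDerivWithin_le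
      (f := fun s : ℝ => f (q + s • e) - s * dd e f q)
      (f' := fun s => dd e f (q + s • e) - dd e f q) (C := C * |h|)
      (fun s hs => by
        have h2 := (hasDerivAt_line (hf.diffAt hU (hseg s hs)))
        have h3 := (hasDerivAt_id s).mul_const (dd e f q)
        simp only [id, one_mul] at h3
        exact (h2.sub h3).hasDerivWithinAt)
      (fun s hs => h1 s hs) h0 hh
  simp only [zero_smul, add_zero, sub_zero, Real.norm_eq_abs, zero_mul] at this
  rw [show f (q + h • e) - f q - h * dd e f q = f (q + h • e) - h * dd e f q - f q by ring]
  exact this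

variable {P : Type} [TopologicalSpace P]

theorem lim_step (hU : IsOpen U) (P0 : Set P) (hP0 : Dense P0) (e : X) {g : P → X → ℝ}
    (hg : ContinuousOn (fun z : X × P => g z.2 z.1) (U ×ˢ univ))
    (hs : ∀ p ∈ P0, Sm U (g p))
    (hb : LBd U (fun (p : P0) => dd e (dd e (g p)))) :
    ContinuousOn (fun z : X × P => deriv (fun s : ℝ => g z.2 (z.1 + s • e)) 0) (U ×ˢ univ) ∧
    ∀ p, ∀ q ∈ U, HasDerivAt (fun s : ℝ => g p (q + s • e))
      (deriv (fun s : ℝ => g p (q + s • e)) 0) 0 := by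
  -- local estimate
  have key : ∀ q0 ∈ U, ∃ δ > 0, ∃ δ' > 0, ∃ C ≥ 0, (∀ q ∈ Metric.ball q0 δ, ∀ s : ℝ, |s| < δ' →
      q + s • e ∈ U) ∧ ∀ q ∈ Metric.ball q0 δ, ∀ p, ∀ h h' : ℝ, h ≠ 0 → h' ≠ 0 →
      |h| < δ' → |h'| < δ' →
      |h⁻¹ * (g p (q + h • e) - g p q) - h'⁻¹ * (g p (q + h' • e) - g p q)| ≤ C * (|h| + |h'|) := by
    intro q0 hq0
    obtain ⟨C, hC⟩ := hb q0 hq0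
    obtain ⟨δ, hδ, hδb⟩ := Metric.eventually_nhds_iff_ball.1 (hC.and (hU.mem_nhds hq0))
    have hmem : ∀ q ∈ Metric.ball q0 (δ / 2), ∀ s : ℝ, |s| < δ / (2 * (‖e‖ + 1)) →
        q + s • e ∈ Metric.ball q0 δ := by
      intro q hq s hs
      rw [Metric.mem_ball, dist_eq_norm] at *
      have hn : 0 < ‖e‖ + 1 := by positivity
      rw [lt_div_iff₀ (by positivity)] at hs
      have : ‖s • e‖ < δ / 2 := by
        rw [norm_smul, Real.norm_eq_abs]
        nlinarith [abs_nonneg s, norm_nonneg e, abs_nonneg (s)]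
      calc ‖q + s • e - q0‖ = ‖(q - q0) + s • e‖ := by congr 1; abel
        _ ≤ ‖q - q0‖ + ‖s • e‖ := norm_add_le _ _
        _ < δ := by linarith
    have hCC : ∀ q ∈ Metric.ball q0 δ, ∀ p : P0, |dd e (dd e (g p)) q| ≤ max C 0 :=
      fun q hq p => ((hδb q hq).1 p).trans (le_max_left _ _)
    refine ⟨δ / 2, by positivity, δ / (2 * (‖e‖ + 1)), by positivity, max C 0, le_max_right _ _,
      fun q hq s hs => (hδb _ (hmem q hq s hs)).2, ?_⟩
    intro q hq p h h' h0 h0' hh hh'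
    have hqU : ∀ s : ℝ, |s| < δ / (2 * (‖e‖ + 1)) → q + s • e ∈ U :=
      fun s hs => (hδb _ (hmem q hq s hs)).2
    have hq' : q ∈ U := by simpa using hqU 0 (by simpa using by positivity)
    have hcontp : ∀ x ∈ U, Continuous (fun p => g p x) := by
      intro x hx
      have : ContinuousOn (fun p => g p x) univ :=
        hg.comp (f := fun p : P => (x, p)) (by fun_prop) (fun p _ => ⟨hx, mem_univ _⟩)
      exact continuousOn_univ.1 this
    have hcl : IsClosed {p | |h⁻¹ * (g p (q + h • e) - g p q)
        - h'⁻¹ * (g p (q + h' • e) - g p q)| ≤ max C 0 * (|h| + |h'|)} := by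
      refine isClosed_le ?_ continuous_const
      have c1 := hcontp _ (hqU h hh)
      have c2 := hcontp _ (hqU h' hh')
      have c3 := hcontp _ hq'
      fun_prop
    have hsub : P0 ⊆ {p | |h⁻¹ * (g p (q + h • e) - g p q)
        - h'⁻¹ * (g p (q + h' • e) - g p q)| ≤ max C 0 * (|h| + |h'|)} := by
      intro p hp
      have hone : ∀ h : ℝ, h ≠ 0 → |h| < δ / (2 * (‖e‖ + 1)) →
          |h⁻¹ * (g p (q + h • e) - g p q) - dd e (g p) q| ≤ max C 0 * |h| := by
        intro h h0 hh
        have hle : ∀ s ∈ Set.uIcc 0 h, |s| < δ / (2 * (‖e‖ + 1)) := fun s hs => by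
          have := Set.abs_sub_left_of_mem_uIcc hs
          simp only [sub_zero] at this
          exact this.trans_lt hh
        have := taylor_line hU (hs p hp) e (C := max C 0) (h := h) q (fun s hs => hqU s (hle s hs))
          (fun s hs => hCC _ (hmem q hq s (hle s hs)) ⟨p, hp⟩)
        have e1 : h⁻¹ * (g p (q + h • e) - g p q) - dd e (g p) q
            = h⁻¹ * (g p (q + h • e) - g p q - h * dd e (g p) q) := by field_simp
        rw [e1, abs_mul, abs_inv, inv_mul_le_iff₀ (abs_pos.2 h0)]
        linarith
      have a1 := hone h h0 hh
      have a2 := hone h' h0' hh'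
      have := abs_sub_le (h⁻¹ * (g p (q + h • e) - g p q)) (dd e (g p) q)
        (h'⁻¹ * (g p (q + h' • e) - g p q))
      rw [abs_sub_comm (dd e (g p) q)] at this
      simp only [mem_ofPred_eq]
      linarith
    exact (hcl.closure_subset_iff.2 hsub) (hP0 p)
  -- existence of the derivative, with a rate
  have key2 : ∀ q0 ∈ U, ∃ δ > 0, ∃ δ' > 0, ∃ C ≥ 0, (∀ q ∈ Metric.ball q0 δ, ∀ s : ℝ, |s| < δ' →
      q + s • e ∈ U) ∧ ∀ q ∈ Metric.ball q0 δ, ∀ p, 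
      HasDerivAt (fun s : ℝ => g p (q + s • e)) (deriv (fun s : ℝ => g p (q + s • e)) 0) 0 ∧
      ∀ h : ℝ, h ≠ 0 → |h| < δ' → |h⁻¹ * (g p (q + h • e) - g p q)
        - deriv (fun s : ℝ => g p (q + s • e)) 0| ≤ C * |h| := by
    intro q0 hq0
    obtain ⟨δ, hδ, δ', hδ', C, hC, hin, hk⟩ := key q0 hq0
    refine ⟨δ, hδ, δ', hδ', C, hC, hin, fun q hq p => ?_⟩
    have hcau : Cauchy (map (fun h : ℝ => h⁻¹ * (g p (q + h • e) - g p q)) (𝓝[≠] 0)) := by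
      rw [Metric.cauchy_iff]
      refine ⟨inferInstance, fun ε hε => ?_⟩
      have hpos : 0 < min δ' (ε / (2 * (C + 1))) := lt_min hδ' (by positivity)
      refine ⟨(fun h : ℝ => h⁻¹ * (g p (q + h • e) - g p q)) ''
        {h : ℝ | h ≠ 0 ∧ |h| < min δ' (ε / (2 * (C + 1)))}, image_mem_map ?_, ?_⟩
      · rw [mem_nhdsWithin]
        refine ⟨Metric.ball 0 _, Metric.isOpen_ball, Metric.mem_ball_self hpos, ?_⟩
        rintro h ⟨h1, h2⟩
        exact ⟨h2, by simpa using h1⟩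
      · rintro _ ⟨h, ⟨h0, hh⟩, rfl⟩ _ ⟨h', ⟨h0', hh'⟩, rfl⟩
        rw [Real.dist_eq]
        refine (hk q hq p h h' h0 h0' (hh.trans_le (min_le_left _ _))
          (hh'.trans_le (min_le_left _ _))).trans_lt ?_
        have a1 := hh.trans_le (min_le_right _ _)
        have a2 := hh'.trans_le (min_le_right _ _)
        rw [lt_div_iff₀ (by positivity)] at a1 a2
        nlinarith [abs_nonneg h, abs_nonneg h']
    obtain ⟨L, hL⟩ := CompleteSpace.complete hcau
    have hD : HasDerivAt (fun s : ℝ => g p (q + s • e)) L 0 := by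
      rw [hasDerivAt_iff_tendsto_slope_zero]
      simpa [Filter.Tendsto] using hL
    rw [hD.deriv]
    refine ⟨hD, fun h h0 hh => ?_⟩
    have ht : Tendsto (fun h' : ℝ => |h⁻¹ * (g p (q + h • e) - g p q)
        - h'⁻¹ * (g p (q + h' • e) - g p q)|) (𝓝[≠] 0)
        (𝓝 |h⁻¹ * (g p (q + h • e) - g p q) - L|) :=
      (tendsto_const_nhds.sub (show Tendsto _ _ _ from hL)).abs
    have ht2 : Tendsto (fun h' : ℝ => C * (|h| + |h'|)) (𝓝[≠] 0) (𝓝 (C * (|h| + |(0:ℝ)|))) :=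
      (Continuous.tendsto (by fun_prop) 0).mono_left nhdsWithin_le_nhds
    have := le_of_tendsto_of_tendsto ht ht2 (by
      have : ∀ᶠ h' : ℝ in 𝓝[≠] 0, h' ∈ Metric.ball (0:ℝ) δ' ∧ h' ≠ 0 :=
        Filter.inter_mem (mem_nhdsWithin_of_mem_nhds (Metric.ball_mem_nhds _ hδ'))
          self_mem_nhdsWithin
      filter_upwards [this] with h' h1
      exact hk q hq p h h' h0 h1.2 hh (by simpa using h1.1))
    simpa using this
  refine ⟨?_, fun p q hq => ?_⟩
  · rintro ⟨q0, p0⟩ ⟨hq0, -⟩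
    obtain ⟨δ, hδ, δ', hδ', C, hC, hin, hk⟩ := key2 q0 hq0
    apply ContinuousAt.continuousWithinAt
    rw [Metric.continuousAt_iff']
    intro ε hε
    obtain ⟨h, h0, hh1, hh2⟩ : ∃ h : ℝ, h ≠ 0 ∧ |h| < δ' ∧ C * |h| < ε / 3 := by
      have hpos : 0 < min δ' (ε / (3 * (C + 1))) := lt_min hδ' (by positivity)
      refine ⟨min δ' (ε / (3 * (C + 1))) / 2, by positivity, ?_, ?_⟩
      · rw [abs_of_pos (by positivity)]
        linarith [min_le_left δ' (ε / (3 * (C + 1)))]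
      · rw [abs_of_pos (by positivity)]
        have := min_le_right δ' (ε / (3 * (C + 1)))
        rw [le_div_iff₀ (by positivity)] at this
        nlinarith
    have hcQ : ContinuousAt (fun z : X × P => h⁻¹ * (g z.2 (z.1 + h • e) - g z.2 z.1)) (q0, p0) := by
      have hop : IsOpen (U ×ˢ (univ : Set P)) := hU.prod isOpen_univ
      have c1 : ContinuousAt (fun z : X × P => g z.2 z.1) (q0, p0) :=
        hg.continuousAt (hop.mem_nhds ⟨hq0, mem_univ _⟩)
      have c2 : ContinuousAt (fun z : X × P => g z.2 (z.1 + h • e)) (q0, p0) := by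
        have : ContinuousAt (fun z : X × P => g z.2 z.1) (q0 + h • e, p0) :=
          hg.continuousAt (hop.mem_nhds ⟨hin q0 (Metric.mem_ball_self hδ) h hh1, mem_univ _⟩)
        exact ContinuousAt.comp (g := fun z : X × P => g z.2 z.1)
          (f := fun z : X × P => (z.1 + h • e, z.2)) (x := (q0, p0)) this (by fun_prop)
      exact continuousAt_const.mul (c2.sub c1)
    rw [Metric.continuousAt_iff'] at hcQ
    have hb : ∀ᶠ z : X × P in 𝓝 (q0, p0), z.1 ∈ Metric.ball q0 δ :=
      (continuous_fst.tendsto (q0, p0)).eventually (Metric.ball_mem_nhds _ hδ)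
    filter_upwards [hcQ (ε / 3) (by positivity), hb] with z hz1 hz2
    have a1 := (hk z.1 hz2 z.2).2 h h0 hh1
    have a2 := (hk q0 (Metric.mem_ball_self hδ) p0).2 h h0 hh1
    rw [Real.dist_eq] at *
    rw [abs_lt] at *
    rw [abs_le] at *
    constructor <;> linarith [a1.1, a1.2, a2.1, a2.2, hz1.1, hz1.2]
  · obtain ⟨δ, hδ, δ', hδ', C, hC, hin, hk⟩ := key2 q hq
    exact (hk q (Metric.mem_ball_self hδ) p).1

/-- line-derivative words -/
noncomputable def lw (b : κ → X) (f : X → ℝ) : List κ → X → ℝ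
  | [] => f
  | j :: l => fun q => deriv (fun s : ℝ => lw b f l (q + s • b j)) 0

theorem lim_words (hU : IsOpen U) (P0 : Set P) (hP0 : Dense P0) {g : P → X → ℝ}
    (hg : ContinuousOn (fun z : X × P => g z.2 z.1) (U ×ˢ univ))
    (hs : ∀ p ∈ P0, Sm U (g p))
    (hb : ∀ l : List κ, LBd U (fun (p : P0) => dw b l (g p))) :
    (∀ p, Sm U (g p)) ∧ ∀ l : List κ,
      ContinuousOn (fun z : X × P => dw b l (g z.2) z.1) (U ×ˢ univ) := by
  have key : ∀ l : List κ, ContinuousOn (fun z : X × P => lw b (g z.2) l z.1) (U ×ˢ univ) ∧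
      (∀ p ∈ P0, EqOn (lw b (g p) l) (dw b l (g p)) U) ∧
      ∀ j, ∀ p, ∀ q ∈ U, HasDerivAt (fun s : ℝ => lw b (g p) l (q + s • b j))
        (lw b (g p) (j :: l) q) 0 := by
    intro l
    have aux : ∀ l : List κ, ContinuousOn (fun z : X × P => lw b (g z.2) l z.1) (U ×ˢ univ) →
      (∀ p ∈ P0, EqOn (lw b (g p) l) (dw b l (g p)) U) → ∀ j : κ,
      ContinuousOn (fun z : X × P => lw b (g z.2) (j :: l) z.1) (U ×ˢ univ) ∧
      ∀ p, ∀ q ∈ U, HasDerivAt (fun s : ℝ => lw b (g p) l (q + s • b j))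
        (lw b (g p) (j :: l) q) 0 := by
      intro l h1 h2 j
      exact lim_step hU P0 hP0 (b j) (g := fun p => lw b (g p) l) h1
        (fun p hp => ((hs p hp).dw hU l).congr (h2 p hp))
        ((hb (j :: j :: l)).congr hU fun p => dd_congr hU (dd_congr hU (h2 p p.2) _) _)
    have main : ContinuousOn (fun z : X × P => lw b (g z.2) l z.1) (U ×ˢ univ) ∧
      (∀ p ∈ P0, EqOn (lw b (g p) l) (dw b l (g p)) U) := by
      induction l with
      | nil => exact ⟨hg, fun p _ q _ => rfl⟩
      | cons j l ih =>
        obtain ⟨a1, a2⟩ := aux l ih.1 ih.2 j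
        refine ⟨a1, fun p hp q hq => ?_⟩
        have hsm : Sm U (lw b (g p) l) := ((hs p hp).dw hU l).congr (ih.2 p hp)
        have h1 := hasDerivAt_line (f := lw b (g p) l) (q := q) (e := b j) (s := 0)
          (by simpa using hsm.diffAt hU hq)
        have := (a2 p q hq).unique h1
        rw [this, dw_cons, ← dd_congr hU (ih.2 p hp) _ hq]
        simp
    exact ⟨main.1, main.2, fun j => (aux l main.1 main.2 j).2⟩
  have hw : ∀ p, (∀ l, Sm U (lw b (g p) l)) ∧ ∀ l, EqOn (dw b l (g p)) (lw b (g p) l) U := fun p =>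
    contDiffOn_of_words b hU (W := lw b (g p))
      (fun l => (key l).1.comp (f := fun q : X => (q, p)) (by fun_prop)
        (fun q hq => ⟨hq, mem_univ _⟩))
      (fun l q hq j => (key l).2.2 j p q hq)
  exact ⟨fun p => (hw p).1 [], fun l => (key l).1.congr fun z hz => (hw z.2).2 l hz.1⟩

end lim
end SN

open Set MeasureTheory
set_option linter.unusedSectionVars false
set_option linter.unusedVariables false
namespace SN
open Filter Topology

section kc
variable {X : Type} [NormedAddCommGroup X] [NormedSpace ℝ X] [FiniteDimensional ℝ X]
variable {κ : Type} [Fintype κ] {b : κ → X} {U : Set X} {J : Set ℝ}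

/-- smooth in `X`, all derivatives jointly continuous -/
def KC0 (b : κ → X) (U : Set X) (J : Set ℝ) (F : ℝ → X → ℝ) : Prop :=
  (∀ τ ∈ J, Sm U (F τ)) ∧
  ∀ l : List κ, ContinuousOn (fun z : X × ℝ => dw b l (F z.2) z.1) (U ×ˢ J)

/-- `F'` is the parameter derivative of `F` -/
def Der (b : κ → X) (U : Set X) (J : Set ℝ) (F F' : ℝ → X → ℝ) : Prop :=
  ∀ l : List κ, ∀ τ ∈ J, ∀ q ∈ U, HasDerivAt (fun σ => dw b l (F σ) q) (dw b l (F' τ) q) τ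

/-- the class of functions with `n` parameter derivatives -/
def KC (b : κ → X) (U : Set X) (J : Set ℝ) : ℕ → (ℝ → X → ℝ) → Prop
  | 0, F => KC0 b U J F
  | n + 1, F => KC0 b U J F ∧ ∃ F', KC b U J n F' ∧ Der b U J F F'

theorem KC.zero {n : ℕ} {F : ℝ → X → ℝ} (h : KC b U J n F) : KC0 b U J F := by
  cases n with
  | zero => exact h
  | succ n => exact h.1

theorem KC.pred {n : ℕ} {F : ℝ → X → ℝ} (h : KC b U J (n + 1) F) : KC b U J n F := by
  induction n generalizing F with
  | zero => exact h.1
  | succ n ih =>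
    obtain ⟨h0, F', h1, h2⟩ := h
    exact ⟨h0, F', ih h1, h2⟩

theorem KC0.congr (hU : IsOpen U) {F G : ℝ → X → ℝ} (h : KC0 b U J F)
    (e : ∀ τ ∈ J, EqOn (G τ) (F τ) U) : KC0 b U J G :=
  ⟨fun τ hτ => (h.1 τ hτ).congr (e τ hτ), fun l => (h.2 l).congr fun z hz =>
    dw_congr hU (e z.2 hz.2) l hz.1⟩

theorem Der.congr (hU : IsOpen U) (hJ : IsOpen J) {F G F' : ℝ → X → ℝ} (h : Der b U J F F')
    (e : ∀ τ ∈ J, EqOn (G τ) (F τ) U) : Der b U J G F' := by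
  intro l τ hτ q hq
  refine (h l τ hτ q hq).congr_of_eventuallyEq ?_
  filter_upwards [hJ.mem_nhds hτ] with σ hσ
  exact dw_congr hU (e σ hσ) l hq

theorem Der.congr' (hU : IsOpen U) {F F' G' : ℝ → X → ℝ} (h : Der b U J F F')
    (e : ∀ τ ∈ J, EqOn (G' τ) (F' τ) U) : Der b U J F G' := by
  intro l τ hτ q hq
  rw [dw_congr hU (e τ hτ) l hq]
  exact h l τ hτ q hq

theorem KC.congr (hU : IsOpen U) (hJ : IsOpen J) {n : ℕ} {F G : ℝ → X → ℝ} (h : KC b U J n F)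
    (e : ∀ τ ∈ J, EqOn (G τ) (F τ) U) : KC b U J n G := by
  cases n with
  | zero => exact KC0.congr hU h e
  | succ n =>
    obtain ⟨h0, F', h1, h2⟩ := h
    exact ⟨h0.congr hU e, F', h1, h2.congr hU hJ e⟩

theorem KC0.dd (hU : IsOpen U) {F : ℝ → X → ℝ} (h : KC0 b U J F) (j : κ) :
    KC0 b U J (fun τ => dd (b j) (F τ)) := by
  refine ⟨fun τ hτ => (h.1 τ hτ).dd hU _, fun l => ?_⟩
  have := h.2 (l ++ [j])
  simpa only [dw_snoc] using this

theorem Der.dd {F F' : ℝ → X → ℝ} (h : Der b U J F F') (j : κ) :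
    Der b U J (fun τ => dd (b j) (F τ)) (fun τ => SN.dd (b j) (F' τ)) := by
  intro l
  have := h (l ++ [j])
  simpa only [dw_snoc] using this

theorem KC.dd (hU : IsOpen U) {n : ℕ} {F : ℝ → X → ℝ} (h : KC b U J n F) (j : κ) :
    KC b U J n (fun τ => dd (b j) (F τ)) := by
  induction n generalizing F with
  | zero => exact KC0.dd hU h j
  | succ n ih =>
    obtain ⟨h0, F', h1, h2⟩ := h
    exact ⟨h0.dd hU j, _, ih h1, h2.dd j⟩

theorem KC0.add (hU : IsOpen U) {F G : ℝ → X → ℝ} (h : KC0 b U J F) (h' : KC0 b U J G) :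
    KC0 b U J (fun τ q => F τ q + G τ q) :=
  ⟨fun τ hτ => (h.1 τ hτ).add (h'.1 τ hτ), fun l => ((h.2 l).add (h'.2 l)).congr fun z hz =>
    dw_add hU (h.1 _ hz.2) (h'.1 _ hz.2) l hz.1⟩

theorem Der.add (hU : IsOpen U) (hJ : IsOpen J) {F G F' G' : ℝ → X → ℝ} (h : Der b U J F F')
    (h' : Der b U J G G')
    (sF : ∀ τ ∈ J, Sm U (F τ)) (sG : ∀ τ ∈ J, Sm U (G τ))
    (sF' : ∀ τ ∈ J, Sm U (F' τ)) (sG' : ∀ τ ∈ J, Sm U (G' τ)) :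
    Der b U J (fun τ q => F τ q + G τ q) (fun τ q => F' τ q + G' τ q) := by
  intro l τ hτ q hq
  rw [dw_add hU (sF' τ hτ) (sG' τ hτ) l hq]
  refine ((h l τ hτ q hq).add (h' l τ hτ q hq)).congr_of_eventuallyEq ?_
  filter_upwards [hJ.mem_nhds hτ] with σ hσ
  exact dw_add hU (sF σ hσ) (sG σ hσ) l hq

theorem KC.add (hU : IsOpen U) (hJ : IsOpen J) {n : ℕ} {F G : ℝ → X → ℝ} (h : KC b U J n F)
    (h' : KC b U J n G) : KC b U J n (fun τ q => F τ q + G τ q) := by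
  induction n generalizing F G with
  | zero => exact KC0.add hU h h'
  | succ n ih =>
    obtain ⟨h0, F', h1, h2⟩ := h
    obtain ⟨g0, G', g1, g2⟩ := h'
    exact ⟨h0.add hU g0, _, ih h1 g1, h2.add hU hJ g2 h0.1 g0.1 h1.zero.1 g1.zero.1⟩

theorem KC0.mul (hU : IsOpen U) {F G : ℝ → X → ℝ} (h : KC0 b U J F) (h' : KC0 b U J G) :
    KC0 b U J (fun τ q => F τ q * G τ q) := by
  refine ⟨fun τ hτ => (h.1 τ hτ).mul (h'.1 τ hτ), fun l => ?_⟩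
  induction l using List.reverseRecOn generalizing F G with
  | nil => exact (h.2 []).mul (h'.2 [])
  | append_singleton l j ih =>
    exact ((ih (h.dd hU j) h').add (ih h (h'.dd hU j))).congr fun z hz =>
      dw_snoc_mul hU (h.1 _ hz.2) (h'.1 _ hz.2) l j hz.1

theorem Der.mul (hU : IsOpen U) (hJ : IsOpen J) {F G F' G' : ℝ → X → ℝ} (h : Der b U J F F')
    (h' : Der b U J G G')
    (sF : ∀ τ ∈ J, Sm U (F τ)) (sG : ∀ τ ∈ J, Sm U (G τ))
    (sF' : ∀ τ ∈ J, Sm U (F' τ)) (sG' : ∀ τ ∈ J, Sm U (G' τ)) :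
    Der b U J (fun τ q => F τ q * G τ q) (fun τ q => F' τ q * G τ q + F τ q * G' τ q) := by
  intro l
  induction l using List.reverseRecOn generalizing F G F' G' with
  | nil => exact fun τ hτ q hq => (h [] τ hτ q hq).mul (h' [] τ hτ q hq)
  | append_singleton l j ih =>
    intro τ hτ q hq
    have i1 := ih (h.dd j) h' (fun τ hτ => (sF τ hτ).dd hU _) sG (fun τ hτ => (sF' τ hτ).dd hU _)
      sG' τ hτ q hq
    have i2 := ih h (h'.dd j) sF (fun τ hτ => (sG τ hτ).dd hU _) sF'
      (fun τ hτ => (sG' τ hτ).dd hU _) τ hτ q hq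
    have i3 := i1.add i2
    have e0 := dw_add hU ((sF' τ hτ).mul (sG τ hτ)) ((sF τ hτ).mul (sG' τ hτ)) (b := b)
      (l ++ [j]) hq
    rw [e0]
    simp only
    rw [dw_snoc_mul hU (sF' τ hτ) (sG τ hτ) l j hq, dw_snoc_mul hU (sF τ hτ) (sG' τ hτ) l j hq]
    have e1 := dw_add hU (((sF' τ hτ).dd hU (b j)).mul (sG τ hτ))
      (((sF τ hτ).dd hU (b j)).mul (sG' τ hτ)) (b := b) l hq
    have e2 := dw_add hU ((sF' τ hτ).mul ((sG τ hτ).dd hU (b j)))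
      ((sF τ hτ).mul ((sG' τ hτ).dd hU (b j))) (b := b) l hq
    simp only at e1 e2
    rw [e1, e2] at i3
    refine (i3.congr_of_eventuallyEq ?_).congr_deriv ?_
    · filter_upwards [hJ.mem_nhds hτ] with σ hσ
      exact dw_snoc_mul hU (sF σ hσ) (sG σ hσ) l j hq
    · ring

theorem KC.mul (hU : IsOpen U) (hJ : IsOpen J) {n : ℕ} {F G : ℝ → X → ℝ} (h : KC b U J n F)
    (h' : KC b U J n G) : KC b U J n (fun τ q => F τ q * G τ q) := by
  induction n generalizing F G with
  | zero => exact KC0.mul hU h h'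
  | succ n ih =>
    have hp := h.pred
    have hp' := h'.pred
    obtain ⟨h0, F', h1, h2⟩ := h
    obtain ⟨g0, G', g1, g2⟩ := h'
    exact ⟨h0.mul hU g0, _, KC.add hU hJ (ih h1 hp') (ih hp g1),
      h2.mul hU hJ g2 h0.1 g0.1 h1.zero.1 g1.zero.1⟩

/-- slices -/
theorem dw_slice (hU : IsOpen U) (hJ : IsOpen J) {f : X × ℝ → ℝ} (hf : Sm (U ×ˢ J) f) (l : List κ)
    {τ : ℝ} (hτ : τ ∈ J) : EqOn (dw b l (fun x => f (x, τ)))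
      (fun x => dw (fun j => (b j, (0 : ℝ))) l f (x, τ)) U := by
  induction l with
  | nil => exact fun _ _ => rfl
  | cons j l ih =>
    intro q hq
    rw [dw_cons, dd_congr hU ih _ hq]
    have hd := (hf.dw (b := fun j => (b j, (0 : ℝ))) (hU.prod hJ) l).diffAt (hU.prod hJ)
      (show (q, τ) ∈ U ×ˢ J from ⟨hq, hτ⟩)
    rw [dw_cons]
    simp only [dd]
    have h1 : HasFDerivAt (fun x : X => (x, τ)) (ContinuousLinearMap.inl ℝ X ℝ) q :=
      hasFDerivAt_prodMk_left q τ
    have := (hd.hasFDerivAt.comp q h1).fderiv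
    have e : fderiv ℝ (fun x => dw (fun j => (b j, (0 : ℝ))) l f (x, τ)) q
      = (fderiv ℝ (dw (fun j => (b j, (0 : ℝ))) l f) (q, τ)).comp (ContinuousLinearMap.inl ℝ X ℝ) :=
      this
    rw [e]; simp

theorem KC.of_smooth (hU : IsOpen U) (hJ : IsOpen J) (n : ℕ) {f : X × ℝ → ℝ}
    (hf : Sm (U ×ˢ J) f) : KC b U J n (fun τ x => f (x, τ)) := by
  have h0 : ∀ {f : X × ℝ → ℝ}, Sm (U ×ˢ J) f → KC0 b U J (fun τ x => f (x, τ)) := by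
    intro f hf
    refine ⟨fun τ hτ => ?_, fun l => ?_⟩
    · exact ContDiffOn.comp (g := f) hf (f := fun x => (x, τ)) (by fun_prop) (fun x hx => ⟨hx, hτ⟩)
    · exact (hf.dw (b := fun j => (b j, (0 : ℝ))) (hU.prod hJ) l).continuousOn.congr
        fun z hz => dw_slice hU hJ hf l hz.2 hz.1
  induction n generalizing f with
  | zero => exact h0 hf
  | succ n ih =>
    refine ⟨h0 hf, _, ih (hf.dd (hU.prod hJ) (0, 1)), ?_⟩
    intro l τ hτ q hq
    rw [dw_slice hU hJ (hf.dd (hU.prod hJ) (0, 1)) l hτ hq]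
    have hz : (q, τ) ∈ U ×ˢ J := ⟨hq, hτ⟩
    simp only
    rw [dw_dd (hU.prod hJ) hf l (0, 1) hz]
    have hd := (hf.dw (b := fun j => (b j, (0 : ℝ))) (hU.prod hJ) l).diffAt (hU.prod hJ) hz
    have h1 : HasDerivAt (fun σ : ℝ => (q, σ)) ((0 : X), (1 : ℝ)) τ :=
      (hasDerivAt_const τ q).prodMk (hasDerivAt_id τ)
    refine (hd.hasFDerivAt.comp_hasDerivAt τ h1).congr_of_eventuallyEq ?_
    filter_upwards [hJ.mem_nhds hτ] with σ hσ
    exact dw_slice hU hJ hf l hσ hq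

theorem KC.contDiffOn (bb : Module.Basis κ ℝ X) (hU : IsOpen U) (hJ : IsOpen J) {n : ℕ}
    {F : ℝ → X → ℝ} (h : KC bb U J n F) (l : List κ) :
    ContDiffOn ℝ n (fun z : X × ℝ => dw bb l (F z.2) z.1) (U ×ˢ J) := by
  induction n generalizing F l with
  | zero => exact contDiffOn_zero.2 (h.2 l)
  | succ n ih =>
    have hp := h.pred
    obtain ⟨h0, F', h1, h2⟩ := h
    let B : Module.Basis (κ ⊕ Unit) ℝ (X × ℝ) := bb.prod (Module.Basis.singleton Unit ℝ)
    let G : κ ⊕ Unit → X × ℝ → ℝ := Sum.elim (fun j z => dw bb (j :: l) (F z.2) z.1)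
      (fun _ z => dw bb l (F' z.2) z.1)
    have hGn : ∀ j, ContDiffOn ℝ n (G j) (U ×ˢ J) := by
      rintro (j | j)
      · exact ih hp (j :: l)
      · exact ih h1 l
    have hF : ∀ z ∈ U ×ˢ J, HasFDerivAt (fun z : X × ℝ => dw bb l (F z.2) z.1)
        (∑ i, G i z • (LinearMap.toContinuousLinearMap (B.coord i))) z := by
      intro z hz
      refine hasFDerivAt_of_partials B (hU.prod hJ) (fun i => (hGn i).continuousOn) ?_ hz
      rintro ⟨q, τ⟩ ⟨hq, hτ⟩ (j | j)
      · have := hasDerivAt_line (f := dw bb l (F τ)) (q := q) (e := bb j) (s := 0)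
          (by simpa using ((h0.1 τ hτ).dw hU l).diffAt hU hq)
        simpa [B, G, Module.Basis.prod_apply, dw_cons] using this
      · have := h2 l τ hτ q hq
        have h3 : HasDerivAt (fun s : ℝ => dw bb l (F (τ + s)) q) (dw bb l (F' τ) q) 0 := by
          have := HasDerivAt.comp_const_add (f := fun σ => dw bb l (F σ) q) τ 0 (by simpa using this)
          simpa using this
        simpa [B, G, Module.Basis.prod_apply] using h3
    have := (contDiffOn_succ_iff_fderiv_of_isOpen (𝕜 := ℝ) (n := (n : WithTop ℕ∞))
        (f := fun z : X × ℝ => dw bb l (F z.2) z.1) (hU.prod hJ)).2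
        ⟨fun q hq => (hF q hq).differentiableAt.differentiableWithinAt, by simp, ?_⟩
    · exact_mod_cast this
    · have h2 : ContDiffOn ℝ n (fun q => ∑ j, G j q •
            (LinearMap.toContinuousLinearMap (B.coord j))) (U ×ˢ J) :=
          ContDiffOn.sum fun j _ => (hGn j).smul contDiffOn_const
      exact h2.congr fun q hq => (hF q hq).fderiv

theorem LBd_of_cont {P : Type} [TopologicalSpace P] {K : Set P} (hK : IsCompact K) {S : Set P}
    (hU : IsOpen U) (hKS : K ⊆ S) {g : P → X → ℝ}
    (hg : ContinuousOn (fun z : X × P => g z.2 z.1) (U ×ˢ S)) : LBd U (fun p : K => g p) := by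
  intro q hq
  obtain ⟨R, hR, hRU⟩ := Metric.isOpen_iff.1 hU q hq
  have hc : IsCompact (Metric.closedBall q (R / 2) ×ˢ K) := (isCompact_closedBall _ _).prod hK
  have hsub : Metric.closedBall q (R / 2) ×ˢ K ⊆ U ×ˢ S :=
    Set.prod_mono ((Metric.closedBall_subset_ball (by linarith)).trans hRU) hKS
  obtain ⟨C, hC⟩ := hc.exists_bound_of_continuousOn (hg.mono hsub)
  refine ⟨C, ?_⟩
  filter_upwards [Metric.closedBall_mem_nhds q (half_pos hR)] with q' hq' p
  exact hC (q', p) ⟨hq', p.2⟩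

end kc
end SN

open Set MeasureTheory
set_option linter.unusedSectionVars false
set_option linter.unusedVariables false
namespace SN
open Filter Topology

section reg
variable {X : Type} [NormedAddCommGroup X] [NormedSpace ℝ X] [FiniteDimensional ℝ X]

theorem LBd.reindex {P Q : Type} {U : Set X} {g : P → X → ℝ} (h : LBd U g) (φ : Q → P) :
    LBd U (fun p => g (φ p)) := by
  intro q hq
  obtain ⟨C, hC⟩ := h q hq
  exact ⟨C, hC.mono fun q' h p => h (φ p)⟩

variable {U : Set X} {J : Set ℝ}

section
variable {κ : Type} [Fintype κ] {b : κ → X}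

theorem KC.sum (hU : IsOpen U) (hJ : IsOpen J) {n : ℕ} {α : Type} (s : Finset α)
    {F : α → ℝ → X → ℝ} (h : ∀ i, KC b U J n (F i)) :
    KC b U J n (fun τ q => ∑ i ∈ s, F i τ q) := by
  classical
  induction s using Finset.induction_on with
  | empty =>
    have := KC.of_smooth (b := b) hU hJ n (f := fun _ => 0) (Sm.const 0)
    simpa using this
  | insert k s hk ih =>
    simp only [Finset.sum_insert hk]
    exact KC.add hU hJ (h k) ih

theorem dw_quot (hU : IsOpen U) {F G : X → ℝ} (hF : Sm U F) (hG : Sm U G) (h : ℝ) (l : List κ)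
    {q : X} (hq : q ∈ U) : dw b l (fun x => h⁻¹ * (F x - G x)) q
      = h⁻¹ * (dw b l F q - dw b l G q) := by
  have e : (fun x => h⁻¹ * (F x - G x)) = fun x => h⁻¹ * F x + (-h⁻¹) * G x := by
    funext x; ring
  rw [e, dw_add hU ((Sm.const _).mul hF) ((Sm.const _).mul hG) l hq]
  simp only
  rw [dw_const_mul hU _ hF l hq, dw_const_mul hU _ hG l hq]
  ring

theorem mvt_quot {K : Set ℝ} (hK : Convex ℝ K) {φ φ' : ℝ → ℝ} {C c : ℝ}
    (hd : ∀ s ∈ K, HasDerivAt φ (φ' s) s) (hC : ∀ s ∈ K, |φ' s - c| ≤ C) {t h : ℝ} (ht : t ∈ K)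
    (hth : t + h ∈ K) (h0 : h ≠ 0) : |h⁻¹ * (φ (t + h) - φ t) - c| ≤ C := by
  have := hK.norm_image_sub_le_of_norm_hasDerivWithin_le
      (f := fun s : ℝ => φ s - s * c) (f' := fun s => φ' s - c) (C := C)
      (fun s hs => by
        have h3 := (hasDerivAt_id s).mul_const c
        simp only [id, one_mul] at h3
        exact ((hd s hs).sub h3).hasDerivWithinAt)
      (fun s hs => hC s hs) ht hth
  simp only [Real.norm_eq_abs, add_sub_cancel_left] at this
  have e : h⁻¹ * (φ (t + h) - φ t) - c = h⁻¹ * (φ (t + h) - (t + h) * c - (φ t - t * c)) := by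
    field_simp; ring
  rw [e, abs_mul, abs_inv, inv_mul_le_iff₀ (abs_pos.2 h0)]
  linarith
end

variable {ι : Type} [Fintype ι] {ex : ι → X} {et : X}

theorem KC0.BB (hU : IsOpen U) {F : ℝ → X → ℝ} (hF : KC0 (bs ex et) U J F) {K : Set ℝ}
    (hK : IsCompact K) (hKJ : K ⊆ J) {Q : Type} (t : Q → ℝ) (ht : ∀ p, t p ∈ K) :
    BB U ex et (fun p => F (t p)) :=
  ⟨fun p => hF.1 _ (hKJ (ht p)), fun l =>
    (LBd_of_cont hK hU hKJ (g := fun σ => dw (bs ex et) l (F σ)) (hF.2 l)).reindex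
      (fun p => ⟨t p, ht p⟩)⟩

theorem quot_BB (hU : IsOpen U) {F F' : ℝ → X → ℝ} (hF : KC0 (bs ex et) U J F)
    (hF' : KC0 (bs ex et) U J F') (hD : Der (bs ex et) U J F F') {K : Set ℝ}
    (hK : IsCompact K) (hKc : Convex ℝ K) (hKJ : K ⊆ J) {Q : Type} (t h : Q → ℝ)
    (ht : ∀ p, t p ∈ K) (hth : ∀ p, t p + h p ∈ K) (h0 : ∀ p, h p ≠ 0) :
    BB U ex et (fun p x => (h p)⁻¹ * (F (t p + h p) x - F (t p) x)) := by
  refine ⟨fun p => (Sm.const _).mul ((hF.1 _ (hKJ (hth p))).sub (hF.1 _ (hKJ (ht p)))),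
    fun l => ?_⟩
  have hl := LBd_of_cont hK hU hKJ (g := fun σ => dw (bs ex et) l (F' σ)) (hF'.2 l)
  intro q hq
  obtain ⟨C, hC⟩ := hl q hq
  refine ⟨C, ?_⟩
  filter_upwards [hC, hU.mem_nhds hq] with q' h1 h2 p
  rw [dw_quot hU (hF.1 _ (hKJ (hth p))) (hF.1 _ (hKJ (ht p))) _ l h2]
  have := mvt_quot hKc (φ := fun σ => dw (bs ex et) l (F σ) q')
    (φ' := fun σ => dw (bs ex et) l (F' σ) q') (c := 0) (C := C)
    (fun s hs => hD l s (hKJ hs) q' h2) (fun s hs => by simpa using h1 ⟨s, hs⟩) (ht p) (hth p)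
    (h0 p)
  simpa using this

theorem KC0_of_eq (bb : Module.Basis (ι ⊕ Unit) ℝ X) (hbb : ⇑bb = bs ex et) (hU : IsOpen U)
    (hJ : IsOpen J) (T : X →L[ℝ] ℝ) (hT : T et = 1) {V a f : ℝ → X → ℝ} {c : ι → ℝ → X → ℝ}
    (hs : ∀ τ ∈ J, Sm U (V τ)) (hV : ContinuousOn (fun z : X × ℝ => V z.2 z.1) (U ×ˢ J))
    (ha : KC0 (bs ex et) U J a) (hc : ∀ i, KC0 (bs ex et) U J (c i)) (hf : KC0 (bs ex et) U J f)
    (heq : ∀ τ ∈ J, ∀ q ∈ U, heat ex et (V τ) q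
      = a τ q * V τ q + ∑ i, c i τ q * dd (ex i) (V τ) q + f τ q) :
    KC0 (bs ex et) U J V := by
  refine ⟨hs, fun l => ?_⟩
  rintro ⟨q, τ0⟩ ⟨hq, hτ0⟩
  obtain ⟨R, hR, hRJ⟩ := Metric.isOpen_iff.1 hJ τ0 hτ0
  set K := Metric.closedBall τ0 (R / 2)
  have hK : IsCompact K := isCompact_closedBall _ _
  have hKJ : K ⊆ J := (Metric.closedBall_subset_ball (by linarith)).trans hRJ
  set B := Metric.ball τ0 (R / 2)
  have hBK : B ⊆ K := Metric.ball_subset_closedBall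
  have hBB := BB_of_eq (P := B) hU T hT (v := fun p => V p) (a := fun p => a p)
    (f := fun p => f p) (b := fun i p => c i p) (fun p => hs p (hKJ (hBK p.2)))
    ((LBd_of_cont hK hU hKJ hV).reindex (fun p : B => ⟨p, hBK p.2⟩))
    (ha.BB hU hK hKJ _ fun p => hBK p.2) (fun i => (hc i).BB hU hK hKJ _ fun p => hBK p.2)
    (hf.BB hU hK hKJ _ fun p => hBK p.2) (fun p => heq p (hKJ (hBK p.2)))
  have hL := lim_words bb hU (P := B) univ dense_univ (g := fun p => V p)
    (hV.comp (f := fun z : X × B => (z.1, (z.2 : ℝ))) (by fun_prop)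
      (fun z hz => ⟨hz.1, hKJ (hBK z.2.2)⟩))
    (fun p _ => hs p (hKJ (hBK p.2)))
    (fun l => by rw [hbb]; exact (hBB.2 l).reindex fun p : (univ : Set B) => p.1)
  have h1 := hL.2 l
  rw [hbb] at h1
  have h2 : ContinuousAt (fun z : X × B => dw (bs ex et) l (V z.2) z.1)
      (q, ⟨τ0, Metric.mem_ball_self (half_pos hR)⟩) :=
    h1.continuousAt ((hU.prod isOpen_univ).mem_nhds ⟨hq, mem_univ _⟩)
  have hemb := (IsOpenEmbedding.id (X := X)).prodMap
    (Metric.isOpen_ball (x := τ0) (ε := R / 2)).isOpenEmbedding_subtypeVal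
  have h3 := (hemb.continuousAt_iff (g := fun z : X × ℝ => dw (bs ex et) l (V z.2) z.1)
    (x := (q, ⟨τ0, Metric.mem_ball_self (half_pos hR)⟩))).1 h2
  exact h3.continuousWithinAt

/-- difference quotient, extended by the derivative -/
noncomputable def qw (V V' : ℝ → X → ℝ) (p : ℝ × ℝ) (q : X) : ℝ :=
  if p.2 = 0 then V' p.1 q else p.2⁻¹ * (V (p.1 + p.2) q - V p.1 q)

theorem qw_zero (V V' : ℝ → X → ℝ) (τ : ℝ) : qw V V' (τ, 0) = V' τ := by
  funext q; simp [qw]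

theorem qw_ne (V V' : ℝ → X → ℝ) {p : ℝ × ℝ} (h : p.2 ≠ 0) :
    qw V V' p = fun q => p.2⁻¹ * (V (p.1 + p.2) q - V p.1 q) := by
  funext q; simp [qw, h]

theorem qw_cont (hU : IsOpen U) (hJ : IsOpen J) {V V' : ℝ → X → ℝ}
    (hV : ContinuousOn (fun z : X × ℝ => V z.2 z.1) (U ×ˢ J))
    (hV' : ContinuousOn (fun z : X × ℝ => V' z.2 z.1) (U ×ˢ J))
    (hd : ∀ τ ∈ J, ∀ q ∈ U, HasDerivAt (fun σ => V σ q) (V' τ q) τ) {q : X} (hq : q ∈ U)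
    {p : ℝ × ℝ} (h1 : p.1 ∈ J) (h2 : p.1 + p.2 ∈ J) :
    ContinuousAt (fun z : X × (ℝ × ℝ) => qw V V' z.2 z.1) (q, p) := by
  obtain ⟨τ, h⟩ := p
  have hop := hU.prod hJ
  by_cases h0 : h = 0
  · subst h0
    have hc : ContinuousAt (fun z : X × ℝ => V' z.2 z.1) (q, τ) :=
      hV'.continuousAt (hop.mem_nhds ⟨hq, h1⟩)
    rw [Metric.continuousAt_iff']
    intro ε hε
    have hev := (Metric.continuousAt_iff'.1 hc (ε / 2) (half_pos hε)).and (hop.mem_nhds ⟨hq, h1⟩)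
    obtain ⟨δ, hδ, hb⟩ := Metric.eventually_nhds_iff_ball.1 hev
    have hb' : ∀ q' ∈ Metric.ball q δ, ∀ σ ∈ Metric.ball τ δ, q' ∈ U ∧ σ ∈ J ∧
        |V' σ q' - V' τ q| ≤ ε / 2 := by
      intro q' hq' σ hσ
      have hm : (q', σ) ∈ Metric.ball (q, τ) δ := by
        rw [← ball_prod_same]; exact ⟨hq', hσ⟩
      have := hb _ hm
      exact ⟨this.2.1, this.2.2, this.1.le⟩
    have hnb : Metric.ball q δ ×ˢ (Metric.ball τ (δ / 2) ×ˢ Metric.ball (0:ℝ) (δ / 2))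
        ∈ 𝓝 (q, (τ, (0:ℝ))) :=
      prod_mem_nhds (Metric.ball_mem_nhds _ hδ) (prod_mem_nhds
        (Metric.ball_mem_nhds _ (half_pos hδ)) (Metric.ball_mem_nhds _ (half_pos hδ)))
    filter_upwards [hnb]
    rintro ⟨q', σ, h⟩ ⟨m1, m2, m3⟩
    simp only at m1 m2 m3
    have m2' : σ ∈ Metric.ball τ δ := Metric.ball_subset_ball (by linarith) m2
    have m3' : σ + h ∈ Metric.ball τ δ := by
      rw [Metric.mem_ball, Real.dist_eq] at *
      have := abs_add_le (σ - τ) (h - 0)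
      rw [show σ + h - τ = (σ - τ) + (h - 0) by ring]
      linarith
    rw [qw_zero, Real.dist_eq]
    by_cases h0 : h = 0
    · subst h0
      rw [qw_zero]
      exact ((hb' q' m1 σ m2').2.2).trans_lt (by linarith)
    · rw [qw_ne _ _ h0]
      have := mvt_quot (convex_ball τ δ) (φ := fun σ => V σ q') (φ' := fun σ => V' σ q')
        (c := V' τ q) (C := ε / 2) (fun s hs => hd s (hb' q' m1 s hs).2.1 q' (hb' q' m1 s hs).1)
        (fun s hs => (hb' q' m1 s hs).2.2) m2' m3' h0
      exact this.trans_lt (by linarith)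
  · have hev : (fun z : X × (ℝ × ℝ) => qw V V' z.2 z.1) =ᶠ[𝓝 (q, (τ, h))]
        fun z => z.2.2⁻¹ * (V (z.2.1 + z.2.2) z.1 - V z.2.1 z.1) := by
      have : ∀ᶠ z : X × (ℝ × ℝ) in 𝓝 (q, (τ, h)), z.2.2 ≠ 0 :=
        ContinuousAt.eventually_ne (by fun_prop) h0
      filter_upwards [this] with z hz
      rw [qw_ne _ _ hz]
    refine ContinuousAt.congr ?_ hev.symm
    have c1 : ContinuousAt (fun z : X × (ℝ × ℝ) => V (z.2.1 + z.2.2) z.1) (q, (τ, h)) :=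
      ContinuousAt.comp (g := fun z : X × ℝ => V z.2 z.1)
        (f := fun z : X × (ℝ × ℝ) => (z.1, z.2.1 + z.2.2)) (x := (q, (τ, h)))
        (hV.continuousAt (hop.mem_nhds ⟨hq, h2⟩)) (by fun_prop)
    have c2 : ContinuousAt (fun z : X × (ℝ × ℝ) => V (z.2.1) z.1) (q, (τ, h)) :=
      ContinuousAt.comp (g := fun z : X × ℝ => V z.2 z.1)
        (f := fun z : X × (ℝ × ℝ) => (z.1, z.2.1)) (x := (q, (τ, h)))
        (hV.continuousAt (hop.mem_nhds ⟨hq, h1⟩)) (by fun_prop)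
    have c3 : ContinuousAt (fun z : X × (ℝ × ℝ) => z.2.2⁻¹) (q, (τ, h)) :=
      ContinuousAt.inv₀ (by fun_prop) h0
    exact c3.mul (c1.sub c2)

theorem quot_lim (bb : Module.Basis (ι ⊕ Unit) ℝ X) (hbb : ⇑bb = bs ex et) (hU : IsOpen U)
    (hJ : IsOpen J) (T : X →L[ℝ] ℝ) (hT : T et = 1) {V V' a a' f f' : ℝ → X → ℝ}
    {c c' : ι → ℝ → X → ℝ} (hV : KC0 (bs ex et) U J V)
    (hV' : ContinuousOn (fun z : X × ℝ => V' z.2 z.1) (U ×ˢ J))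
    (hd : ∀ τ ∈ J, ∀ q ∈ U, HasDerivAt (fun σ => V σ q) (V' τ q) τ)
    (ha : KC0 (bs ex et) U J a) (hc : ∀ i, KC0 (bs ex et) U J (c i)) (hf : KC0 (bs ex et) U J f)
    (ha' : KC0 (bs ex et) U J a') (hc' : ∀ i, KC0 (bs ex et) U J (c' i))
    (hf' : KC0 (bs ex et) U J f')
    (da : Der (bs ex et) U J a a') (dc : ∀ i, Der (bs ex et) U J (c i) (c' i))
    (df : Der (bs ex et) U J f f')
    (heq : ∀ τ ∈ J, ∀ q ∈ U, heat ex et (V τ) q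
      = a τ q * V τ q + ∑ i, c i τ q * dd (ex i) (V τ) q + f τ q) {τ0 : ℝ} (hτ0 : τ0 ∈ J) :
    Sm U (V' τ0) ∧ ∀ l, ∀ q ∈ U, ContinuousAt
      (fun z : X × (ℝ × ℝ) => dw (bs ex et) l (qw V V' z.2) z.1) (q, (τ0, 0)) := by
  obtain ⟨R, hR, hRJ⟩ := Metric.isOpen_iff.1 hJ τ0 hτ0
  set K := Metric.closedBall τ0 (R / 2) with hKdef
  have hK : IsCompact K := isCompact_closedBall _ _
  have hKc : Convex ℝ K := convex_closedBall _ _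
  have hKJ : K ⊆ J := (Metric.closedBall_subset_ball (by linarith)).trans hRJ
  let B : Set (ℝ × ℝ) := Metric.ball τ0 (R / 4) ×ˢ Metric.ball 0 (R / 4)
  have hBo : IsOpen B := Metric.isOpen_ball.prod Metric.isOpen_ball
  have hB1 : ∀ p ∈ B, p.1 ∈ K := by
    rintro ⟨t, h⟩ ⟨h1, h2⟩
    simp only [Metric.mem_ball, hKdef, Metric.mem_closedBall] at *
    linarith
  have hB2 : ∀ p ∈ B, p.1 + p.2 ∈ K := by
    rintro ⟨t, h⟩ ⟨h1, h2⟩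
    simp only [Metric.mem_ball, hKdef, Metric.mem_closedBall, Real.dist_eq] at *
    rw [show t + h - τ0 = (t - τ0) + (h - 0) by ring]
    linarith [abs_add_le (t - τ0) (h - 0)]
  have h00 : (τ0, (0:ℝ)) ∈ B :=
    ⟨Metric.mem_ball_self (by positivity), Metric.mem_ball_self (by positivity)⟩
  let P0 : Set B := {p | (p : ℝ × ℝ).2 ≠ 0}
  have hP0 : Dense P0 :=
    ((dense_compl_singleton (0:ℝ)).preimage isOpenMap_snd).preimage
      hBo.isOpenEmbedding_subtypeVal.isOpenMap
  let t : P0 → ℝ := fun p => p.1.1.1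
  let h : P0 → ℝ := fun p => p.1.1.2
  have ht : ∀ p, t p ∈ K := fun p => hB1 _ p.1.2
  have hth : ∀ p, t p + h p ∈ K := fun p => hB2 _ p.1.2
  have hh0 : ∀ p, h p ≠ 0 := fun p => p.2
  have hqe : ∀ p : P0, qw V V' (p : B) = fun q => (h p)⁻¹ * (V (t p + h p) q - V (t p) q) :=
    fun p => qw_ne V V' p.2
  have hsV : ∀ p : P0, Sm U (qw V V' (p : B)) := fun p => by
    rw [hqe p]
    exact (Sm.const _).mul ((hV.1 _ (hKJ (hth p))).sub (hV.1 _ (hKJ (ht p))))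
  have hcont : ContinuousOn (fun z : X × B => qw V V' z.2 z.1) (U ×ˢ univ) := by
    rintro ⟨q, p⟩ ⟨hq, -⟩
    apply ContinuousAt.continuousWithinAt
    exact ContinuousAt.comp (g := fun z : X × (ℝ × ℝ) => qw V V' z.2 z.1)
        (f := fun z : X × B => (z.1, (z.2 : ℝ × ℝ))) (x := (q, p))
        (qw_cont hU hJ (hV.2 []) hV' hd hq (hKJ (hB1 _ p.2)) (hKJ (hB2 _ p.2))) (by fun_prop)
  have hbd : LBd U (fun p : P0 => qw V V' (p : B)) := by
    have hl := LBd_of_cont hK hU hKJ hV'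
    intro q hq
    obtain ⟨C, hC⟩ := hl q hq
    refine ⟨C, ?_⟩
    filter_upwards [hC, hU.mem_nhds hq] with q' h1 h2 p
    rw [hqe p]
    have := mvt_quot hKc (φ := fun σ => V σ q') (φ' := fun σ => V' σ q') (c := 0) (C := C)
      (fun s hs => hd s (hKJ hs) q' h2) (fun s hs => by simpa using h1 ⟨s, hs⟩) (ht p) (hth p)
      (hh0 p)
    simpa using this
  have hBB := BB_of_eq (P := P0) hU T hT (v := fun p => qw V V' (p : B)) (a := fun p => a (t p))
    (f := fun p x => (h p)⁻¹ * (f (t p + h p) x - f (t p) x)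
      + ((h p)⁻¹ * (a (t p + h p) x - a (t p) x) * V (t p + h p) x
      + ∑ i, (h p)⁻¹ * (c i (t p + h p) x - c i (t p) x) * dd (bs ex et (Sum.inl i)) (V (t p + h p)) x))
    (b := fun i p => c i (t p)) hsV hbd
    (ha.BB hU hK hKJ t ht) (fun i => (hc i).BB hU hK hKJ t ht)
    (BB.add hU (quot_BB hU hf hf' df hK hKc hKJ t h ht hth hh0)
      (BB.add hU (BB.mul hU (quot_BB hU ha ha' da hK hKc hKJ t h ht hth hh0)
        (hV.BB hU hK hKJ (fun p => t p + h p) hth))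
        (BB.sum hU Finset.univ fun i => BB.mul hU
          (quot_BB hU (hc i) (hc' i) (dc i) hK hKc hKJ t h ht hth hh0)
          ((hV.dd hU (Sum.inl i)).BB hU hK hKJ (fun p => t p + h p) hth))))
    (by
      intro p q hq
      have s1 := hV.1 _ (hKJ (hth p))
      have s2 := hV.1 _ (hKJ (ht p))
      rw [hqe p]
      simp only
      rw [heat_const_mul hU _ (s1.sub s2) hq, heat_sub hU s1 s2 hq, heq _ (hKJ (hth p)) q hq,
        heq _ (hKJ (ht p)) q hq]
      have hdd : ∀ i, dd (ex i) (fun q => (h p)⁻¹ * (V (t p + h p) q - V (t p) q)) q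
          = (h p)⁻¹ * (dd (ex i) (V (t p + h p)) q - dd (ex i) (V (t p)) q) := by
        intro i
        rw [dd_const_mul _ ((s1.sub s2).diffAt hU hq), dd_sub (s1.diffAt hU hq) (s2.diffAt hU hq)]
      simp only [hdd, bs, Sum.elim_inl]
      have e1 : ∑ i, c i (t p) q * ((h p)⁻¹ * (dd (ex i) (V (t p + h p)) q - dd (ex i) (V (t p)) q))
          + ∑ i, (h p)⁻¹ * (c i (t p + h p) q - c i (t p) q) * dd (ex i) (V (t p + h p)) q
          = (h p)⁻¹ * (∑ i, c i (t p + h p) q * dd (ex i) (V (t p + h p)) q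
            - ∑ i, c i (t p) q * dd (ex i) (V (t p)) q) := by
        rw [← Finset.sum_add_distrib, ← Finset.sum_sub_distrib, Finset.mul_sum]
        exact Finset.sum_congr rfl fun i _ => by ring
      linear_combination -e1)
  have hL := lim_words bb hU P0 hP0 (g := fun p : B => qw V V' p) hcont
    (fun p hp => hsV ⟨p, hp⟩) (fun l => by rw [hbb]; exact hBB.2 l)
  refine ⟨?_, fun l q hq => ?_⟩
  · have := hL.1 ⟨_, h00⟩
    rw [qw_zero] at this
    exact this
  · have h1 := hL.2 l
    rw [hbb] at h1
    have h2 : ContinuousAt (fun z : X × B => dw (bs ex et) l (qw V V' z.2) z.1)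
        (q, ⟨_, h00⟩) :=
      h1.continuousAt ((hU.prod isOpen_univ).mem_nhds ⟨hq, mem_univ _⟩)
    have hemb := (IsOpenEmbedding.id (X := X)).prodMap hBo.isOpenEmbedding_subtypeVal
    exact (hemb.continuousAt_iff
      (g := fun z : X × (ℝ × ℝ) => dw (bs ex et) l (qw V V' z.2) z.1)
      (x := (q, ⟨_, h00⟩))).1 h2

theorem KC_of_eq (bb : Module.Basis (ι ⊕ Unit) ℝ X) (hbb : ⇑bb = bs ex et) (hU : IsOpen U)
    (hJ : IsOpen J) (T : X →L[ℝ] ℝ) (hT : T et = 1) (n : ℕ) {V a f : ℝ → X → ℝ}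
    {c : ι → ℝ → X → ℝ}
    (hs : ∀ τ ∈ J, Sm U (V τ)) (hV : ContDiffOn ℝ n (fun z : X × ℝ => V z.2 z.1) (U ×ˢ J))
    (ha : KC (bs ex et) U J n a) (hc : ∀ i, KC (bs ex et) U J n (c i))
    (hf : KC (bs ex et) U J n f)
    (heq : ∀ τ ∈ J, ∀ q ∈ U, heat ex et (V τ) q
      = a τ q * V τ q + ∑ i, c i τ q * dd (ex i) (V τ) q + f τ q) :
    KC (bs ex et) U J n V := by
  induction n generalizing V f with
  | zero => exact KC0_of_eq bb hbb hU hJ T hT hs hV.continuousOn ha hc hf heq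
  | succ n ih =>
    have hop := hU.prod hJ
    have hVn : KC (bs ex et) U J n V := ih hs (hV.of_le (by exact_mod_cast Nat.le_succ n)) ha.pred
      (fun i => (hc i).pred) hf.pred heq
    obtain ⟨ha0, a', ha1, da⟩ := ha
    obtain ⟨hf0, f', hf1, df⟩ := hf
    choose hc0 c' hc1 dc using hc
    set V' : ℝ → X → ℝ := fun τ q => fderiv ℝ (fun z : X × ℝ => V z.2 z.1) (q, τ) (0, 1) with hV'def
    have hV' : ContDiffOn ℝ n (fun z : X × ℝ => V' z.2 z.1) (U ×ˢ J) :=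
      (hV.fderiv_of_isOpen hop (by norm_cast)).clm_apply contDiffOn_const
    have hd : ∀ τ ∈ J, ∀ q ∈ U, HasDerivAt (fun σ => V σ q) (V' τ q) τ := by
      intro τ hτ q hq
      have hdiff : DifferentiableAt ℝ (fun z : X × ℝ => V z.2 z.1) (q, τ) :=
        (hV.differentiableOn (by norm_cast)).differentiableAt (hop.mem_nhds ⟨hq, hτ⟩)
      have h1 : HasDerivAt (fun σ : ℝ => (q, σ)) ((0 : X), (1 : ℝ)) τ :=
        (hasDerivAt_const τ q).prodMk (hasDerivAt_id τ)
      exact hdiff.hasFDerivAt.comp_hasDerivAt τ h1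
    have hQ := fun τ0 (hτ0 : τ0 ∈ J) => quot_lim bb hbb hU hJ T hT hVn.zero hV'.continuousOn hd
      ha0 hc0 hf0 ha1.zero (fun i => (hc1 i).zero) hf1.zero da dc df heq hτ0
    have hsV' : ∀ τ ∈ J, Sm U (V' τ) := fun τ hτ => (hQ τ hτ).1
    have hder : Der (bs ex et) U J V V' := by
      intro l τ hτ q hq
      rw [hasDerivAt_iff_tendsto_slope_zero]
      have h1 := (hQ τ hτ).2 l q hq
      have h2 : ContinuousAt (fun h : ℝ => dw (bs ex et) l (qw V V' (τ, h)) q) 0 :=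
        ContinuousAt.comp (g := fun z : X × (ℝ × ℝ) => dw (bs ex et) l (qw V V' z.2) z.1)
          (f := fun h : ℝ => (q, (τ, h))) (x := 0) h1 (by fun_prop)
      have h3 : Tendsto _ _ _ := h2
      simp only [qw_zero] at h3
      refine (h3.mono_left nhdsWithin_le_nhds).congr' ?_
      have hev : ∀ᶠ h : ℝ in 𝓝 0, τ + h ∈ J :=
        ContinuousAt.eventually_mem (f := fun h : ℝ => τ + h) (by fun_prop)
          (hJ.mem_nhds (by simpa using hτ))
      filter_upwards [nhdsWithin_le_nhds hev, self_mem_nhdsWithin] with h h1 h2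
      rw [qw_ne V V' (p := (τ, h)) h2]
      simp only [smul_eq_mul]
      exact dw_quot hU (hs _ h1) (hs _ hτ) h l hq
    refine ⟨hVn.zero, V', ?_, hder⟩
    refine ih (f := fun τ q => a' τ q * V τ q
        + ∑ i, c' i τ q * dd (bs ex et (Sum.inl i)) (V τ) q + f' τ q) hsV' hV'
      (KC.pred ⟨ha0, a', ha1, da⟩) (fun i => KC.pred ⟨hc0 i, c' i, hc1 i, dc i⟩)
      (KC.add hU hJ (KC.add hU hJ (KC.mul hU hJ ha1 hVn)
        (KC.sum hU hJ _ fun i => KC.mul hU hJ (hc1 i) (hVn.dd hU (Sum.inl i)))) hf1) ?_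
    intro τ hτ q hq
    have hl : HasDerivAt (fun σ => heat ex et (V σ) q) (heat ex et (V' τ) q) τ := by
      have h1 := hder [Sum.inr ()] τ hτ q hq
      have h2 := fun i => hder [Sum.inl i, Sum.inl i] τ hτ q hq
      exact h1.sub (HasDerivAt.fun_sum fun i _ => h2 i)
    have hr : HasDerivAt (fun σ => a σ q * V σ q + ∑ i, c i σ q * dd (ex i) (V σ) q + f σ q)
        ((a' τ q * V τ q + a τ q * V' τ q)
          + ∑ i, (c' i τ q * dd (ex i) (V τ) q + c i τ q * dd (ex i) (V' τ) q) + f' τ q) τ := by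
      refine ((((da [] τ hτ q hq).mul (hd τ hτ q hq))).add (HasDerivAt.fun_sum fun i _ =>
        (dc i [] τ hτ q hq).mul (hder [Sum.inl i] τ hτ q hq))).add (df [] τ hτ q hq)
    have hlr := hl.congr_of_eventuallyEq (f := fun σ => heat ex et (V σ) q)
      (f₁ := fun σ => a σ q * V σ q + ∑ i, c i σ q * dd (ex i) (V σ) q + f σ q) (by
        filter_upwards [hJ.mem_nhds hτ] with σ hσ
        exact (heq σ hσ q hq).symm)
    rw [hlr.unique hr, Finset.sum_add_distrib]
    simp only [bs, Sum.elim_inl]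
    ring

end reg
end SN

open Set MeasureTheory
set_option linter.unusedSectionVars false
set_option linter.unusedVariables false
namespace SN
open Filter Topology

/-- The real variable part of the frequency argument. -/
theorem frequency_ode {H D H' D' Q : ℝ → ℝ} {S A : ℝ} (hS : 0 ≤ S) (hA : 0 ≤ A)
    (hH : ∀ s ≥ S, 0 < H s) (hD : ∀ s ≥ S, 0 ≤ D s)
    (dH : ∀ s ≥ S, HasDerivAt H (H' s) s) (dD : ∀ s ≥ S, HasDerivAt D (D' s) s)
    (h1 : ∀ s ≥ S, D' s * H s - D s * H' s ≤ H s * Q s / 2)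
    (h2 : ∀ s ≥ S, -2 * D s - H s - Q s ≤ H' s)
    (hQ : ∀ s ≥ S, Q s ≤ A * Real.exp (-s) * (H s + D s))
    (hdec : ∀ k : ℕ, ∃ C : ℝ, ∀ s ≥ S, H s ≤ C * Real.exp (-(k * s))) : False := by
  set Φ : ℝ → ℝ := fun s => (1 + D s / H s) * Real.exp (A / 2 * Real.exp (-s)) with hΦ
  have dΦ : ∀ s ≥ S, HasDerivAt Φ (((D' s * H s - D s * H' s) / H s ^ 2)
      * Real.exp (A / 2 * Real.exp (-s)) + (1 + D s / H s)
      * (Real.exp (A / 2 * Real.exp (-s)) * (A / 2 * -Real.exp (-s)))) s := by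
    intro s hs
    have e1 := ((dD s hs).div (dH s hs) (hH s hs).ne').const_add 1
    have e2 : HasDerivAt (fun s => Real.exp (A / 2 * Real.exp (-s)))
        (Real.exp (A / 2 * Real.exp (-s)) * (A / 2 * -Real.exp (-s))) s := by
      have := ((hasDerivAt_neg s).exp.const_mul (A / 2)).exp
      simpa using this
    exact e1.mul e2
  have anti : AntitoneOn Φ (Ici S) := by
    refine antitoneOn_of_deriv_nonpos (convex_Ici S)
      (fun s hs => (dΦ s hs).continuousAt.continuousWithinAt)
      (fun s hs => (dΦ s (interior_subset hs)).differentiableAt.differentiableWithinAt) ?_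
    intro s hs
    have hs' : S ≤ s := interior_subset hs
    rw [(dΦ s hs').deriv]
    have hHs := hH s hs'
    have hle : (D' s * H s - D s * H' s) / H s ^ 2 ≤ A / 2 * Real.exp (-s) * (1 + D s / H s) := by
      rw [div_le_iff₀ (by positivity)]
      have e : A / 2 * Real.exp (-s) * (1 + D s / H s) * H s ^ 2
          = H s * (A * Real.exp (-s) * (H s + D s)) / 2 := by field_simp
      rw [e]
      have := mul_le_mul_of_nonneg_left (hQ s hs') hHs.le
      linarith [h1 s hs']
    have hE := Real.exp_pos (A / 2 * Real.exp (-s))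
    nlinarith
  set Nst := Φ S with hNst
  have hN1 : ∀ s ≥ S, 1 + D s / H s ≤ Nst := by
    intro s hs
    have h3 : Φ s ≤ Φ S := anti (mem_Ici.2 le_rfl) hs hs
    have h4 : 1 ≤ Real.exp (A / 2 * Real.exp (-s)) := Real.one_le_exp (by positivity)
    have h5 : 0 ≤ 1 + D s / H s := by
      have := div_nonneg (hD s hs) (hH s hs).le; linarith
    calc 1 + D s / H s ≤ Φ s := le_mul_of_one_le_right h5 h4
      _ ≤ Nst := h3
  obtain ⟨K, hK⟩ : ∃ K, K = (2 + A) * Nst := ⟨_, rfl⟩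
  have hH'K : ∀ s ≥ S, -K * H s ≤ H' s := by
    intro s hs
    have hHs := hH s hs
    have h3 : H s + D s ≤ Nst * H s := by
      have := mul_le_mul_of_nonneg_right (hN1 s hs) hHs.le
      rwa [add_mul, div_mul_cancel₀ _ hHs.ne', one_mul] at this
    have h4 : Real.exp (-s) ≤ 1 := Real.exp_le_one_iff.2 (by linarith)
    have h5 : A * Real.exp (-s) * (H s + D s) ≤ A * (H s + D s) := by
      refine mul_le_mul_of_nonneg_right ?_ (by linarith [hD s hs])
      nlinarith
    have h6 := h2 s hs
    have h7 := hQ s hs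
    have h8 := hD s hs
    have : K * H s = (2 + A) * (Nst * H s) := by rw [hK]; ring
    nlinarith
  have mono : MonotoneOn (fun s => H s * Real.exp (K * s)) (Ici S) := by
    have dd : ∀ s ≥ S, HasDerivAt (fun s => H s * Real.exp (K * s))
        (H' s * Real.exp (K * s) + H s * (Real.exp (K * s) * K)) s := by
      intro s hs
      have := ((hasDerivAt_id s).const_mul K).exp
      simp only [id, mul_one] at this
      exact (dH s hs).mul this
    refine monotoneOn_of_deriv_nonneg (convex_Ici S)
      (fun s hs => (dd s hs).continuousAt.continuousWithinAt)
      (fun s hs => (dd s (interior_subset hs)).differentiableAt.differentiableWithinAt) ?_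
    intro s hs
    have hs' : S ≤ s := interior_subset hs
    rw [(dd s hs').deriv]
    have := hH'K s hs'
    have hE := Real.exp_pos (K * s)
    nlinarith
  obtain ⟨k, hk⟩ := exists_nat_gt K
  obtain ⟨C, hC⟩ := hdec k
  have hlow : ∀ s ≥ S, H S * Real.exp (K * S) ≤ C * Real.exp (-((k - K) * s)) := by
    intro s hs
    have h3 := mono (mem_Ici.2 le_rfl) hs hs
    refine h3.trans ?_
    have := mul_le_mul_of_nonneg_right (hC s hs) (Real.exp_pos (K * s)).le
    rw [mul_assoc C, ← Real.exp_add] at this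
    refine this.trans (le_of_eq ?_)
    congr 2; ring
  have ht : Tendsto (fun s : ℝ => C * Real.exp (-((k - K) * s))) atTop (𝓝 (C * 0)) := by
    refine Tendsto.const_mul C (Real.tendsto_exp_neg_atTop_nhds_zero.comp ?_)
    exact tendsto_id.const_mul_atTop (by linarith)
  have := ge_of_tendsto ht (eventually_atTop.2 ⟨S, hlow⟩)
  have hpos := mul_pos (hH S le_rfl) (Real.exp_pos (K * S))
  linarith

end SN

open Set MeasureTheory
set_option linter.unusedSectionVars false
set_option linter.unusedVariables false
namespace SN
open Filter Topology

section flat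
variable {X : Type} [NormedAddCommGroup X] [NormedSpace ℝ X]
variable {ι : Type} [Fintype ι] {ex : ι → X} {et : X} {U : Set X} {u : X → ℝ}

/-- The module generated over smooth functions by the spatial derivatives of `u`. -/
inductive Gen (U : Set X) (ex : ι → X) (u : X → ℝ) : (X → ℝ) → Prop
  | base (c : X → ℝ) (hc : Sm U c) (l : List ι) : Gen U ex u (fun x => c x * dw ex l u x)
  | add {f g : X → ℝ} : Gen U ex u f → Gen U ex u g → Gen U ex u (fun x => f x + g x)
  | congr {f g : X → ℝ} : Gen U ex u f → EqOn g f U → Gen U ex u g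

theorem Gen.sm (hU : IsOpen U) (hu : Sm U u) {f : X → ℝ} (h : Gen U ex u f) : Sm U f := by
  induction h with
  | base c hc l => exact hc.mul (hu.dw hU l)
  | add _ _ h1 h2 => exact h1.add h2
  | congr _ he h1 => exact h1.congr he

theorem Gen.mul {f c : X → ℝ} (h : Gen U ex u f) (hc : Sm U c) :
    Gen U ex u (fun x => c x * f x) := by
  induction h with
  | base c' hc' l =>
    refine (Gen.base _ (hc.mul hc') l).congr fun x _ => ?_
    simp only; ring
  | add _ _ h1 h2 =>
    refine (h1.add h2).congr fun x _ => ?_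
    simp only; ring
  | congr _ he h1 =>
    refine h1.congr fun x hx => ?_
    simp only [he hx]

theorem Gen.word (l : List ι) : Gen U ex u (dw ex l u) :=
  (Gen.base _ (Sm.const 1) l).congr fun x _ => by simp

theorem Gen.sum {κ : Type} (s : Finset κ) {f : κ → X → ℝ} (h : ∀ k, Gen U ex u (f k)) :
    Gen U ex u (fun x => ∑ k ∈ s, f k x) := by
  classical
  induction s using Finset.induction_on with
  | empty => exact (Gen.base _ (Sm.const 0) []).congr fun x _ => by simp
  | insert k s hk ih =>
    exact ((h k).add ih).congr fun x _ => by simp [Finset.sum_insert hk]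

theorem Gen.dd_of (hU : IsOpen U) (hu : Sm U u) {e : X}
    (he : ∀ l, Gen U ex u (dd e (dw ex l u))) {f : X → ℝ} (h : Gen U ex u f) :
    Gen U ex u (dd e f) := by
  induction h with
  | base c hc l =>
    refine ((Gen.base _ (hc.dd hU e) l).add ((he l).mul hc)).congr fun x hx => ?_
    exact dd_mul (hc.diffAt hU hx) ((hu.dw hU l).diffAt hU hx) _
  | add h1 h2 i1 i2 =>
    refine (i1.add i2).congr fun x hx => ?_
    exact dd_add ((h1.sm hU hu).diffAt hU hx) ((h2.sm hU hu).diffAt hU hx) _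
  | congr _ he h1 => exact h1.congr (dd_congr hU he e)

theorem Gen.ddx (hU : IsOpen U) (hu : Sm U u) (i : ι) {f : X → ℝ} (h : Gen U ex u f) :
    Gen U ex u (dd (ex i) f) :=
  h.dd_of hU hu fun l => Gen.word (i :: l)

theorem Gen.dwx (hU : IsOpen U) (hu : Sm U u) (l : List ι) {f : X → ℝ} (h : Gen U ex u f) :
    Gen U ex u (dw ex l f) := by
  induction l with
  | nil => exact h
  | cons i l ih => exact ih.ddx hU hu i

theorem Gen.ddt (hU : IsOpen U) (hu : Sm U u) {a : X → ℝ} {c : ι → X → ℝ} (ha : Sm U a)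
    (hc : ∀ i, Sm U (c i))
    (heq : ∀ q ∈ U, heat ex et u q = a q * u q + ∑ i, c i q * dd (ex i) u q)
    {f : X → ℝ} (h : Gen U ex u f) : Gen U ex u (dd et f) := by
  have h0 : Gen U ex u (dd et u) := by
    refine ((Gen.sum Finset.univ fun i => Gen.word [i, i]).add
      ((Gen.base a ha []).add (Gen.sum Finset.univ fun i => Gen.base (c i) (hc i) [i]))).congr ?_
    intro q hq
    have := heq q hq
    simp only [heat] at this
    simp only [dw_cons, dw_nil]
    linarith
  refine h.dd_of hU hu fun l => (h0.dwx hU hu l).congr fun x hx => ?_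
  exact (dw_dd hU hu l et hx).symm

theorem Gen.vanish {p : X} (hp : p ∈ U) (hv : ∀ l, dw ex l u p = 0) {f : X → ℝ}
    (h : Gen U ex u f) : f p = 0 := by
  induction h with
  | base c hc l => simp [hv l]
  | add _ _ h1 h2 => simp [h1, h2]
  | congr _ he h1 => rw [he hp, h1]

theorem clm_norm_le_basis {κ : Type} [Fintype κ] [FiniteDimensional ℝ X] (b : Module.Basis κ ℝ X)
    (L : X →L[ℝ] ℝ) :
    ‖L‖ ≤ ∑ j, |L (b j)| * ‖LinearMap.toContinuousLinearMap (b.coord j)‖ := by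
  refine L.opNorm_le_bound (Finset.sum_nonneg fun j _ => by positivity) fun x => ?_
  conv_lhs => rw [← b.sum_repr x]
  rw [map_sum, Finset.sum_mul]
  refine (norm_sum_le _ _).trans (Finset.sum_le_sum fun j _ => ?_)
  rw [map_smul, smul_eq_mul, norm_mul, mul_comm, mul_assoc]
  refine mul_le_mul_of_nonneg_left ?_ (abs_nonneg _)
  exact (LinearMap.toContinuousLinearMap (b.coord j)).le_opNorm x

/-- Functions closed under differentiation and vanishing at `p` are flat at `p`. -/
theorem flat_of_closed {κ : Type} [Fintype κ] [FiniteDimensional ℝ X] (b : Module.Basis κ ℝ X)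
    (hU : IsOpen U) {p : X} (hp : p ∈ U) {G : (X → ℝ) → Prop} (hs : ∀ f, G f → Sm U f)
    (hd : ∀ f, G f → ∀ j, G (dd (b j) f)) (hv : ∀ f, G f → f p = 0) (n : ℕ) :
    ∀ f, G f → ∃ C, 0 ≤ C ∧ ∃ δ > 0, ∀ q ∈ Metric.ball p δ, |f q| ≤ C * ‖q - p‖ ^ n := by
  induction n with
  | zero =>
    intro f hf
    have hc : ContinuousAt f p := (hs f hf).contAt hU hp
    obtain ⟨δ, hδ, h⟩ := Metric.continuousAt_iff.1 hc 1 one_pos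
    refine ⟨1, zero_le_one, δ, hδ, fun q hq => ?_⟩
    have := h (Metric.mem_ball.1 hq)
    rw [hv f hf, Real.dist_eq, sub_zero] at this
    simpa using this.le
  | succ n ih =>
    intro f hf
    choose C hC δ hδ h using fun j => ih _ (hd f hf j)
    obtain ⟨δ', hδ', hU'⟩ := Metric.isOpen_iff.1 hU p hp
    have hN : ∀ j, 0 ≤ ‖LinearMap.toContinuousLinearMap (b.coord j)‖ := fun j => norm_nonneg _
    have hex : ∃ η > 0, η ≤ δ' ∧ ∀ j, η ≤ δ j := by
      by_cases hne : Nonempty κ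
      · obtain ⟨j0, hj0⟩ := Finite.exists_min δ
        exact ⟨min δ' (δ j0), lt_min hδ' (hδ j0), min_le_left _ _,
          fun j => (min_le_right _ _).trans (hj0 j)⟩
      · exact ⟨δ', hδ', le_rfl, fun j => (hne ⟨j⟩).elim⟩
    obtain ⟨η, hη, hη1, hη2⟩ := hex
    refine ⟨∑ j, C j * ‖LinearMap.toContinuousLinearMap (b.coord j)‖,
      Finset.sum_nonneg fun j _ => mul_nonneg (hC j) (hN j), η, hη, fun q hq => ?_⟩
    have hq' : ‖q - p‖ < η := by simpa [dist_eq_norm] using hq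
    have hsub : Metric.closedBall p ‖q - p‖ ⊆ U := fun z hz =>
      hU' (Metric.mem_ball.2 (lt_of_le_of_lt (Metric.mem_closedBall.1 hz) (hq'.trans_le hη1)))
    have key := (convex_closedBall p ‖q - p‖).norm_image_sub_le_of_norm_fderiv_le
      (𝕜 := ℝ) (f := f) (C := (∑ j, C j * ‖LinearMap.toContinuousLinearMap (b.coord j)‖) * ‖q - p‖ ^ n)
      (x := p) (y := q) (fun z hz => (hs f hf).diffAt hU (hsub hz)) ?_
      (Metric.mem_closedBall_self (norm_nonneg _)) (by simp [dist_eq_norm])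
    · rw [hv f hf, sub_zero] at key
      rw [pow_succ, ← mul_assoc]; exact key
    · intro z hz
      refine (clm_norm_le_basis b _).trans ?_
      rw [Finset.sum_mul]
      refine Finset.sum_le_sum fun j _ => ?_
      have hz' : ‖z - p‖ ≤ ‖q - p‖ := by simpa [dist_eq_norm] using hz
      have h1 := h j z (by rw [Metric.mem_ball, dist_eq_norm]; exact lt_of_le_of_lt hz' (hq'.trans_le (hη2 j)))
      have h2 : C j * ‖z - p‖ ^ n ≤ C j * ‖q - p‖ ^ n :=
        mul_le_mul_of_nonneg_left (pow_le_pow_left₀ (norm_nonneg _) hz' n) (hC j)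
      have h3 : |(fderiv ℝ f z) (b j)| ≤ C j * ‖q - p‖ ^ n := h1.trans h2
      calc _ ≤ (C j * ‖q - p‖ ^ n) * ‖LinearMap.toContinuousLinearMap (b.coord j)‖ :=
            mul_le_mul_of_nonneg_right h3 (hN j)
        _ = _ := by ring

theorem flat_of_words [FiniteDimensional ℝ X] (bb : Module.Basis (ι ⊕ Unit) ℝ X)
    (hbb : ⇑bb = bs ex et) (hU : IsOpen U) (hu : Sm U u) {a : X → ℝ} {c : ι → X → ℝ}
    (ha : Sm U a) (hc : ∀ i, Sm U (c i))
    (heq : ∀ q ∈ U, heat ex et u q = a q * u q + ∑ i, c i q * dd (ex i) u q)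
    {p : X} (hp : p ∈ U) (hv : ∀ l, dw ex l u p = 0) (n : ℕ) :
    ∃ C, 0 ≤ C ∧ ∃ δ > 0, ∀ q ∈ Metric.ball p δ, |u q| ≤ C * ‖q - p‖ ^ n := by
  refine flat_of_closed bb hU hp (G := Gen U ex u) (fun f hf => hf.sm hU hu) ?_
    (fun f hf => hf.vanish hp hv) n u (Gen.word [])
  intro f hf j
  rw [hbb]
  rcases j with i | _
  · exact hf.ddx hU hu i
  · exact hf.ddt hU hu ha hc heq
end flat

end SN

open Set MeasureTheory
set_option linter.unusedSectionVars false
set_option linter.unusedVariables false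
namespace SN
open Filter Topology

/-- Space-time. -/
abbrev XX (d : ℕ) := (Fin d → ℝ) × ℝ
/-- Spatial unit vectors. -/
def xx {d : ℕ} (i : Fin d) : XX d := (Pi.single i 1, 0)
/-- Time unit vector. -/
def tt {d : ℕ} : XX d := (0, 1)
/-- The Gaussian weight. -/
noncomputable def gam {d : ℕ} (y : Fin d → ℝ) : ℝ := Real.exp (-(∑ i, y i ^ 2) / 4)

section gauss
variable {d : ℕ}

theorem gam_pos (y : Fin d → ℝ) : 0 < gam y := Real.exp_pos _
theorem gam_smooth : ContDiff ℝ (⊤ : ℕ∞) (gam (d := d)) := by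
  unfold gam
  refine ContDiff.exp (ContDiff.div_const (ContDiff.neg (ContDiff.sum fun i _ => ?_)) _)
  exact (contDiff_apply ℝ ℝ i).pow 2

theorem fderiv_gam (y : Fin d → ℝ) (i : Fin d) :
    fderiv ℝ (gam (d := d)) y (Pi.single i 1) = -(y i / 2) * gam y := by
  have h : HasFDerivAt (gam (d := d)) (Real.exp (-(∑ i, y i ^ 2) / 4) •
      ((4 : ℝ)⁻¹ • -(∑ j, (2 * y j) • ContinuousLinearMap.proj (R := ℝ) (φ := fun _ : Fin d => ℝ) j))) y := by
    refine HasFDerivAt.exp ?_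
    have hs : HasFDerivAt (fun y : Fin d → ℝ => ∑ j, y j ^ 2)
        (∑ j, (2 * y j) • ContinuousLinearMap.proj (R := ℝ) (φ := fun _ : Fin d => ℝ) j) y := by
      refine HasFDerivAt.fun_sum fun j _ => ?_
      have := (hasFDerivAt_apply (𝕜 := ℝ) j y).pow 2
      simpa using this
    have := hs.neg.const_mul (4 : ℝ)⁻¹
    refine this.congr_of_eventuallyEq (Eventually.of_forall fun z => ?_)
    simp only [Pi.neg_apply]; ring
  rw [h.fderiv]
  simp only [_root_.smul_apply, _root_.neg_apply, _root_.sum_apply,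
    ContinuousLinearMap.proj_apply, smul_eq_mul, Pi.single_apply, mul_ite, mul_one, mul_zero,
    Finset.sum_ite_eq', Finset.mem_univ, if_true, gam]
  simp
  ring

/-- Smooth with locally uniformly (in time) compact support in space. -/
structure Cs (f : XX d → ℝ) : Prop where
  sm : Sm univ f
  supp : ∀ S : ℝ, ∃ R : ℝ, ∀ y s, s ≤ S → R < ‖y‖ → f (y, s) = 0

theorem Cs.add {f g : XX d → ℝ} (hf : Cs f) (hg : Cs g) : Cs (fun q => f q + g q) := by
  refine ⟨hf.sm.add hg.sm, fun S => ?_⟩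
  obtain ⟨R, hR⟩ := hf.supp S
  obtain ⟨R', hR'⟩ := hg.supp S
  refine ⟨max R R', fun y s hs hy => ?_⟩
  simp [hR y s hs (lt_of_le_of_lt (le_max_left _ _) hy), hR' y s hs (lt_of_le_of_lt (le_max_right _ _) hy)]

theorem Cs.mul {f c : XX d → ℝ} (hf : Cs f) (hc : Sm univ c) : Cs (fun q => c q * f q) := by
  refine ⟨hc.mul hf.sm, fun S => ?_⟩
  obtain ⟨R, hR⟩ := hf.supp S
  exact ⟨R, fun y s hs hy => by simp [hR y s hs hy]⟩

theorem Cs.smul {f : XX d → ℝ} (hf : Cs f) (c : ℝ) : Cs (fun q => c * f q) := hf.mul (Sm.const c)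

theorem Cs.sub {f g : XX d → ℝ} (hf : Cs f) (hg : Cs g) : Cs (fun q => f q - g q) := by
  have := hf.add (hg.smul (-1))
  simpa [sub_eq_add_neg] using this

theorem Cs.sum {κ : Type} (s : Finset κ) {f : κ → XX d → ℝ} (hf : ∀ k, Cs (f k)) :
    Cs (fun q => ∑ k ∈ s, f k q) := by
  classical
  induction s using Finset.induction_on with
  | empty => exact ⟨by simpa using Sm.const 0, fun S => ⟨0, by simp⟩⟩
  | insert k s hk ih =>
    simp only [Finset.sum_insert hk]
    exact (hf k).add ih

theorem Cs.dd {f : XX d → ℝ} (hf : Cs f) (e : XX d) : Cs (dd e f) := by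
  refine ⟨hf.sm.dd isOpen_univ e, fun S => ?_⟩
  obtain ⟨R, hR⟩ := hf.supp (S + 1)
  refine ⟨R, fun y s hs hy => ?_⟩
  have ho : IsOpen {q : XX d | q.2 < S + 1 ∧ R < ‖q.1‖} :=
    (isOpen_lt continuous_snd continuous_const).inter
      (isOpen_lt continuous_const continuous_fst.norm)
  have he : EqOn f (fun _ => 0) {q : XX d | q.2 < S + 1 ∧ R < ‖q.1‖} := fun q hq => hR q.1 q.2 hq.1.le hq.2
  rw [dd_congr ho he e (show (y, s) ∈ {q : XX d | q.2 < S + 1 ∧ R < ‖q.1‖} from ⟨by simp; linarith, hy⟩)]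
  exact dd_const 0 _ _

theorem Cs.slice_cont {f : XX d → ℝ} (hf : Cs f) (s : ℝ) : Continuous (fun y => f (y, s)) :=
  (contDiffOn_univ.1 hf.sm).continuous.comp (by fun_prop)

theorem Cs.integrable {f : XX d → ℝ} (hf : Cs f) (s : ℝ) :
    Integrable (fun y => f (y, s) * gam y) := by
  obtain ⟨R, hR⟩ := hf.supp s
  refine Continuous.integrable_of_hasCompactSupport
    ((hf.slice_cont s).mul gam_smooth.continuous) ?_
  refine HasCompactSupport.intro (isCompact_closedBall (0 : Fin d → ℝ) R) fun y hy => ?_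
  have : R < ‖y‖ := by simpa using hy
  simp [hR y s le_rfl this]

theorem fderiv_slice {f : XX d → ℝ} {y : Fin d → ℝ} {s : ℝ} (hf : DifferentiableAt ℝ f (y, s))
    (e : Fin d → ℝ) : fderiv ℝ (fun y => f (y, s)) y e = dd (e, 0) f (y, s) := by
  have h1 : HasFDerivAt (fun y : Fin d → ℝ => (y, s)) (ContinuousLinearMap.inl ℝ (Fin d → ℝ) ℝ) y :=
    hasFDerivAt_prodMk_left y s
  have := hf.hasFDerivAt.comp y h1
  have e2 := this.fderiv
  simp only [Function.comp_def] at e2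
  rw [e2]
  simp [dd]

theorem hasDerivAt_slice {f : XX d → ℝ} {y : Fin d → ℝ} {s : ℝ} (hf : DifferentiableAt ℝ f (y, s)) :
    HasDerivAt (fun s => f (y, s)) (dd tt f (y, s)) s := by
  have h1 : HasDerivAt (fun s : ℝ => (y, s)) ((0 : Fin d → ℝ), (1 : ℝ)) s :=
    (hasDerivAt_const s y).prodMk (hasDerivAt_id s)
  exact hf.hasFDerivAt.comp_hasDerivAt s h1

/-- Weighted integral. -/
noncomputable def gInt (f : XX d → ℝ) (s : ℝ) : ℝ := ∫ y, f (y, s) * gam y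

theorem gInt_add {f g : XX d → ℝ} (hf : Cs f) (hg : Cs g) (s : ℝ) :
    gInt (fun q => f q + g q) s = gInt f s + gInt g s := by
  simp only [gInt, add_mul]
  exact integral_add (hf.integrable s) (hg.integrable s)
theorem gInt_smul (f : XX d → ℝ) (c : ℝ) (s : ℝ) :
    gInt (fun q => c * f q) s = c * gInt f s := by
  simp only [gInt, mul_assoc]
  exact integral_const_mul c _
theorem gInt_sum {κ : Type} (t : Finset κ) {f : κ → XX d → ℝ} (hf : ∀ k, Cs (f k)) (s : ℝ) :
    gInt (fun q => ∑ k ∈ t, f k q) s = ∑ k ∈ t, gInt (f k) s := by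
  simp only [gInt, Finset.sum_mul]
  exact integral_finsetSum t fun k _ => (hf k).integrable s
theorem gInt_nonneg {f : XX d → ℝ} (hf : ∀ q, 0 ≤ f q) (s : ℝ) : 0 ≤ gInt f s :=
  integral_nonneg fun y => mul_nonneg (hf _) (gam_pos y).le

theorem gam_le_one (y : Fin d → ℝ) : gam y ≤ 1 :=
  Real.exp_le_one_iff.2 (by
    have : 0 ≤ ∑ i, y i ^ 2 := Finset.sum_nonneg fun i _ => sq_nonneg _
    linarith)

theorem Cs.hasDerivAt_gInt {f : XX d → ℝ} (hf : Cs f) (s : ℝ) :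
    HasDerivAt (gInt f) (gInt (SN.dd tt f) s) s := by
  have hd := hf.dd tt
  obtain ⟨R, hR⟩ := hd.supp (s + 1)
  have hcont := (contDiffOn_univ.1 hd.sm).continuous
  obtain ⟨M, hM⟩ := ((isCompact_closedBall (0 : Fin d → ℝ) R).prod
    (isCompact_Icc (a := s - 1) (b := s + 1))).exists_bound_of_continuousOn hcont.continuousOn
  refine (hasDerivAt_integral_of_dominated_loc_of_deriv_le (s := Ioo (s - 1) (s + 1))
    (F := fun s y => f (y, s) * gam y) (F' := fun s y => SN.dd tt f (y, s) * gam y)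
    (bound := (Metric.closedBall (0 : Fin d → ℝ) R).indicator fun _ => M)
    (Ioo_mem_nhds (by linarith) (by linarith)) ?_ (hf.integrable s)
    (hd.integrable s).aestronglyMeasurable ?_ ?_ ?_).2
  · exact Eventually.of_forall fun s => (hf.integrable s).aestronglyMeasurable
  · refine Eventually.of_forall fun y s' hs' => ?_
    by_cases hy : y ∈ Metric.closedBall (0 : Fin d → ℝ) R
    · rw [indicator_of_mem hy, norm_mul]
      have h1 := hM (y, s') ⟨hy, ⟨hs'.1.le, hs'.2.le⟩⟩
      have h2 : ‖gam y‖ ≤ 1 := by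
        rw [Real.norm_eq_abs, abs_of_pos (gam_pos y)]; exact gam_le_one y
      calc _ ≤ ‖SN.dd tt f (y, s')‖ * 1 := mul_le_mul_of_nonneg_left h2 (norm_nonneg _)
        _ ≤ M := by rw [mul_one]; exact h1
    · rw [indicator_of_notMem hy]
      have : R < ‖y‖ := by simpa using hy
      simp [hR y s' hs'.2.le this]
  · exact (integrable_indicator_iff Metric.isClosed_closedBall.measurableSet).2
      (integrableOn_const (isCompact_closedBall _ _).measure_lt_top.ne)
  · refine Eventually.of_forall fun y s' hs' => ?_
    exact (hasDerivAt_slice (hf.sm.diffAt isOpen_univ (mem_univ _))).mul_const _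

theorem sm_coord (i : Fin d) : Sm univ (fun q : XX d => q.1 i) :=
  contDiffOn_univ.2 ((contDiff_apply ℝ ℝ i).comp contDiff_fst)

theorem gInt_by_parts {p q : XX d → ℝ} (hp : Cs p) (hq : Cs q) (i : Fin d) (s : ℝ) :
    gInt (fun z => p z * (dd (xx i) q z - z.1 i / 2 * q z)) s = - gInt (fun z => dd (xx i) p z * q z) s := by
  have hpd : ∀ y, DifferentiableAt ℝ p (y, s) := fun y => hp.sm.diffAt isOpen_univ (mem_univ _)
  have hqd : ∀ y, DifferentiableAt ℝ q (y, s) := fun y => hq.sm.diffAt isOpen_univ (mem_univ _)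
  have hps : ∀ y, DifferentiableAt ℝ (fun y => p (y, s)) y := fun y =>
    (hpd y).comp y (by fun_prop)
  have hqs : ∀ y, DifferentiableAt ℝ (fun y => q (y, s)) y := fun y =>
    (hqd y).comp y (by fun_prop)
  have hg : ∀ y, DifferentiableAt ℝ (gam (d := d)) y := fun y =>
    gam_smooth.differentiable (by simp) y
  have e1 : ∀ y, fderiv ℝ (fun y => p (y, s)) y (Pi.single i 1) = dd (xx i) p (y, s) := fun y =>
    fderiv_slice (hpd y) _
  have e2 : ∀ y, fderiv ℝ (fun y => q (y, s) * gam y) y (Pi.single i 1)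
      = (dd (xx i) q (y, s) - y i / 2 * q (y, s)) * gam y := by
    intro y
    rw [fderiv_fun_mul (hqs y) (hg y)]
    simp only [_root_.add_apply, _root_.smul_apply, smul_eq_mul]
    rw [fderiv_gam, fderiv_slice (hqd y)]
    simp only [xx]; ring
  have hc : Sm univ (fun z : XX d => z.1 i / 2) := (sm_coord i).div_const 2
  have key := integral_mul_fderiv_eq_neg_fderiv_mul_of_integrable (μ := volume)
    (f := fun y => p (y, s)) (g := fun y => q (y, s) * gam y) (v := Pi.single i 1) ?_ ?_ ?_
    (fun y _ => hps y) (fun y _ => (hqs y).mul (hg y))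
  · simp only [e1, e2] at key
    simp only [gInt]
    simp only [mul_assoc] at key ⊢
    exact key
  · simp only [e1, ← mul_assoc]
    exact (hq.mul (hp.dd (xx i)).sm).integrable s
  · simp only [e2, ← mul_assoc]
    exact (((hq.dd (xx i)).sub (hq.mul hc)).mul hp.sm).integrable s
  · simp only [← mul_assoc]
    exact (hq.mul hp.sm).integrable s

/-- Weighted `L²` product. -/
noncomputable def ip (f g : XX d → ℝ) (s : ℝ) : ℝ := gInt (fun q => f q * g q) s

theorem ip_comm (f g : XX d → ℝ) (s : ℝ) : ip f g s = ip g f s := by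
  simp only [ip, mul_comm]
theorem ip_add {f g h : XX d → ℝ} (hf : Cs f) (hg : Cs g) (hh : Cs h) (s : ℝ) :
    ip f (fun q => g q + h q) s = ip f g s + ip f h s := by
  simp only [ip, mul_add]
  exact gInt_add (hg.mul hf.sm) (hh.mul hf.sm) s
theorem ip_smul (f g : XX d → ℝ) (c s : ℝ) : ip f (fun q => c * g q) s = c * ip f g s := by
  simp only [ip]
  rw [← gInt_smul]
  congr 1; funext q; ring
theorem ip_self_nonneg (f : XX d → ℝ) (s : ℝ) : 0 ≤ ip f f s := gInt_nonneg (fun _ => mul_self_nonneg _) s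
theorem ip_expand {f g : XX d → ℝ} (hf : Cs f) (hg : Cs g) (c s : ℝ) :
    ip (fun q => f q + c * g q) (fun q => f q + c * g q) s
      = ip f f s + 2 * c * ip f g s + c ^ 2 * ip g g s := by
  have hcg := hg.smul c
  rw [ip_add (hf.add hcg) hf hcg, ip_smul, ip_comm _ f, ip_comm _ g, ip_add hf hf hcg, ip_add hg hf hcg,
    ip_smul, ip_smul, ip_comm g f]
  ring
theorem ip_cs {f g : XX d → ℝ} (hf : Cs f) (hg : Cs g) (s : ℝ) :
    ip f g s ^ 2 ≤ ip f f s * ip g g s := by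
  have h := discrim_le_zero (a := ip g g s) (b := 2 * ip f g s) (c := ip f f s) (fun x => by
    have h1 := ip_self_nonneg (fun q => f q + x * g q) s
    rw [ip_expand hf hg] at h1
    linarith)
  simp only [discrim] at h
  nlinarith

/-- The Ornstein–Uhlenbeck operator. -/
noncomputable def OU (w : XX d → ℝ) (q : XX d) : ℝ :=
  ∑ i, (dd (xx i) (dd (xx i) w) q - q.1 i / 2 * dd (xx i) w q)

theorem Cs.OU {w : XX d → ℝ} (hw : Cs w) : Cs (OU w) :=
  Cs.sum _ fun i => ((hw.dd _).dd _).sub ((hw.dd _).mul ((sm_coord i).div_const 2))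

theorem ip_OU {p w : XX d → ℝ} (hp : Cs p) (hw : Cs w) (s : ℝ) :
    ip p (OU w) s = - ∑ i, ip (dd (xx i) p) (dd (xx i) w) s := by
  have : ip p (OU w) s
      = gInt (fun q => ∑ i, p q * (dd (xx i) (dd (xx i) w) q - q.1 i / 2 * dd (xx i) w q)) s := by
    simp only [ip, SN.OU, Finset.mul_sum]
  rw [this, gInt_sum _ fun i =>
    (((hw.dd _).dd _).sub ((hw.dd _).mul ((sm_coord i).div_const 2))).mul hp.sm,
    ← Finset.sum_neg_distrib]
  exact Finset.sum_congr rfl fun i _ => gInt_by_parts hp (hw.dd _) i s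

theorem ip_deriv {f : XX d → ℝ} (hf : Cs f) (s : ℝ) :
    HasDerivAt (fun s => ip f f s) (2 * ip f (dd tt f) s) s := by
  have h := (hf.mul hf.sm).hasDerivAt_gInt s
  have e : dd tt (fun q => f q * f q) = fun q => 2 * (f q * dd tt f q) := by
    funext q
    rw [dd_mul (hf.sm.diffAt isOpen_univ (mem_univ _)) (hf.sm.diffAt isOpen_univ (mem_univ _))]
    ring
  rw [e, gInt_smul] at h
  exact h

theorem freq_calc {w G : XX d → ℝ} (hw : Cs w) (hG : Cs G)
    (hwG : ∀ q, dd tt w q = OU w q + G q) :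
    ∃ H' D' : ℝ → ℝ, ∀ s, HasDerivAt (fun s => ip w w s) (H' s) s ∧
      HasDerivAt (fun s => ∑ i, ip (dd (xx i) w) (dd (xx i) w) s) (D' s) s ∧
      D' s * ip w w s - (∑ i, ip (dd (xx i) w) (dd (xx i) w) s) * H' s ≤ ip w w s * ip G G s / 2 ∧
      -2 * (∑ i, ip (dd (xx i) w) (dd (xx i) w) s) - ip w w s - ip G G s ≤ H' s := by
  have hL := hw.OU
  have hT : dd tt w = fun q => OU w q + G q := funext hwG
  refine ⟨fun s => 2 * ip w (dd tt w) s, fun s => -2 * ip (dd tt w) (OU w) s, fun s =>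
    ⟨ip_deriv hw s, ?_, ?_, ?_⟩⟩
  · have h1 := HasDerivAt.fun_sum (u := Finset.univ) fun i _ => ip_deriv (hw.dd (xx i)) s
    have e : -2 * ip (dd tt w) (OU w) s
        = ∑ i, 2 * ip (dd (xx i) w) (dd tt (dd (xx i) w)) s := by
      rw [ip_OU (hw.dd tt) hw, ← Finset.mul_sum]
      have : ∀ i, ip (dd (xx i) (dd tt w)) (dd (xx i) w) s = ip (dd (xx i) w) (dd tt (dd (xx i) w)) s := by
        intro i
        rw [ip_comm]
        congr 1
        funext q
        exact dd_comm isOpen_univ hw.sm _ _ (mem_univ q)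
      simp only [this]
      ring
    simp only [e]
    exact h1
  · have hD : ∑ i, ip (dd (xx i) w) (dd (xx i) w) s = - ip w (OU w) s := by
      rw [ip_OU hw hw]; ring
    have hP : Cs (fun q => OU w q + (1/2) * G q) := hL.add (hG.smul _)
    have c := ip_cs hw hP s
    rw [ip_expand hL hG, ip_add hw hL (hG.smul _), ip_smul] at c
    simp only
    rw [hD, hT, ip_add hw hL hG, ip_comm (fun q => OU w q + G q) (OU w), ip_add hL hL hG]
    have := ip_self_nonneg w s
    nlinarith [sq_nonneg (ip w G s)]
  · have hD : ∑ i, ip (dd (xx i) w) (dd (xx i) w) s = - ip w (OU w) s := by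
      rw [ip_OU hw hw]; ring
    have h1 := ip_self_nonneg (fun q => w q + 1 * G q) s
    rw [ip_expand hw hG] at h1
    simp only
    rw [hD, hT, ip_add hw hL hG]
    linarith
end gauss

end SN

open Set MeasureTheory
set_option linter.unusedSectionVars false
set_option linter.unusedVariables false
namespace SN
open Filter Topology

section resc
variable {d : ℕ}

/-- Wider Gaussian. -/
noncomputable def g8 (y : Fin d → ℝ) : ℝ := Real.exp (-(∑ i, y i ^ 2) / 8)

theorem g8_integrable : Integrable (g8 (d := d)) := by
  have h : ∀ i : Fin d, Integrable (fun x : ℝ => Real.exp (-(1/8) * x ^ 2)) := fun i =>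
    integrable_exp_neg_mul_sq (by norm_num)
  have := Integrable.fintype_prod (μ := fun _ : Fin d => volume) h
  refine this.congr (Eventually.of_forall fun y => ?_)
  simp only [g8]
  rw [← Real.exp_sum, neg_div, Finset.sum_div, ← Finset.sum_neg_distrib]
  congr 1
  exact Finset.sum_congr rfl fun i _ => by ring

theorem g8_nonneg (y : Fin d → ℝ) : 0 ≤ g8 y := (Real.exp_pos _).le

theorem norm_sq_le_sum (y : Fin d → ℝ) : ‖y‖ ^ 2 ≤ ∑ i, y i ^ 2 := by
  have h0 : 0 ≤ ∑ i, y i ^ 2 := Finset.sum_nonneg fun i _ => sq_nonneg _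
  have : ‖y‖ ≤ Real.sqrt (∑ i, y i ^ 2) := by
    refine (pi_norm_le_iff_of_nonneg (Real.sqrt_nonneg _)).2 fun i => ?_
    rw [Real.norm_eq_abs, ← Real.sqrt_sq_eq_abs]
    exact Real.sqrt_le_sqrt (Finset.single_le_sum (f := fun i => y i ^ 2) (fun i _ => sq_nonneg _) (Finset.mem_univ i))
  calc ‖y‖ ^ 2 ≤ Real.sqrt (∑ i, y i ^ 2) ^ 2 := pow_le_pow_left₀ (norm_nonneg _) this 2
    _ = _ := Real.sq_sqrt h0

theorem sum_le_norm_sq (y : Fin d → ℝ) : ∑ i, y i ^ 2 ≤ d * ‖y‖ ^ 2 := by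
  have : ∀ i ∈ Finset.univ, y i ^ 2 ≤ ‖y‖ ^ 2 := fun i _ => by
    rw [← sq_abs]
    exact pow_le_pow_left₀ (abs_nonneg _) (norm_le_pi_norm y i) 2
  simpa using Finset.sum_le_card_nsmul _ _ _ this

theorem poly_le_exp (k : ℕ) : ∃ B : ℝ, 0 ≤ B ∧ ∀ r : ℝ, 0 ≤ r → (1 + r) ^ (2 * k) ≤ B * Real.exp (r ^ 2 / 8) := by
  refine ⟨16 ^ k * k.factorial * Real.exp (1 / 8), by positivity, fun r hr => ?_⟩
  have h1 := Real.pow_div_factorial_le_exp (x := 1 / 8 + r ^ 2 / 8) (by positivity) k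
  rw [div_le_iff₀ (by positivity)] at h1
  calc (1 + r) ^ (2 * k) = ((1 + r) ^ 2) ^ k := by rw [pow_mul]
    _ ≤ (16 * (1 / 8 + r ^ 2 / 8)) ^ k := by
        refine pow_le_pow_left₀ (by positivity) ?_ k
        nlinarith [sq_nonneg (1 - r)]
    _ = 16 ^ k * (1 / 8 + r ^ 2 / 8) ^ k := by rw [mul_pow]
    _ ≤ 16 ^ k * (Real.exp (1 / 8 + r ^ 2 / 8) * k.factorial) := by gcongr
    _ = _ := by rw [Real.exp_add]; ring

/-- Self-similar change of variables. -/
noncomputable def Th (x0 : Fin d → ℝ) (t0 : ℝ) (q : XX d) : XX d :=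
  (x0 + Real.exp (-(q.2 / 2)) • q.1, t0 - Real.exp (-q.2))

theorem Th_smooth (x0 : Fin d → ℝ) (t0 : ℝ) : ContDiff ℝ (⊤ : ℕ∞) (Th x0 t0) := by
  unfold Th
  refine ContDiff.prodMk ?_ ?_
  · refine contDiff_const.add (ContDiff.smul (ContDiff.exp ?_) contDiff_fst)
    exact (contDiff_snd.div_const 2).neg
  · exact contDiff_const.sub (ContDiff.exp contDiff_snd.neg)

theorem dd_comp_Th {u : XX d → ℝ} (hu : Sm univ u) (x0 : Fin d → ℝ) (t0 : ℝ) (q e : XX d) :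
    dd e (fun q => u (Th x0 t0 q)) q
      = dd (Real.exp (-(q.2 / 2)) • e.1 + (-(e.2 / 2) * Real.exp (-(q.2 / 2))) • q.1,
          e.2 * Real.exp (-q.2)) u (Th x0 t0 q) := by
  have hT : HasDerivAt (fun r : ℝ => Th x0 t0 (q + r • e))
      (Real.exp (-(q.2 / 2)) • e.1 + (-(e.2 / 2) * Real.exp (-(q.2 / 2))) • q.1,
          e.2 * Real.exp (-q.2)) 0 := by
    simp only [Th, Prod.fst_add, Prod.snd_add, Prod.smul_fst, Prod.smul_snd, smul_eq_mul]
    have l2 : HasDerivAt (fun r : ℝ => q.2 + r * e.2) e.2 0 := by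
      simpa using ((hasDerivAt_id (0 : ℝ)).mul_const e.2).const_add q.2
    have l1 : HasDerivAt (fun r : ℝ => q.1 + r • e.1) e.1 0 := by
      simpa using ((hasDerivAt_id (0 : ℝ)).smul_const e.1).const_add q.1
    have e2 := l2.neg.exp
    have e1 := (l2.div_const 2).neg.exp
    refine HasDerivAt.prodMk ?_ ?_
    · have := (e1.smul l1).const_add x0
      simp only [zero_mul, add_zero, zero_smul, Pi.neg_apply] at this
      convert this using 1
      congr 2
      ring
    · have := e2.const_sub t0
      simp only [zero_mul, add_zero, Pi.neg_apply] at this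
      convert this using 1
      ring
  have h1 := HasFDerivAt.comp_hasDerivAt (x := (0 : ℝ)) (f := fun r : ℝ => Th x0 t0 (q + r • e))
    (l := u) (l' := fderiv ℝ u (Th x0 t0 q)) (by
      have := (hu.diffAt isOpen_univ (mem_univ (Th x0 t0 q))).hasFDerivAt
      simpa using this) hT
  have hc : Sm univ (fun q => u (Th x0 t0 q)) :=
    contDiffOn_univ.2 ((contDiffOn_univ.1 hu).comp (Th_smooth x0 t0))
  have h2 := hasDerivAt_line (q := q) (e := e) (s := 0) (hc.diffAt isOpen_univ (mem_univ _))
  have h3 := h2.unique h1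
  simp only [zero_smul, add_zero] at h3
  exact h3

theorem dd_comp_xx {u : XX d → ℝ} (hu : Sm univ u) (x0 : Fin d → ℝ) (t0 : ℝ) (i : Fin d) :
    dd (xx i) (fun q => u (Th x0 t0 q))
      = fun q => Real.exp (-(q.2 / 2)) * dd (xx i) u (Th x0 t0 q) := by
  funext q
  rw [dd_comp_Th hu]
  have : ((Real.exp (-(q.2 / 2)) • (xx i : XX d).1 + (-((xx i : XX d).2 / 2) * Real.exp (-(q.2 / 2))) • q.1,
          (xx i : XX d).2 * Real.exp (-q.2)) : XX d) = Real.exp (-(q.2 / 2)) • xx i := by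
    simp [xx]
  rw [this]
  simp [dd]

theorem XX_decomp (z : XX d) : z = (∑ i, z.1 i • xx i) + z.2 • tt := by
  refine Prod.ext ?_ ?_
  · funext j
    simp [xx, tt, Prod.fst_sum, Finset.sum_apply, Pi.single_apply]
  · simp [xx, tt, Prod.snd_sum]

theorem dd_decomp (u : XX d → ℝ) (z q : XX d) :
    dd z u q = (∑ i, z.1 i * dd (xx i) u q) + z.2 * dd tt u q := by
  conv_lhs => rw [XX_decomp z]
  simp [dd, map_add, map_sum]

theorem resc_eq {u : XX d → ℝ} (hu : Sm univ u) (x0 : Fin d → ℝ) (t0 : ℝ) (q : XX d) :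
    dd tt (fun q => u (Th x0 t0 q)) q = OU (fun q => u (Th x0 t0 q)) q
      + Real.exp (-q.2) * heat xx tt u (Th x0 t0 q) := by
  have hE : Sm univ (fun q : XX d => Real.exp (-(q.2 / 2))) :=
    contDiffOn_univ.2 (ContDiff.exp (contDiff_snd.div_const 2).neg)
  have hE0 : ∀ i : Fin d, ∀ q, dd (xx i) (fun q : XX d => Real.exp (-(q.2 / 2))) q = 0 := by
    intro i q
    have h2 := hasDerivAt_line (q := q) (e := xx i) (s := 0) (hE.diffAt isOpen_univ (mem_univ _))
    have h3 : HasDerivAt (fun s : ℝ => Real.exp (-((q + s • xx i).2 / 2))) 0 0 := by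
      simp only [xx, Prod.snd_add, Prod.smul_snd, smul_zero, add_zero]
      exact hasDerivAt_const _ _
    simpa using h2.unique h3
  have hdi : ∀ i, Sm univ (dd (xx i) u) := fun i => hu.dd isOpen_univ _
  have hdic : ∀ i, Sm univ (fun q => dd (xx i) u (Th x0 t0 q)) := fun i =>
    contDiffOn_univ.2 ((contDiffOn_univ.1 (hdi i)).comp (Th_smooth x0 t0))
  have h2 : ∀ i, dd (xx i) (dd (xx i) (fun q => u (Th x0 t0 q))) q
      = Real.exp (-q.2) * dd (xx i) (dd (xx i) u) (Th x0 t0 q) := by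
    intro i
    rw [dd_comp_xx hu, dd_mul (hE.diffAt isOpen_univ (mem_univ _)) ((hdic i).diffAt isOpen_univ (mem_univ _)),
      hE0, dd_comp_xx (hdi i)]
    have : Real.exp (-q.2) = Real.exp (-(q.2 / 2)) * Real.exp (-(q.2 / 2)) := by
      rw [← Real.exp_add]; congr 1; ring
    rw [this]; ring
  rw [dd_comp_Th hu, dd_decomp]
  simp only [OU, h2]
  simp only [dd_comp_xx hu, heat]
  simp only [tt, smul_zero, zero_add, Pi.smul_apply, smul_eq_mul, one_mul, mul_sub, Finset.mul_sum,
    Finset.sum_sub_distrib]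
  have : ∀ i, q.1 i / 2 * (Real.exp (-(q.2 / 2)) * dd (xx i) u (Th x0 t0 q))
     = - (-(1 / 2) * Real.exp (-(q.2 / 2)) * q.1 i * dd (xx i) u (Th x0 t0 q)) := fun i => by ring
  simp only [this, Finset.sum_neg_distrib]
  simp only [mul_assoc]
  ring

theorem resc_Cs {u : XX d → ℝ} (hu : Sm univ u) {M : ℝ} (hM : ∀ q, M < ‖q‖ → u q = 0)
    (x0 : Fin d → ℝ) (t0 : ℝ) : Cs (fun q => u (Th x0 t0 q)) := by
  refine ⟨contDiffOn_univ.2 ((contDiffOn_univ.1 hu).comp (Th_smooth x0 t0)), fun S => ?_⟩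
  refine ⟨(M + ‖x0‖) * Real.exp (S / 2), fun y s hs hy => hM _ ?_⟩
  have hpos := Real.exp_pos (-(s / 2))
  by_cases hM0 : M + ‖x0‖ < 0
  · have := norm_nonneg x0
    exact lt_of_lt_of_le (by linarith) (norm_nonneg _)
  push Not at hM0
  have h1 : (M + ‖x0‖) * Real.exp (s / 2) < ‖y‖ :=
    lt_of_le_of_lt (mul_le_mul_of_nonneg_left (Real.exp_le_exp.2 (by linarith)) hM0) hy
  have h2 : M + ‖x0‖ < Real.exp (-(s / 2)) * ‖y‖ := by
    have := mul_lt_mul_of_pos_left h1 hpos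
    have e : Real.exp (-(s / 2)) * ((M + ‖x0‖) * Real.exp (s / 2)) = M + ‖x0‖ := by
      rw [mul_comm (M + _), ← mul_assoc, ← Real.exp_add]; simp
    linarith
  have h3 : ‖Real.exp (-(s / 2)) • y‖ ≤ ‖x0 + Real.exp (-(s / 2)) • y‖ + ‖x0‖ := by
    have := norm_sub_le (x0 + Real.exp (-(s / 2)) • y) x0
    simpa using this
  rw [norm_smul, Real.norm_eq_abs, abs_of_pos hpos] at h3
  have h4 : M < ‖(Th x0 t0 (y, s)).1‖ := by
    show M < ‖x0 + Real.exp (-(s / 2)) • y‖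
    linarith
  exact h4.trans_le (norm_fst_le (Th x0 t0 (y, s)))
end resc

end SN

open Set MeasureTheory
set_option linter.unusedSectionVars false
set_option linter.unusedVariables false
namespace SN
open Filter Topology

section sucp
variable {d : ℕ}

theorem Th_norm (x0 : Fin d → ℝ) (t0 : ℝ) (y : Fin d → ℝ) (s : ℝ) :
    ‖Th x0 t0 (y, s) - (x0, t0)‖ = max (Real.exp (-(s / 2)) * ‖y‖) (Real.exp (-s)) := by
  have : Th x0 t0 (y, s) - (x0, t0) = (Real.exp (-(s / 2)) • y, -Real.exp (-s)) := by
    simp [Th]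
  rw [this, Prod.norm_def, norm_smul, norm_neg, Real.norm_eq_abs, Real.norm_eq_abs,
    abs_of_pos (Real.exp_pos _), abs_of_pos (Real.exp_pos _)]

theorem sum_sq_aux (a : ℝ) (b : Fin d → ℝ) :
    (|a| + ∑ i, |b i|) ^ 2 ≤ (2 + 2 * d) * (a ^ 2 + ∑ i, b i ^ 2) := by
  have h1 : (∑ i, |b i|) ^ 2 ≤ d * ∑ i, b i ^ 2 := by
    have := sq_sum_le_card_mul_sum_sq (s := Finset.univ) (f := fun i => |b i|)
    simpa using this
  have h0 : 0 ≤ ∑ i, b i ^ 2 := Finset.sum_nonneg fun i _ => sq_nonneg _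
  have h2 : (0 : ℝ) ≤ d := Nat.cast_nonneg d
  have h3 := sq_abs a
  nlinarith [sq_nonneg (|a| - ∑ i, |b i|), mul_nonneg h2 (sq_nonneg a)]

theorem Q_est {u : XX d → ℝ} (hu : Sm univ u) {M : ℝ} (hM : ∀ q, M < ‖q‖ → u q = 0)
    (x0 : Fin d → ℝ) (t0 : ℝ) {C0 R : ℝ} (hC0 : 0 ≤ C0) (hR : 0 < R)
    (hF1 : ∀ q, ‖q - (x0, t0)‖ < R → |heat xx tt u q| ≤ C0 * (|u q| + ∑ i, |dd (xx i) u q|))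
    (hF2 : ∀ q, |heat xx tt u q| ≤ C0) {G w : XX d → ℝ}
    (hw : w = fun q => u (Th x0 t0 q))
    (hG : G = fun q => Real.exp (-q.2) * heat xx tt u (Th x0 t0 q)) (hGc : Cs G)
    {s : ℝ} (hs0 : 0 ≤ s) (hsR : Real.exp (-s) < R) :
    ip G G s ≤ C0 ^ 2 * (2 + 2 * d) * Real.exp (-s) *
        (ip w w s + ∑ i, ip (dd (xx i) w) (dd (xx i) w) s)
      + C0 ^ 2 * Real.exp (-(R ^ 2 / 8 * Real.exp s)) * ∫ y : Fin d → ℝ, g8 y := by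
  have hwc : Cs w := hw ▸ resc_Cs hu hM x0 t0
  have hsum : Cs (fun q => w q * w q + ∑ i, dd (xx i) w q * dd (xx i) w q) :=
    (hwc.mul hwc.sm).add (Cs.sum _ fun i => (hwc.dd _).mul (hwc.dd _).sm)
  have e1 : ip w w s + ∑ i, ip (dd (xx i) w) (dd (xx i) w) s
      = gInt (fun q => w q * w q + ∑ i, dd (xx i) w q * dd (xx i) w q) s := by
    rw [gInt_add (hwc.mul hwc.sm) (Cs.sum _ fun i => (hwc.dd _).mul (hwc.dd _).sm),
      gInt_sum _ fun i => (hwc.dd _).mul (hwc.dd _).sm]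
    rfl
  rw [e1]
  simp only [ip, gInt]
  rw [← integral_const_mul, ← integral_const_mul, ← integral_add ((hsum.integrable s).const_mul _)
    (g8_integrable.const_mul _)]
  refine integral_mono ((hGc.mul hGc.sm).integrable s)
    (((hsum.integrable s).const_mul _).add (g8_integrable.const_mul _)) fun y => ?_
  have hE := Real.exp_pos (-s)
  have hE1 : Real.exp (-s) ≤ 1 := Real.exp_le_one_iff.2 (by linarith)
  have hEh := Real.exp_pos (-(s / 2))
  have hEq : Real.exp (-(s / 2)) * Real.exp (-(s / 2)) = Real.exp (-s) := by
    rw [← Real.exp_add]; congr 1; ring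
  have hg := gam_pos y
  simp only
  set z := Th x0 t0 (y, s) with hz
  have hGz : G (y, s) = Real.exp (-s) * heat xx tt u z := by rw [hG]
  have hwz : w (y, s) = u z := by rw [hw]
  have hwi : ∀ i, dd (xx i) w (y, s) = Real.exp (-(s / 2)) * dd (xx i) u z := by
    intro i; rw [hw, dd_comp_xx hu]
  have h8 := g8_nonneg y
  have hnn : 0 ≤ w (y, s) * w (y, s) + ∑ i, dd (xx i) w (y, s) * dd (xx i) w (y, s) :=
    add_nonneg (mul_self_nonneg _) (Finset.sum_nonneg fun i _ => mul_self_nonneg _)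
  have hT1 : 0 ≤ C0 ^ 2 * (2 + 2 * d) * Real.exp (-s) *
      ((w (y, s) * w (y, s) + ∑ i, dd (xx i) w (y, s) * dd (xx i) w (y, s)) * gam y) := by
    have : (0 : ℝ) ≤ d := Nat.cast_nonneg d
    positivity
  have hT2 : 0 ≤ C0 ^ 2 * Real.exp (-(R ^ 2 / 8 * Real.exp s)) * g8 y := by positivity
  by_cases hzR : ‖z - (x0, t0)‖ < R
  · refine le_add_of_le_of_nonneg ?_ hT2
    rw [← mul_assoc]
    refine mul_le_mul_of_nonneg_right ?_ hg.le
    have h1 := hF1 z hzR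
    have h2 : (heat xx tt u z) ^ 2 ≤ C0 ^ 2 * ((2 + 2 * d) * (u z ^ 2 + ∑ i, dd (xx i) u z ^ 2)) := by
      rw [← sq_abs]
      calc |heat xx tt u z| ^ 2 ≤ (C0 * (|u z| + ∑ i, |dd (xx i) u z|)) ^ 2 :=
            pow_le_pow_left₀ (abs_nonneg _) h1 2
        _ = C0 ^ 2 * (|u z| + ∑ i, |dd (xx i) u z|) ^ 2 := by ring
        _ ≤ _ := mul_le_mul_of_nonneg_left (sum_sq_aux _ _) (sq_nonneg _)
    have h3 : ∑ i, dd (xx i) w (y, s) * dd (xx i) w (y, s) = Real.exp (-s) * ∑ i, dd (xx i) u z ^ 2 := by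
      rw [Finset.mul_sum]
      refine Finset.sum_congr rfl fun i _ => ?_
      rw [hwi, ← hEq]; ring
    rw [hGz, h3, hwz]
    have h4 : Real.exp (-s) * (u z ^ 2 + ∑ i, dd (xx i) u z ^ 2)
        ≤ u z * u z + Real.exp (-s) * ∑ i, dd (xx i) u z ^ 2 := by
      nlinarith [sq_nonneg (u z)]
    calc Real.exp (-s) * heat xx tt u z * (Real.exp (-s) * heat xx tt u z)
        = Real.exp (-s) ^ 2 * (heat xx tt u z) ^ 2 := by ring
      _ ≤ Real.exp (-s) ^ 2 * (C0 ^ 2 * ((2 + 2 * d) * (u z ^ 2 + ∑ i, dd (xx i) u z ^ 2))) :=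
          mul_le_mul_of_nonneg_left h2 (sq_nonneg _)
      _ = C0 ^ 2 * (2 + 2 * d) * Real.exp (-s) * (Real.exp (-s) * (u z ^ 2 + ∑ i, dd (xx i) u z ^ 2)) := by
          ring
      _ ≤ _ := by
          refine mul_le_mul_of_nonneg_left h4 ?_
          have : (0 : ℝ) ≤ d := Nat.cast_nonneg d
          positivity
  · refine le_add_of_nonneg_of_le hT1 ?_
    rw [hz, Th_norm] at hzR
    have hy : R ≤ Real.exp (-(s / 2)) * ‖y‖ := by
      by_contra hcon
      push Not at hcon
      exact hzR (max_lt hcon hsR)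
    have hy2 : R ^ 2 * Real.exp s ≤ ∑ i, y i ^ 2 := by
      refine le_trans ?_ (norm_sq_le_sum y)
      have h1 : R ^ 2 ≤ (Real.exp (-(s / 2)) * ‖y‖) ^ 2 := pow_le_pow_left₀ hR.le hy 2
      have h2 : (Real.exp (-(s / 2)) * ‖y‖) ^ 2 = Real.exp (-s) * ‖y‖ ^ 2 := by rw [← hEq]; ring
      rw [h2] at h1
      calc R ^ 2 * Real.exp s ≤ Real.exp (-s) * ‖y‖ ^ 2 * Real.exp s :=
            mul_le_mul_of_nonneg_right h1 (Real.exp_pos _).le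
        _ = (Real.exp (-s) * Real.exp s) * ‖y‖ ^ 2 := by ring
        _ = ‖y‖ ^ 2 := by rw [← Real.exp_add]; simp
    have hgam : gam y ≤ Real.exp (-(R ^ 2 / 8 * Real.exp s)) * g8 y := by
      simp only [gam, g8]
      rw [← Real.exp_add]
      refine Real.exp_le_exp.2 ?_
      linarith
    have h5 : G (y, s) * G (y, s) ≤ C0 ^ 2 := by
      rw [hGz]
      have h6 : |Real.exp (-s) * heat xx tt u z| ≤ C0 := by
        rw [abs_mul, abs_of_pos hE]
        have := hF2 z
        have := abs_nonneg (heat xx tt u z)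
        nlinarith
      rw [← sq, ← sq_abs]
      exact pow_le_pow_left₀ (abs_nonneg _) h6 2
    rw [mul_assoc (C0 ^ 2)]
    exact mul_le_mul h5 hgam hg.le (sq_nonneg _)

theorem H_est {u : XX d → ℝ} (hu : Sm univ u) {M : ℝ} (hM : ∀ q, M < ‖q‖ → u q = 0)
    (x0 : Fin d → ℝ) (t0 : ℝ)
    {w : XX d → ℝ} (hw : w = fun q => u (Th x0 t0 q)) (k : ℕ)
    (hfl : ∃ C : ℝ, 0 ≤ C ∧ ∀ q, |u q| ≤ C * ‖q - (x0, t0)‖ ^ k) :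
    ∃ C : ℝ, ∀ s ≥ 0, ip w w s ≤ C * Real.exp (-(k * s)) := by
  obtain ⟨C, hC, hfl⟩ := hfl
  obtain ⟨B, hB, hpoly⟩ := poly_le_exp k
  have hwc : Cs w := hw ▸ resc_Cs hu hM x0 t0
  refine ⟨C ^ 2 * B * ∫ y : Fin d → ℝ, g8 y, fun s hs => ?_⟩
  have : C ^ 2 * B * (∫ y : Fin d → ℝ, g8 y) * Real.exp (-(k * s))
      = ∫ y : Fin d → ℝ, C ^ 2 * B * Real.exp (-(k * s)) * g8 y := by
    rw [integral_const_mul]; ring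
  rw [this]
  simp only [ip, gInt]
  refine integral_mono ((hwc.mul hwc.sm).integrable s) (g8_integrable.const_mul _) fun y => ?_
  simp only
  have hwz : w (y, s) = u (Th x0 t0 (y, s)) := by rw [hw]
  have h1 := hfl (Th x0 t0 (y, s))
  rw [← hwz, Th_norm] at h1
  have hEh := Real.exp_pos (-(s / 2))
  have h2 : max (Real.exp (-(s / 2)) * ‖y‖) (Real.exp (-s)) ≤ Real.exp (-(s / 2)) * (1 + ‖y‖) := by
    refine max_le ?_ ?_
    · nlinarith
    · have h3 : Real.exp (-s) ≤ Real.exp (-(s / 2)) := Real.exp_le_exp.2 (by linarith)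
      have := mul_nonneg hEh.le (norm_nonneg y)
      linarith
  have h3 : |w (y, s)| ≤ C * (Real.exp (-(s / 2)) * (1 + ‖y‖)) ^ k :=
    h1.trans (mul_le_mul_of_nonneg_left (pow_le_pow_left₀ (le_max_of_le_right (Real.exp_pos _).le) h2 k) hC)
  have h4 : w (y, s) * w (y, s) ≤ C ^ 2 * (Real.exp (-(k * s)) * (1 + ‖y‖) ^ (2 * k)) := by
    rw [← sq, ← sq_abs]
    refine (pow_le_pow_left₀ (abs_nonneg _) h3 2).trans (le_of_eq ?_)
    have : Real.exp (-(k * s)) = (Real.exp (-(s / 2)) ^ k) ^ 2 := by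
      rw [← pow_mul, ← Real.exp_nat_mul]; congr 1; push_cast; ring
    rw [this, mul_pow (Real.exp _)]; ring
  have h5 := hpoly ‖y‖ (norm_nonneg _)
  have h6 : Real.exp (‖y‖ ^ 2 / 8) * gam y ≤ g8 y := by
    simp only [gam, g8]
    rw [← Real.exp_add]
    refine Real.exp_le_exp.2 ?_
    have := norm_sq_le_sum y
    linarith
  have hg := gam_pos y
  calc w (y, s) * w (y, s) * gam y
      ≤ (C ^ 2 * (Real.exp (-(k * s)) * (B * Real.exp (‖y‖ ^ 2 / 8)))) * gam y := by
        refine mul_le_mul_of_nonneg_right (h4.trans ?_) hg.le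
        gcongr
    _ = C ^ 2 * B * Real.exp (-(k * s)) * (Real.exp (‖y‖ ^ 2 / 8) * gam y) := by ring
    _ ≤ _ := by gcongr

/-- The height drops below a double exponential infinitely often. -/
theorem H_small {u : XX d → ℝ} (hu : Sm univ u) {M : ℝ} (hM : ∀ q, M < ‖q‖ → u q = 0)
    (x0 : Fin d → ℝ) (t0 : ℝ) {C0 R : ℝ} (hC0 : 0 ≤ C0) (hR : 0 < R)
    (hF1 : ∀ q, ‖q - (x0, t0)‖ < R → |heat xx tt u q| ≤ C0 * (|u q| + ∑ i, |dd (xx i) u q|))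
    (hF2 : ∀ q, |heat xx tt u q| ≤ C0)
    (hfl : ∀ k : ℕ, ∃ C : ℝ, 0 ≤ C ∧ ∀ q, |u q| ≤ C * ‖q - (x0, t0)‖ ^ k)
    {w : XX d → ℝ} (hw : w = fun q => u (Th x0 t0 q)) (S : ℝ) :
    ∃ s ≥ S, ip w w s < Real.exp (-(R ^ 2 / 16 * Real.exp s)) := by
  by_contra hcon
  push Not at hcon
  have hwc : Cs w := hw ▸ resc_Cs hu hM x0 t0
  obtain ⟨G, hG⟩ : ∃ G : XX d → ℝ, G = fun q => Real.exp (-q.2) * heat xx tt u (Th x0 t0 q) := ⟨_, rfl⟩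
  have hwG : ∀ q, dd tt w q = OU w q + G q := by
    intro q; rw [hw, hG]; exact resc_eq hu x0 t0 q
  have hGc : Cs G := by
    have : G = fun q => dd tt w q - OU w q := by funext q; rw [hwG]; ring
    rw [this]; exact (hwc.dd tt).sub hwc.OU
  obtain ⟨H', D', hfreq⟩ := freq_calc hwc hGc hwG
  obtain ⟨S1, hS1⟩ : ∃ S1, Real.exp (-S1) < R := ⟨-Real.log R + 1, by
    rw [neg_add, neg_neg, Real.exp_add, Real.exp_log hR]
    have : Real.exp (-1) < 1 := Real.exp_lt_one_iff.2 (by norm_num)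
    nlinarith⟩
  set c := R ^ 2 / 16 with hc
  have hcpos : 0 < c := by positivity
  set N8 := ∫ y : Fin d → ℝ, g8 y with hN8
  have hN8' : 0 ≤ N8 := integral_nonneg g8_nonneg
  set S2 := max (max S S1) 0 with hS2
  have hlow : ∀ s ≥ S2, Real.exp (-(c * Real.exp s)) ≤ ip w w s := fun s hs =>
    hcon s ((le_max_left _ _).trans ((le_max_left _ _).trans hs))
  have hs0 : ∀ s ≥ S2, 0 ≤ s := fun s hs => (le_max_right _ _).trans hs
  have hd0 : (0 : ℝ) ≤ d := Nat.cast_nonneg d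
  have hDnn : ∀ s, 0 ≤ ∑ i, ip (dd (xx i) w) (dd (xx i) w) s := fun s =>
    Finset.sum_nonneg fun i _ => ip_self_nonneg _ _
  refine frequency_ode (H := fun s => ip w w s) (D := fun s => ∑ i, ip (dd (xx i) w) (dd (xx i) w) s)
    (H' := H') (D' := D') (Q := fun s => ip G G s) (S := S2)
    (A := C0 ^ 2 * (2 + 2 * d) + C0 ^ 2 * N8 / c) (le_max_right _ _) (by positivity)
    (fun s hs => (Real.exp_pos _).trans_le (hlow s hs)) (fun s _ => hDnn s)
    (fun s _ => (hfreq s).1) (fun s _ => (hfreq s).2.1) (fun s _ => (hfreq s).2.2.1)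
    (fun s _ => (hfreq s).2.2.2) ?_ ?_
  · intro s hs
    have hsR : Real.exp (-s) < R :=
      lt_of_le_of_lt (Real.exp_le_exp.2 (neg_le_neg (show S1 ≤ s from
        (le_max_right _ _).trans ((le_max_left _ _).trans hs)))) hS1
    have hq := Q_est hu hM x0 t0 hC0 hR hF1 hF2 hw hG hGc (hs0 s hs) hsR
    have h1 : Real.exp (-(R ^ 2 / 8 * Real.exp s))
        = Real.exp (-(c * Real.exp s)) * Real.exp (-(c * Real.exp s)) := by
      rw [← Real.exp_add, hc]; congr 1; ring
    have h2 : Real.exp (-(c * Real.exp s)) ≤ Real.exp (-s) / c := by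
      rw [Real.exp_neg, Real.exp_neg, div_eq_mul_inv, ← mul_inv]
      refine inv_anti₀ (by positivity) ?_
      have := Real.add_one_le_exp (c * Real.exp s)
      linarith
    have h3 := hlow s hs
    have h4 : Real.exp (-(R ^ 2 / 8 * Real.exp s)) ≤ Real.exp (-s) / c *
        (ip w w s + ∑ i, ip (dd (xx i) w) (dd (xx i) w) s) := by
      rw [h1]
      exact mul_le_mul h2 (by linarith [hDnn s]) (Real.exp_pos _).le (by positivity)
    have h5 : C0 ^ 2 * Real.exp (-(R ^ 2 / 8 * Real.exp s)) * N8 ≤ C0 ^ 2 * (Real.exp (-s) / c *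
        (ip w w s + ∑ i, ip (dd (xx i) w) (dd (xx i) w) s)) * N8 := by gcongr
    refine hq.trans ?_
    have h6 : (C0 ^ 2 * (2 + 2 * ↑d) + C0 ^ 2 * N8 / c) * Real.exp (-s) *
        (ip w w s + ∑ i, ip (dd (xx i) w) (dd (xx i) w) s)
        = C0 ^ 2 * (2 + 2 * d) * Real.exp (-s) * (ip w w s + ∑ i, ip (dd (xx i) w) (dd (xx i) w) s)
         + C0 ^ 2 * (Real.exp (-s) / c *
        (ip w w s + ∑ i, ip (dd (xx i) w) (dd (xx i) w) s)) * N8 := by ring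
    rw [h6]
    linarith
  · intro k
    obtain ⟨C, hC⟩ := H_est hu hM x0 t0 hw k (hfl k)
    exact ⟨C, fun s hs => hC s (hs0 s hs)⟩

theorem H_lower {u : XX d → ℝ} (hu : Sm univ u) {M : ℝ} (hM : ∀ q, M < ‖q‖ → u q = 0)
    (x0 : Fin d → ℝ) (t0 : ℝ) {w : XX d → ℝ} (hw : w = fun q => u (Th x0 t0 q))
    {ρ : ℝ} {x1 : Fin d → ℝ} (hx1 : ‖x1 - x0‖ < ρ) (hne : u (x1, t0) ≠ 0) :
    ∃ κ > 0, ∃ S : ℝ, ∀ s ≥ S, κ * Real.exp (-(d * ρ ^ 2 / 4 * Real.exp s)) ≤ ip w w s := by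
  have hwc : Cs w := hw ▸ resc_Cs hu hM x0 t0
  have hcont : ContinuousAt u (x1, t0) := hu.contAt isOpen_univ (mem_univ _)
  set ε := |u (x1, t0)| / 2 with hε
  have hεp : 0 < ε := by have := abs_pos.2 hne; positivity
  obtain ⟨δ1, hδ1, h1⟩ := Metric.continuousAt_iff.1 hcont ε hεp
  set δ := min δ1 (ρ - ‖x1 - x0‖) with hδ
  have hδp : 0 < δ := lt_min hδ1 (by linarith)
  have hbig : ∀ q : XX d, dist q (x1, t0) < δ → ε ≤ |u q| := by
    intro q hq
    have h2 := h1 (hq.trans_le (min_le_left _ _))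
    rw [Real.dist_eq] at h2
    have h3 : |u (x1, t0)| ≤ |u q| + |u q - u (x1, t0)| := by
      have := abs_sub_abs_le_abs_sub (u (x1, t0)) (u q)
      rw [abs_sub_comm] at this; linarith
    have h4 : |u (x1, t0)| = 2 * ε := by rw [hε]; ring
    linarith
  set V := (volume (Metric.ball (0 : Fin d → ℝ) δ)).toReal with hV
  have hVp : 0 < V := ENNReal.toReal_pos (Metric.measure_ball_pos volume _ hδp).ne' measure_ball_lt_top.ne
  refine ⟨ε ^ 2 * V, by positivity, max 0 (-Real.log δ + 1), fun s hs => ?_⟩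
  have hs0 : 0 ≤ s := (le_max_left _ _).trans hs
  have hsδ : Real.exp (-s) < δ := by
    have h2 : Real.exp (-s) ≤ Real.exp (Real.log δ + -1) :=
      Real.exp_le_exp.2 (by have := (le_max_right _ _).trans hs; linarith)
    rw [Real.exp_add, Real.exp_log hδp] at h2
    have : Real.exp (-1) < 1 := Real.exp_lt_one_iff.2 (by norm_num)
    nlinarith
  have hEh := Real.exp_pos (-(s / 2))
  have hEh1 : Real.exp (-(s / 2)) ≤ 1 := Real.exp_le_one_iff.2 (by linarith)
  set y1 := Real.exp (s / 2) • (x1 - x0) with hy1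
  have hy1' : Real.exp (-(s / 2)) • y1 = x1 - x0 := by
    rw [hy1, smul_smul, ← Real.exp_add]; simp
  have hB : ∀ y ∈ Metric.ball y1 δ, ε ^ 2 * Real.exp (-(d * ρ ^ 2 / 4 * Real.exp s))
      ≤ w (y, s) * w (y, s) * gam y := by
    intro y hy
    have hyn : ‖y - y1‖ < δ := by simpa [dist_eq_norm] using hy
    have hz : ‖x0 + Real.exp (-(s / 2)) • y - x1‖ < δ := by
      have : x0 + Real.exp (-(s / 2)) • y - x1 = Real.exp (-(s / 2)) • (y - y1) := by
        rw [smul_sub, hy1']; abel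
      rw [this, norm_smul, Real.norm_eq_abs, abs_of_pos hEh]
      have := norm_nonneg (y - y1)
      nlinarith
    have h2 : ε ≤ |w (y, s)| := by
      rw [hw]
      refine hbig _ ?_
      rw [Prod.dist_eq]
      refine max_lt ?_ ?_
      · rw [dist_eq_norm]; exact hz
      · rw [Real.dist_eq]
        simp only [Th]
        rw [show t0 - Real.exp (-s) - t0 = -Real.exp (-s) by ring, abs_neg, abs_of_pos (Real.exp_pos _)]
        exact hsδ
    have h3 : Real.exp (-(s / 2)) * ‖y‖ < ρ := by
      have h4 : Real.exp (-(s / 2)) • y = (x0 + Real.exp (-(s / 2)) • y - x1) + (x1 - x0) := by abel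
      have h5 : ‖Real.exp (-(s / 2)) • y‖ < ρ := by
        rw [h4]
        refine (norm_add_le _ _).trans_lt ?_
        have : δ ≤ ρ - ‖x1 - x0‖ := min_le_right _ _
        linarith
      rwa [norm_smul, Real.norm_eq_abs, abs_of_pos hEh] at h5
    have h6 : ‖y‖ ^ 2 ≤ ρ ^ 2 * Real.exp s := by
      have h7 := pow_le_pow_left₀ (by positivity) h3.le 2
      rw [mul_pow, ← Real.exp_nat_mul] at h7
      have h8 : Real.exp s * Real.exp ((2 : ℕ) * -(s / 2)) = 1 := by
        rw [← Real.exp_add]; convert Real.exp_zero using 2; push_cast; ring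
      have h9 := mul_le_mul_of_nonneg_left h7 (Real.exp_pos s).le
      rw [← mul_assoc, h8] at h9
      linarith
    have h7 : Real.exp (-(d * ρ ^ 2 / 4 * Real.exp s)) ≤ gam y := by
      refine Real.exp_le_exp.2 ?_
      have h8 := sum_le_norm_sq y
      have h9 : (d : ℝ) * ‖y‖ ^ 2 ≤ d * (ρ ^ 2 * Real.exp s) :=
        mul_le_mul_of_nonneg_left h6 (Nat.cast_nonneg d)
      linarith
    refine mul_le_mul ?_ h7 (Real.exp_pos _).le (mul_self_nonneg _)
    rw [← sq (w _), ← sq_abs (w _)]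
    exact pow_le_pow_left₀ hεp.le h2 2
  have hh_in : Integrable (fun y => w (y, s) * w (y, s) * gam y) := (hwc.mul hwc.sm).integrable s
  have h2 : ∫ y in Metric.ball y1 δ, ε ^ 2 * Real.exp (-(d * ρ ^ 2 / 4 * Real.exp s))
      ≤ ∫ y in Metric.ball y1 δ, w (y, s) * w (y, s) * gam y :=
    setIntegral_mono_on (integrableOn_const measure_ball_lt_top.ne) hh_in.integrableOn measurableSet_ball hB
  have h3 : ∫ y in Metric.ball y1 δ, w (y, s) * w (y, s) * gam y ≤ ip w w s :=
    setIntegral_le_integral hh_in (Eventually.of_forall fun y => mul_nonneg (mul_self_nonneg _) (gam_pos y).le)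
  rw [setIntegral_const, smul_eq_mul, measureReal_def, Measure.addHaar_ball_center, ← hV] at h2
  calc _ = V * (ε ^ 2 * Real.exp (-(d * ρ ^ 2 / 4 * Real.exp s))) := by ring
    _ ≤ _ := h2.trans h3

theorem sucp0 {u : XX d → ℝ} (hu : Sm univ u) {M : ℝ} (hM : ∀ q, M < ‖q‖ → u q = 0)
    (x0 : Fin d → ℝ) (t0 : ℝ) {C0 R : ℝ} (hC0 : 0 ≤ C0) (hR : 0 < R)
    (hF1 : ∀ q, ‖q - (x0, t0)‖ < R → |heat xx tt u q| ≤ C0 * (|u q| + ∑ i, |dd (xx i) u q|))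
    (hF2 : ∀ q, |heat xx tt u q| ≤ C0)
    (hfl : ∀ k : ℕ, ∃ C : ℝ, 0 ≤ C ∧ ∀ q, |u q| ≤ C * ‖q - (x0, t0)‖ ^ k) :
    ∃ ρ > 0, ∀ x, ‖x - x0‖ < ρ → u (x, t0) = 0 := by
  set c := R ^ 2 / 16 with hc
  have hcpos : 0 < c := by positivity
  refine ⟨Real.sqrt (c / (d + 1)), Real.sqrt_pos.2 (by positivity), fun x1 hx1 => ?_⟩
  by_contra hne
  obtain ⟨κ, hκ, S, hS⟩ := H_lower hu hM x0 t0 rfl hx1 hne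
  have hρ : (d : ℝ) * Real.sqrt (c / (d + 1)) ^ 2 / 4 ≤ c / 4 := by
    rw [Real.sq_sqrt (by positivity)]
    have : (d : ℝ) * (c / (d + 1)) ≤ c := by
      rw [mul_div_assoc', div_le_iff₀ (by positivity)]
      nlinarith
    linarith
  have hlim : Tendsto (fun s : ℝ => Real.exp (-(c * (3 / 4) * Real.exp s))) atTop (𝓝 0) := by
    refine Real.tendsto_exp_neg_atTop_nhds_zero.comp ?_
    exact Real.tendsto_exp_atTop.const_mul_atTop (by positivity)
  obtain ⟨S', hS'⟩ := eventually_atTop.1 (hlim.eventually (gt_mem_nhds hκ))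
  obtain ⟨s, hs, hlt⟩ := H_small hu hM x0 t0 hC0 hR hF1 hF2 hfl rfl (max S S')
  have h1 := hS s ((le_max_left _ _).trans hs)
  have h2 := hS' s ((le_max_right _ _).trans hs)
  have h3 : Real.exp (-(c / 4 * Real.exp s)) ≤
      Real.exp (-(d * Real.sqrt (c / (d + 1)) ^ 2 / 4 * Real.exp s)) :=
    Real.exp_le_exp.2 (neg_le_neg (mul_le_mul_of_nonneg_right hρ (Real.exp_pos _).le))
  have h4 : Real.exp (-(c * Real.exp s)) = Real.exp (-(c * (3 / 4) * Real.exp s)) * Real.exp (-(c / 4 * Real.exp s)) := by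
    rw [← Real.exp_add]; congr 1; ring
  rw [h4] at hlt
  have h5 := mul_le_mul_of_nonneg_left h3 hκ.le
  have h6 := mul_lt_mul_of_pos_right h2 (Real.exp_pos (-(c / 4 * Real.exp s)))
  linarith
end sucp

end SN

open Set MeasureTheory
set_option linter.unusedSectionVars false
set_option linter.unusedVariables false
namespace SN
open Filter Topology

section ucp
variable {d : ℕ}

/-- The standard basis of space-time. -/
noncomputable def XXb (d : ℕ) : Module.Basis (Fin d ⊕ Unit) ℝ (XX d) :=
  (Pi.basisFun ℝ (Fin d)).prod (Module.Basis.singleton Unit ℝ)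

theorem XXb_eq (d : ℕ) : ⇑(XXb d) = bs (xx (d := d)) tt := by
  funext j
  rcases j with i | _
  · simp [XXb, bs, xx]
  · simp [XXb, bs, tt]

theorem bdd_of_supp {f : XX d → ℝ} (hf : Sm univ f) {M : ℝ} (hM : ∀ q, M < ‖q‖ → f q = 0) :
    ∃ B : ℝ, 0 ≤ B ∧ ∀ q, |f q| ≤ B := by
  obtain ⟨B, hB⟩ := (isCompact_closedBall (0 : XX d) M).exists_bound_of_continuousOn
    (contDiffOn_univ.1 hf).continuous.continuousOn
  refine ⟨max B 0, le_max_right _ _, fun q => ?_⟩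
  by_cases hq : ‖q‖ ≤ M
  · exact (hB q (by simpa using hq)).trans (le_max_left _ _)
  · rw [hM q (not_le.1 hq)]; simp

theorem sucp_local {U : Set (XX d)} (hU : IsOpen U) {u a : XX d → ℝ} {c : Fin d → XX d → ℝ}
    (hu : Sm U u) (ha : Sm U a) (hc : ∀ i, Sm U (c i))
    (heq : ∀ q ∈ U, heat xx tt u q = a q * u q + ∑ i, c i q * dd (xx i) u q)
    {x0 : Fin d → ℝ} {t0 : ℝ} (hp : (x0, t0) ∈ U) (hv : ∀ l, dw xx l u (x0, t0) = 0) :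
    ∃ ρ > 0, ∀ x, ‖x - x0‖ < ρ → u (x, t0) = 0 := by
  obtain ⟨p, hpe⟩ : ∃ p : XX d, p = (x0, t0) := ⟨_, rfl⟩
  rw [← hpe] at hp hv
  obtain ⟨R0, hR0, hball⟩ := Metric.isOpen_iff.1 hU p hp
  obtain ⟨R, hR⟩ : ∃ R, R = R0 / 3 := ⟨_, rfl⟩
  have hRp : 0 < R := by rw [hR]; positivity
  have hcb : Metric.closedBall p (2 * R) ⊆ U := fun q hq =>
    hball (lt_of_le_of_lt (Metric.mem_closedBall.1 hq) (by rw [hR]; linarith))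
  let φ : ContDiffBump p := ⟨R, 2 * R, hRp, by linarith⟩
  have hφU : ∀ q, q ∉ U → ∀ᶠ z in 𝓝 q, φ z = 0 := by
    intro q hq
    have : q ∉ Metric.closedBall p (2 * R) := fun h => hq (hcb h)
    filter_upwards [(Metric.isClosed_closedBall (x := p) (ε := 2 * R)).isOpen_compl.mem_nhds this] with z hz
    refine φ.zero_of_le_dist ?_
    have : 2 * R < dist z p := by simpa using hz
    exact this.le
  obtain ⟨w, hw⟩ : ∃ w : XX d → ℝ, w = fun q => φ q * u q := ⟨_, rfl⟩
  have hws : Sm univ w := by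
    rw [hw]
    refine contDiffOn_univ.2 (contDiff_iff_contDiffAt.2 fun q => ?_)
    by_cases hq : q ∈ U
    · exact φ.contDiff.contDiffAt.mul (hu.contDiffAt (hU.mem_nhds hq))
    · refine (contDiffAt_const (c := (0 : ℝ))).congr_of_eventuallyEq ?_
      filter_upwards [hφU q hq] with z hz
      simp [hz]
  have hwM : ∀ q, ‖p‖ + 2 * R < ‖q‖ → w q = 0 := by
    intro q hq
    have : 2 * R ≤ dist q p := by
      rw [dist_eq_norm]
      have := norm_sub_norm_le q p
      linarith
    rw [hw]
    simp only
    rw [φ.zero_of_le_dist this, zero_mul]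
  have hEq : EqOn w u (Metric.ball p R) := by
    intro q hq
    rw [hw]
    simp only
    rw [φ.one_of_mem_closedBall (Metric.ball_subset_closedBall hq), one_mul]
  have hwu : ∀ q ∈ U, |w q| ≤ |u q| := by
    intro q hq
    rw [hw]
    simp only [abs_mul]
    rw [abs_of_nonneg φ.nonneg]
    exact mul_le_of_le_one_left (abs_nonneg _) φ.le_one
  have hRU : Metric.ball p R ⊆ U := fun q hq => hcb (Metric.mem_closedBall.2
    ((Metric.mem_ball.1 hq).le.trans (by linarith)))
  -- bounds of the coefficients
  obtain ⟨A0, hA0⟩ := (isCompact_closedBall p (2 * R)).exists_bound_of_continuousOn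
    (ha.continuousOn.mono hcb)
  choose A1 hA1 using fun i => (isCompact_closedBall p (2 * R)).exists_bound_of_continuousOn
    ((hc i).continuousOn.mono hcb)
  have hA0' : 0 ≤ A0 := (norm_nonneg _).trans (hA0 p (Metric.mem_closedBall_self (by positivity)))
  have hA1' : ∀ i, 0 ≤ A1 i := fun i =>
    (norm_nonneg _).trans (hA1 i p (Metric.mem_closedBall_self (by positivity)))
  obtain ⟨A, hA⟩ : ∃ A, A = A0 + ∑ i, A1 i := ⟨_, rfl⟩
  have hs1 : 0 ≤ ∑ i, A1 i := Finset.sum_nonneg fun i _ => hA1' i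
  have hA0A : A0 ≤ A := by rw [hA]; linarith
  have hA1A : ∀ i, A1 i ≤ A := fun i => by
    rw [hA]
    have := Finset.single_le_sum (f := A1) (fun i _ => hA1' i) (Finset.mem_univ i)
    linarith
  -- bound of the heat operator
  have hheatM : ∀ q, ‖p‖ + 2 * R < ‖q‖ → heat xx tt w q = 0 := by
    intro q hq
    have ho : IsOpen {q : XX d | ‖p‖ + 2 * R < ‖q‖} := isOpen_lt continuous_const continuous_norm
    have he : EqOn w (fun _ => 0) {q : XX d | ‖p‖ + 2 * R < ‖q‖} := fun q hq => hwM q hq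
    rw [heat_congr ho he hq]
    have : ∀ e : XX d, dd e (fun _ : XX d => (0 : ℝ)) = fun _ => 0 := fun e => by
      funext z; exact dd_const 0 z e
    simp [heat, this]
  obtain ⟨B1, hB1, hF2⟩ := bdd_of_supp (hws.heat (ex := xx) (et := tt) isOpen_univ) hheatM
  obtain ⟨B, hB, hwB⟩ := bdd_of_supp hws hwM
  have hRb : ∀ q, ‖q - (x0, t0)‖ < R → q ∈ Metric.ball p R := fun q hq => by
    rw [Metric.mem_ball, dist_eq_norm, hpe]; exact hq
  have hF1 : ∀ q, ‖q - (x0, t0)‖ < R → |heat xx tt w q| ≤ max A B1 * (|w q| + ∑ i, |dd (xx i) w q|) := by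
    intro q hq
    have hqb := hRb q hq
    rw [heat_congr Metric.isOpen_ball hEq hqb, heq q (hRU hqb), hEq hqb]
    have hdi : ∀ i, dd (xx i) w q = dd (xx i) u q := fun i => dd_congr Metric.isOpen_ball hEq _ hqb
    simp only [hdi]
    have hqc : q ∈ Metric.closedBall p (2 * R) := Metric.mem_closedBall.2
      ((Metric.mem_ball.1 hqb).le.trans (by linarith))
    have hm := le_max_left A B1
    refine (abs_add_le _ _).trans ?_
    rw [mul_add, Finset.mul_sum, abs_mul]
    refine add_le_add (mul_le_mul_of_nonneg_right ((hA0 q hqc).trans (hA0A.trans hm)) (abs_nonneg _)) ?_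
    refine (Finset.abs_sum_le_sum_abs _ _).trans (Finset.sum_le_sum fun i _ => ?_)
    rw [abs_mul]
    exact mul_le_mul_of_nonneg_right ((hA1 i q hqc).trans ((hA1A i).trans hm)) (abs_nonneg _)
  have hflw : ∀ k : ℕ, ∃ C : ℝ, 0 ≤ C ∧ ∀ q, |w q| ≤ C * ‖q - (x0, t0)‖ ^ k := by
    intro k
    obtain ⟨C, hC, δ, hδ, hfl⟩ := flat_of_words (XXb d) (XXb_eq d) hU hu ha hc heq hp hv k
    set η := min δ R with hη
    have hηp : 0 < η := lt_min hδ hRp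
    refine ⟨max C (B / η ^ k), le_max_of_le_left hC, fun q => ?_⟩
    rw [← hpe]
    by_cases hq : ‖q - p‖ < η
    · have h1 := hfl q (by rw [Metric.mem_ball, dist_eq_norm]; exact hq.trans_le (min_le_left _ _))
      have h2 := hwu q (hRU (by rw [Metric.mem_ball, dist_eq_norm]; exact hq.trans_le (min_le_right _ _)))
      exact (h2.trans h1).trans (mul_le_mul_of_nonneg_right (le_max_left _ _) (by positivity))
    · push Not at hq
      have h1 : η ^ k ≤ ‖q - p‖ ^ k := pow_le_pow_left₀ hηp.le hq k
      calc |w q| ≤ B := hwB q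
        _ = B / η ^ k * η ^ k := by field_simp
        _ ≤ B / η ^ k * ‖q - p‖ ^ k := mul_le_mul_of_nonneg_left h1 (by positivity)
        _ ≤ _ := mul_le_mul_of_nonneg_right (le_max_right _ _) (by positivity)
  obtain ⟨ρ, hρ, h⟩ := sucp0 hws hwM x0 t0 (le_max_of_le_right hB1) hRp hF1
    (fun q => (hF2 q).trans (le_max_right _ _)) hflw
  refine ⟨min ρ R, lt_min hρ hRp, fun x hx => ?_⟩
  rw [← hEq, h x (hx.trans_le (min_le_left _ _))]
  refine hRb _ ?_
  simpa [Prod.norm_def] using hx.trans_le (min_le_right _ _)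

/-- If all spatial derivatives vanish at one point then the whole time slice vanishes. -/
theorem slice_zero {Ω : Set (Fin d → ℝ)} {I : Set ℝ} (hΩ : IsOpen Ω) (hΩc : IsConnected Ω) (hI : IsOpen I)
    {u a : XX d → ℝ} {c : Fin d → XX d → ℝ}
    (hu : Sm (Ω ×ˢ I) u) (ha : Sm (Ω ×ˢ I) a) (hc : ∀ i, Sm (Ω ×ˢ I) (c i))
    (heq : ∀ q ∈ Ω ×ˢ I, heat xx tt u q = a q * u q + ∑ i, c i q * dd (xx i) u q)
    {x0 : Fin d → ℝ} {t0 : ℝ} (hx0 : x0 ∈ Ω) (ht0 : t0 ∈ I) (hv : ∀ l, dw xx l u (x0, t0) = 0) :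
    ∀ x ∈ Ω, u (x, t0) = 0 := by
  have hU : IsOpen (Ω ×ˢ I) := hΩ.prod hI
  set A : Set (Fin d → ℝ) := {x | x ∈ Ω ∧ ∀ l, dw xx l u (x, t0) = 0} with hA
  have hAo : IsOpen A := by
    rw [Metric.isOpen_iff]
    rintro x ⟨hx, hxl⟩
    obtain ⟨ρ, hρ, h⟩ := sucp_local hU hu ha hc heq (show (x, t0) ∈ Ω ×ˢ I from ⟨hx, ht0⟩) hxl
    obtain ⟨ρ', hρ', h'⟩ := Metric.isOpen_iff.1 hΩ x hx
    refine ⟨min ρ ρ', lt_min hρ hρ', ?_⟩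
    have hsub : Metric.ball x (min ρ ρ') ⊆ Ω := (Metric.ball_subset_ball (min_le_right _ _)).trans h'
    have key : ∀ l, ∀ z ∈ Metric.ball x (min ρ ρ'), dw xx l u (z, t0) = 0 := by
      intro l
      induction l with
      | nil =>
        intro z hz
        refine h z ?_
        have := Metric.mem_ball.1 hz
        rw [dist_eq_norm] at this
        exact this.trans_le (min_le_left _ _)
      | cons i l ih =>
        intro z hz
        have hd := (hu.dw (b := xx) hU l).diffAt hU (show (z, t0) ∈ Ω ×ˢ I from ⟨hsub hz, ht0⟩)
        have h1 := fderiv_slice hd (Pi.single i 1)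
        have h2 : (fun y => dw xx l u (y, t0)) =ᶠ[𝓝 z] fun _ => 0 := by
          filter_upwards [Metric.isOpen_ball.mem_nhds hz] with y hy
          exact ih y hy
        rw [h2.fderiv_eq] at h1
        simp only [dw_cons, xx]
        simpa using h1.symm
    exact fun z hz => ⟨hsub hz, fun l => key l z hz⟩
  have hcl : closure A ∩ Ω ⊆ A := by
    rintro x ⟨hxc, hx⟩
    refine ⟨hx, fun l => ?_⟩
    have hne : (𝓝[A] x).NeBot := mem_closure_iff_nhdsWithin_neBot.1 hxc
    have hct : ContinuousAt (fun y => dw xx l u (y, t0)) x :=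
      ContinuousAt.comp (f := fun y => (y, t0)) (x := x)
        ((hu.dw (b := xx) hU l).contAt hU (show (x, t0) ∈ Ω ×ˢ I from ⟨hx, ht0⟩)) (by fun_prop)
    have h1 : Tendsto (fun y => dw xx l u (y, t0)) (𝓝[A] x) (𝓝 (dw xx l u (x, t0))) :=
      hct.tendsto.mono_left nhdsWithin_le_nhds
    have h2 : Tendsto (fun y => dw xx l u (y, t0)) (𝓝[A] x) (𝓝 0) := by
      refine tendsto_const_nhds.congr' ?_
      filter_upwards [self_mem_nhdsWithin] with y hy
      exact (hy.2 l).symm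
    exact tendsto_nhds_unique h1 h2
  have hsub := hΩc.isPreconnected.subset_of_closure_inter_subset hAo ⟨x0, hx0, hx0, hv⟩ hcl
  exact fun x hx => (hsub hx).2 []
end ucp

end SN

open Set MeasureTheory
set_option linter.unusedSectionVars false
set_option linter.unusedVariables false
namespace SN
open Filter Topology

section ift
variable {Z : Type} [NormedAddCommGroup Z] [NormedSpace ℝ Z] [FiniteDimensional ℝ Z]

theorem exists_global {r : ℕ} {h : Z → Z} {p : Z} (hh : ContDiffAt ℝ r h p) :
    ∃ H : Z → Z, ContDiff ℝ r H ∧ H =ᶠ[𝓝 p] h := by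
  have hev : ∀ᶠ y in 𝓝 p, ContDiffAt ℝ r h y := hh.eventually (by simp)
  obtain ⟨R, hR, hball⟩ := Metric.eventually_nhds_iff_ball.1 hev
  let φ : ContDiffBump p := ⟨R / 3, R / 2, by positivity, by linarith⟩
  refine ⟨fun q => φ q • h q, contDiff_iff_contDiffAt.2 fun q => ?_, ?_⟩
  · by_cases hq : q ∈ Metric.ball p R
    · exact φ.contDiff.contDiffAt.smul (hball q hq)
    · refine (contDiffAt_const (c := (0 : Z))).congr_of_eventuallyEq ?_
      have : q ∉ Metric.closedBall p (R / 2) := fun h' => hq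
        (lt_of_le_of_lt (Metric.mem_closedBall.1 h') (by linarith))
      filter_upwards [(Metric.isClosed_closedBall (x := p) (ε := R / 2)).isOpen_compl.mem_nhds this] with z hz
      have h2 : R / 2 < dist z p := by simpa using hz
      simp [φ.zero_of_le_dist h2.le]
  · filter_upwards [Metric.ball_mem_nhds p (show (0 : ℝ) < R / 3 by positivity)] with z hz
    rw [φ.one_of_mem_closedBall (Metric.ball_subset_closedBall hz), one_smul]

theorem ift_graph {r : ℕ} (hr : 1 ≤ r) {f g : Z → ℝ} {q0 : Z} (hf : ContDiffAt ℝ r f q0)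
    (hg : ContDiffAt ℝ r g q0) (hf0 : f q0 = 0) (hg0 : g q0 = 0) {e1 e2 : Z} {l1 l2 : Z →L[ℝ] ℝ}
    (h11 : l1 e1 = 1) (h12 : l1 e2 = 0) (h21 : l2 e1 = 0) (h22 : l2 e2 = 1)
    (hdet : dd e1 f q0 * dd e2 g q0 - dd e2 f q0 * dd e1 g q0 ≠ 0) :
    ∃ Φ : Z → ℝ × ℝ, ContDiff ℝ r Φ ∧ (∀ q (s s' : ℝ), Φ (q + s • e1 + s' • e2) = Φ q) ∧
      ∀ᶠ q in 𝓝 q0, f q = 0 → g q = 0 → l1 q = (Φ q).1 ∧ l2 q = (Φ q).2 := by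
  have hr0 : (r : WithTop ℕ∞) ≠ 0 := by
    have : r ≠ 0 := by omega
    exact_mod_cast this
  obtain ⟨Ψ, hΨ⟩ : ∃ Ψ : Z → Z, Ψ = fun q => q + (f q - l1 q) • e1 + (g q - l2 q) • e2 := ⟨_, rfl⟩
  have hΨs : ContDiffAt ℝ r Ψ q0 := by
    rw [hΨ]
    exact (contDiffAt_id.add ((hf.sub l1.contDiff.contDiffAt).smul contDiffAt_const)).add
      ((hg.sub l2.contDiff.contDiffAt).smul contDiffAt_const)
  have hfd := (hf.differentiableAt hr0).hasFDerivAt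
  have hgd := (hg.differentiableAt hr0).hasFDerivAt
  obtain ⟨L, hL⟩ : ∃ L : Z →L[ℝ] Z, L = ContinuousLinearMap.id ℝ Z + (fderiv ℝ f q0 - l1).smulRight e1
    + (fderiv ℝ g q0 - l2).smulRight e2 := ⟨_, rfl⟩
  have hΨd : HasFDerivAt Ψ L q0 := by
    rw [hΨ, hL]
    exact ((hasFDerivAt_id q0).add ((hfd.sub l1.hasFDerivAt).smul_const e1)).add
      ((hgd.sub l2.hasFDerivAt).smul_const e2)
  have hLw : ∀ w, L w = w + (fderiv ℝ f q0 w - l1 w) • e1 + (fderiv ℝ g q0 w - l2 w) • e2 := by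
    intro w; rw [hL]; simp
  have hinj : Function.Injective L := by
    rw [injective_iff_map_eq_zero]
    intro w hw
    rw [hLw] at hw
    have a1 := congrArg l1 hw
    have a2 := congrArg l2 hw
    simp [h11, h12, h21, h22] at a1 a2
    have hw2 : w = l1 w • e1 + l2 w • e2 := by
      rw [a1, a2] at hw
      simp only [zero_sub, neg_smul] at hw
      have : w - (l1 w • e1 + l2 w • e2) = 0 := by rw [← hw]; abel
      exact sub_eq_zero.1 this
    rw [hw2] at a1 a2
    simp only [map_add, map_smul, smul_eq_mul] at a1 a2
    simp only [dd] at hdet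
    have b1 : l1 w = 0 := by
      have : l1 w * (fderiv ℝ f q0 e1 * fderiv ℝ g q0 e2 - fderiv ℝ f q0 e2 * fderiv ℝ g q0 e1) = 0 := by
        linear_combination (fderiv ℝ g q0 e2) * a1 - (fderiv ℝ f q0 e2) * a2
      exact (mul_eq_zero.1 this).resolve_right hdet
    have b2 : l2 w = 0 := by
      have : l2 w * (fderiv ℝ f q0 e1 * fderiv ℝ g q0 e2 - fderiv ℝ f q0 e2 * fderiv ℝ g q0 e1) = 0 := by
        linear_combination (-fderiv ℝ g q0 e1) * a1 + (fderiv ℝ f q0 e1) * a2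
      exact (mul_eq_zero.1 this).resolve_right hdet
    rw [hw2, b1, b2]; simp
  let E : Z ≃L[ℝ] Z := (LinearEquiv.ofInjectiveEndo (L : Z →ₗ[ℝ] Z) hinj).toContinuousLinearEquiv
  have hE : (E : Z →L[ℝ] Z) = L := by
    ext w; rfl
  rw [← hE] at hΨd
  haveI : CompleteSpace Z := FiniteDimensional.complete ℝ Z
  have hst : HasStrictFDerivAt Ψ (E : Z →L[ℝ] Z) q0 := hΨs.hasStrictFDerivAt' hΨd hr0
  have hinv : ContDiffAt ℝ r (hΨs.localInverse hΨd hr0) (Ψ q0) := hΨs.to_localInverse hΨd hr0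
  have hli : ∀ᶠ q in 𝓝 q0, hΨs.localInverse hΨd hr0 (Ψ q) = q := hst.eventually_left_inverse
  obtain ⟨H, hH, hHe⟩ := exists_global hinv
  let π : Z →L[ℝ] Z := ContinuousLinearMap.id ℝ Z - l1.smulRight e1 - l2.smulRight e2
  have hπ : ∀ q, π q = q - l1 q • e1 - l2 q • e2 := fun q => by simp [π]
  refine ⟨fun q => (l1 (H (π q)), l2 (H (π q))), ?_, ?_, ?_⟩
  · exact (l1.contDiff.comp (hH.comp π.contDiff)).prodMk (l2.contDiff.comp (hH.comp π.contDiff))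
  · intro q s s'
    have : π (q + s • e1 + s' • e2) = π q := by
      simp only [hπ, map_add, map_smul, h11, h12, h21, h22, smul_eq_mul, mul_one, mul_zero, add_zero, zero_add, add_smul]
      abel
    simp only [this]
  · have hc : Tendsto Ψ (𝓝 q0) (𝓝 (Ψ q0)) := hΨs.continuousAt
    filter_upwards [hli, hc.eventually hHe] with q h1 h2 hfq hgq
    have : Ψ q = π q := by
      rw [hΨ, hπ]; simp only [hfq, hgq, zero_sub, neg_smul]; abel
    rw [this] at h1 h2
    simp only [h2, h1, and_self]

end ift

/-- If a symmetric nonzero matrix has zero trace then some principal 2 by 2 minor is nonzero. -/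
theorem minor_ne {d : ℕ} {A : Fin d → Fin d → ℝ} (hs : ∀ i j, A i j = A j i)
    (hne : ∃ i j, A i j ≠ 0) (htr : ∑ i, A i i = 0) :
    ∃ i j, i ≠ j ∧ A i i * A j j - A j i * A i j ≠ 0 := by
  by_contra h
  push Not at h
  have h' : ∀ i j, A i i * A j j = A i j ^ 2 := by
    intro i j
    by_cases hij : i = j
    · subst hij; ring
    · have := h i j hij
      rw [hs j i] at this; linarith
  have : ∑ i, ∑ j, A i j ^ 2 = 0 := by
    calc ∑ i, ∑ j, A i j ^ 2 = ∑ i, ∑ j, A i i * A j j := by simp only [h']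
      _ = (∑ i, A i i) * ∑ j, A j j := by rw [Finset.sum_mul_sum]
      _ = 0 := by rw [htr, zero_mul]
  obtain ⟨i, j, hij⟩ := hne
  have h1 := (Finset.sum_eq_zero_iff_of_nonneg (fun i _ => Finset.sum_nonneg fun j _ => sq_nonneg (A i j))).1 this
    i (Finset.mem_univ i)
  have h2 := (Finset.sum_eq_zero_iff_of_nonneg (fun j _ => sq_nonneg (A i j))).1 h1 j (Finset.mem_univ j)
  exact hij (pow_eq_zero_iff (two_ne_zero) |>.1 h2)

section low
variable {X : Type} [NormedAddCommGroup X] [NormedSpace ℝ X]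
variable {ι : Type} [Fintype ι] {ex : ι → X} {et : X} {U : Set X} {u : X → ℝ}

/-- Combinations of spatial derivatives of `u` of order at most `m`. -/
inductive Low (U : Set X) (ex : ι → X) (u : X → ℝ) (m : ℕ) : (X → ℝ) → Prop
  | base (c : X → ℝ) (hc : Sm U c) (l : List ι) (hl : l.length ≤ m) : Low U ex u m (fun x => c x * dw ex l u x)
  | add {f g : X → ℝ} : Low U ex u m f → Low U ex u m g → Low U ex u m (fun x => f x + g x)
  | congr {f g : X → ℝ} : Low U ex u m f → EqOn g f U → Low U ex u m g

theorem Low.sm (hU : IsOpen U) (hu : Sm U u) {m : ℕ} {f : X → ℝ} (h : Low U ex u m f) : Sm U f := by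
  induction h with
  | base c hc l hl => exact hc.mul (hu.dw hU l)
  | add _ _ h1 h2 => exact h1.add h2
  | congr _ he h1 => exact h1.congr he

theorem Low.sum {κ : Type} {m : ℕ} (s : Finset κ) {f : κ → X → ℝ} (h : ∀ k, Low U ex u m (f k)) :
    Low U ex u m (fun x => ∑ k ∈ s, f k x) := by
  classical
  induction s using Finset.induction_on with
  | empty => exact (Low.base _ (Sm.const 0) [] (by simp)).congr fun x _ => by simp
  | insert k s hk ih =>
    exact ((h k).add ih).congr fun x _ => by simp [Finset.sum_insert hk]

theorem Low.ddx (hU : IsOpen U) (hu : Sm U u) (i : ι) {m : ℕ} {f : X → ℝ} (h : Low U ex u m f) :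
    Low U ex u (m + 1) (dd (ex i) f) := by
  induction h with
  | base c hc l hl =>
    refine ((Low.base _ (hc.dd hU (ex i)) l (by omega)).add
      (Low.base _ hc (i :: l) (by simp; omega))).congr fun x hx => ?_
    exact dd_mul (hc.diffAt hU hx) ((hu.dw hU l).diffAt hU hx) _
  | add h1 h2 i1 i2 =>
    refine (i1.add i2).congr fun x hx => ?_
    exact dd_add ((h1.sm hU hu).diffAt hU hx) ((h2.sm hU hu).diffAt hU hx) _
  | congr _ he h1 => exact h1.congr (dd_congr hU he _)

theorem Low.dwx (hU : IsOpen U) (hu : Sm U u) (l : List ι) {m : ℕ} {f : X → ℝ} (h : Low U ex u m f) :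
    Low U ex u (m + l.length) (dw ex l f) := by
  induction l with
  | nil => exact h
  | cons i l ih => exact ih.ddx hU hu i

theorem Low.vanish {p : X} (hp : p ∈ U) {m : ℕ} (hv : ∀ l : List ι, l.length ≤ m → dw ex l u p = 0)
    {f : X → ℝ} (h : Low U ex u m f) : f p = 0 := by
  induction h with
  | base c hc l hl => simp [hv l hl]
  | add _ _ h1 h2 => simp [h1, h2]
  | congr _ he h1 => rw [he hp, h1]

/-- At a zero of order above `l.length + 1` the time derivative is the trace of the Hessian. -/
theorem ddt_eq_trace (hU : IsOpen U) (hu : Sm U u) {a : X → ℝ} {c : ι → X → ℝ} (ha : Sm U a)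
    (hc : ∀ i, Sm U (c i))
    (heq : ∀ q ∈ U, heat ex et u q = a q * u q + ∑ i, c i q * dd (ex i) u q)
    {p : X} (hp : p ∈ U) (l : List ι) (hv : ∀ l' : List ι, l'.length ≤ 1 + l.length → dw ex l' u p = 0) :
    dd et (dw ex l u) p = ∑ i, dw ex (i :: i :: l) u p := by
  have h0 : Low U ex u 1 (heat ex et u) := by
    refine ((Low.base a ha [] (by simp)).add (Low.sum Finset.univ fun i =>
      Low.base (c i) (hc i) [i] (by simp))).congr heq
  have h1 := (h0.dwx hU hu l).vanish hp hv
  have h2 : ∀ l : List ι, EqOn (dw ex l (heat ex et u))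
      (fun q => dd et (dw ex l u) q - ∑ i, dw ex (i :: i :: l) u q) U := by
    intro l
    induction l with
    | nil => intro q hq; simp [heat]
    | cons j l ih =>
      intro q hq
      have hd : ∀ i, DifferentiableAt ℝ (dw ex (i :: i :: l) u) q := fun i => (hu.dw hU _).diffAt hU hq
      rw [dw_cons, dd_congr hU ih _ hq, dd_sub ((((hu.dw hU l).dd hU et)).diffAt hU hq)
        (DifferentiableAt.fun_sum fun i _ => hd i), dd_sum _ (fun i _ => hd i)]
      congr 1
      · exact dd_comm hU (hu.dw hU l) _ _ hq
      · refine Finset.sum_congr rfl fun i _ => ?_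
        simp only [dw_cons]
        rw [dd_comm hU ((hu.dw hU l).dd hU (ex i)) _ _ hq]
        exact dd_congr hU (dd_comm hU (hu.dw hU l) _ _) _ hq
  rw [h2 l hp] at h1
  linarith
end low

end SN

open Set MeasureTheory
set_option linter.unusedSectionVars false
set_option linter.unusedVariables false
namespace SN
open Filter Topology

section graph
variable {d : ℕ}

abbrev YY (d : ℕ) := (Fin d → ℝ) × ℝ × ℝ

/-- The two kinds of graphs. -/
def GraphSet (r : ℕ) (D : Set (YY d)) (S : Set (YY d)) : Prop :=
  (∃ i j : Fin d, i ≠ j ∧ ∃ Φ : ((Fin d → ℝ) × ℝ × ℝ) → ℝ × ℝ,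
            ContDiff ℝ r Φ ∧
            (∀ (x : Fin d → ℝ) (t τ s s' : ℝ),
              Φ (Function.update (Function.update x i s) j s', t, τ) = Φ (x, t, τ)) ∧
            S = {q : (Fin d → ℝ) × ℝ × ℝ | q ∈ D ∧
              q.1 i = (Φ q).1 ∧ q.1 j = (Φ q).2})
        ∨
        (∃ i : Fin d, ∃ Φ : ((Fin d → ℝ) × ℝ) → ℝ × ℝ,
            ContDiff ℝ r Φ ∧
            (∀ (x : Fin d → ℝ) (τ s : ℝ), Φ (Function.update x i s, τ) = Φ (x, τ)) ∧
            S = {q : (Fin d → ℝ) × ℝ × ℝ | q ∈ D ∧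
              q.1 i = (Φ (q.1, q.2.2)).1 ∧ q.2.1 = (Φ (q.1, q.2.2)).2})

theorem update_eq (x : Fin d → ℝ) (i : Fin d) (s : ℝ) :
    Function.update x i s = x + (s - x i) • Pi.single i (1 : ℝ) := by
  funext k
  by_cases h : k = i
  · subst h; simp
  · simp [h, Pi.single_apply]

/-- The spatial directions. -/
noncomputable def yx (i : Fin d) : YY d := (Pi.single i 1, 0, 0)

/-- The time direction. -/
def yt : YY d := (0, 1, 0)

theorem local_graph {r : ℕ} (hr : 1 ≤ r) {D : Set (YY d)} (hD : IsOpen D) {W : List (Fin d) → YY d → ℝ}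
    (h1 : ∀ l, ContDiffOn ℝ r (W l) D) (h2 : ∀ l i, ∀ q ∈ D, dd (yx i) (W l) q = W (i :: l) q)
    (h3 : ∀ l, ∀ q ∈ D, (∀ l' : List (Fin d), l'.length ≤ 1 + l.length → W l' q = 0) →
      dd yt (W l) q = ∑ i, W (i :: i :: l) q)
    (h4 : ∀ l i j, ∀ q ∈ D, W (i :: j :: l) q = W (j :: i :: l) q)
    {q : YY d} (hq : q ∈ D) {k : ℕ} (hk : 2 ≤ k) (hv : ∀ l : List (Fin d), l.length < k → W l q = 0)
    (hne : ∃ l : List (Fin d), l.length = k ∧ W l q ≠ 0) :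
    ∃ S, GraphSet r D S ∧ ∀ᶠ z in 𝓝 q, z ∈ D → (∀ l : List (Fin d), l.length < k → W l z = 0) → z ∈ S := by
  obtain ⟨l0, hl0, hW⟩ := hne
  match l0, hl0, hW with
  | [], hl, _ => simp at hl; omega
  | [_], hl, _ => simp at hl; omega
  | i0 :: j0 :: β, hl, hW =>
  have hβ : β.length + 2 = k := by simpa using hl
  have hcd : ∀ l, ContDiffAt ℝ r (W l) q := fun l => (h1 l).contDiffAt (hD.mem_nhds hq)
  have ht := h3 β q hq fun l' hl' => hv l' (by omega)
  by_cases htr : ∑ i, W (i :: i :: β) q = 0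
  · obtain ⟨i, j, hij, hm⟩ := minor_ne (A := fun i j => W (i :: j :: β) q) (fun i j => h4 β i j q hq)
      ⟨i0, j0, hW⟩ htr
    let l1 : YY d →L[ℝ] ℝ := (ContinuousLinearMap.proj i).comp (ContinuousLinearMap.fst ℝ (Fin d → ℝ) (ℝ × ℝ))
    let l2 : YY d →L[ℝ] ℝ := (ContinuousLinearMap.proj j).comp (ContinuousLinearMap.fst ℝ (Fin d → ℝ) (ℝ × ℝ))
    obtain ⟨Φ, hΦ, hinv, hev⟩ := ift_graph hr (hcd (i :: β)) (hcd (j :: β)) (hv _ (by simp; omega))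
      (hv _ (by simp; omega)) (e1 := yx i) (e2 := yx j) (l1 := l1) (l2 := l2) (by simp [l1, yx])
      (by simp [l1, yx, Pi.single_apply, hij]) (by simp [l2, yx, Pi.single_apply, hij.symm]) (by simp [l2, yx])
      (by
        rw [h2 _ _ q hq, h2 _ _ q hq, h2 _ _ q hq, h2 _ _ q hq]
        exact hm)
    refine ⟨_, Or.inl ⟨i, j, hij, Φ, hΦ, ?_, rfl⟩, ?_⟩
    · intro x t τ s s'
      rw [← hinv (x, t, τ) (s - x i) (s' - x j)]
      congr 1
      rw [update_eq, update_eq]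
      simp [yx, hij.symm, Pi.single_apply]
    · filter_upwards [hev] with z hz hzD hzv
      obtain ⟨a1, a2⟩ := hz (hzv _ (by simp; omega)) (hzv _ (by simp; omega))
      exact ⟨hzD, a1, a2⟩
  · let l1 : YY d →L[ℝ] ℝ := (ContinuousLinearMap.proj i0).comp (ContinuousLinearMap.fst ℝ (Fin d → ℝ) (ℝ × ℝ))
    let l2 : YY d →L[ℝ] ℝ := (ContinuousLinearMap.fst ℝ ℝ ℝ).comp (ContinuousLinearMap.snd ℝ (Fin d → ℝ) (ℝ × ℝ))
    obtain ⟨Φ, hΦ, hinv, hev⟩ := ift_graph hr (hcd β) (hcd (j0 :: β)) (hv _ (by omega))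
      (hv _ (by simp; omega)) (e1 := yx i0) (e2 := yt) (l1 := l1) (l2 := l2) (by simp [l1, yx])
      (by simp [l1, yt]) (by simp [l2, yx]) (by simp [l2, yt])
      (by
        rw [h2 _ _ q hq, ht, h2 _ _ q hq, hv (i0 :: β) (by simp; omega), zero_mul, zero_sub]
        exact neg_ne_zero.2 (mul_ne_zero htr hW))
    refine ⟨_, Or.inr ⟨i0, fun p => Φ (p.1, 0, p.2), ?_, ?_, rfl⟩, ?_⟩
    · exact hΦ.comp (contDiff_fst.prodMk (contDiff_const.prodMk contDiff_snd))
    · intro x τ s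
      simp only
      rw [← hinv (x, 0, τ) (s - x i0) 0]
      congr 1
      rw [update_eq]
      simp [yx]
    · filter_upwards [hev] with z hz hzD hzv
      obtain ⟨a1, a2⟩ := hz (hzv _ (by omega)) (hzv _ (by simp; omega))
      have : Φ (z.1, 0, z.2.2) = Φ z := by
        rw [← hinv (z.1, 0, z.2.2) 0 z.2.1]
        congr 1
        simp [yt]
      refine ⟨hzD, ?_, ?_⟩
      · rw [this]; exact a1
      · rw [this]; exact a2

theorem global_graph (hd : 2 ≤ d) {r : ℕ} (hr : 1 ≤ r) {D : Set (YY d)} (hD : IsOpen D) {W : List (Fin d) → YY d → ℝ}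
    (h1 : ∀ l, ContDiffOn ℝ r (W l) D) (h2 : ∀ l i, ∀ q ∈ D, dd (yx i) (W l) q = W (i :: l) q)
    (h3 : ∀ l, ∀ q ∈ D, (∀ l' : List (Fin d), l'.length ≤ 1 + l.length → W l' q = 0) →
      dd yt (W l) q = ∑ i, W (i :: i :: l) q)
    (h4 : ∀ l i j, ∀ q ∈ D, W (i :: j :: l) q = W (j :: i :: l) q)
    (h5 : ∀ q ∈ D, ∃ l, W l q ≠ 0) :
    ∃ S : ℕ → Set (YY d), {q | q ∈ D ∧ W [] q = 0 ∧ ∀ i, W [i] q = 0} ⊆ ⋃ n, S n ∧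
      ∀ n, GraphSet r D (S n) := by
  classical
  let M : ℕ → Set (YY d) := fun k => {q | q ∈ D ∧ 2 ≤ k ∧ (∀ l : List (Fin d), l.length < k → W l q = 0) ∧
    ∃ l : List (Fin d), l.length = k ∧ W l q ≠ 0}
  have key : ∀ k, ∃ T : Set (Set (YY d)), T.Countable ∧ (∀ S ∈ T, GraphSet r D S) ∧ M k ⊆ ⋃₀ T := by
    intro k
    have hloc : ∀ q, ∃ S, q ∈ M k → (GraphSet r D S ∧ ∀ᶠ z in 𝓝 q, z ∈ D →
        (∀ l : List (Fin d), l.length < k → W l z = 0) → z ∈ S) := by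
      intro q
      by_cases hq : q ∈ M k
      · obtain ⟨S, hS⟩ := local_graph hr hD h1 h2 h3 h4 hq.1 hq.2.1 hq.2.2.1 hq.2.2.2
        exact ⟨S, fun _ => hS⟩
      · exact ⟨∅, fun h => absurd h hq⟩
    choose S hS using hloc
    obtain ⟨t, htM, htc, hcov⟩ := TopologicalSpace.countable_cover_nhdsWithin (s := M k)
      (f := fun q => {z | z ∈ D → (∀ l : List (Fin d), l.length < k → W l z = 0) → z ∈ S q})
      (fun q hq => mem_nhdsWithin_of_mem_nhds (hS q hq).2)
    refine ⟨S '' t, htc.image S, ?_, ?_⟩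
    · rintro _ ⟨q, hq, rfl⟩
      exact (hS q (htM hq)).1
    · intro z hz
      obtain ⟨q, hq, hzq⟩ := mem_iUnion₂.1 (hcov hz)
      exact ⟨S q, mem_image_of_mem S hq, hzq hz.1 hz.2.2.1⟩
  choose T hTc hTg hTM using key
  let S0 : Set (YY d) := {q : (Fin d → ℝ) × ℝ × ℝ | q ∈ D ∧
              q.1 (⟨0, by omega⟩ : Fin d) = ((0 : ℝ), (0 : ℝ)).1 ∧ q.1 (⟨1, by omega⟩ : Fin d) = ((0 : ℝ), (0 : ℝ)).2}
  have hS0 : GraphSet r D S0 := Or.inl ⟨⟨0, by omega⟩, ⟨1, by omega⟩, by simp, fun _ => (0, 0),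
    contDiff_const, fun _ _ _ _ _ => rfl, rfl⟩
  obtain ⟨S, hS⟩ := ((countable_singleton S0).union (countable_iUnion hTc)).exists_eq_range
    ⟨S0, Or.inl rfl⟩
  refine ⟨S, ?_, ?_⟩
  · rintro q ⟨hqD, hq0, hq1⟩
    have hex : ∃ k, ∃ l : List (Fin d), l.length = k ∧ W l q ≠ 0 := by
      obtain ⟨l, hl⟩ := h5 q hqD
      exact ⟨_, l, rfl, hl⟩
    have hqM : q ∈ M (Nat.find hex) := by
      refine ⟨hqD, ?_, ?_, Nat.find_spec hex⟩
      · rw [Nat.le_find_iff]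
        intro m hm
        rintro ⟨l, hl, hne⟩
        match l, hl, hne with
        | [], _, hne => exact hne hq0
        | [i], _, hne => exact hne (hq1 i)
        | _ :: _ :: _, hl, _ => simp at hl; omega
      · intro l hl
        by_contra hne
        exact Nat.find_min hex hl ⟨l, rfl, hne⟩
    obtain ⟨s, hs, hqs⟩ := hTM _ hqM
    have : s ∈ range S := by
      rw [← hS]; exact Or.inr (mem_iUnion.2 ⟨_, hs⟩)
    obtain ⟨n, rfl⟩ := this
    exact mem_iUnion.2 ⟨n, hqs⟩
  · intro n
    have : S n ∈ ({S0} ∪ ⋃ k, T k : Set (Set (YY d))) := by rw [hS]; exact mem_range_self n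
    rcases this with h | h
    · rw [h]; exact hS0
    · obtain ⟨k, hk⟩ := mem_iUnion.1 h
      exact hTg k _ hk
end graph

end SN

open Set MeasureTheory
set_option linter.unusedSectionVars false
set_option linter.unusedVariables false
namespace SN
open Filter Topology

theorem dw_map_inl {d : ℕ} (l : List (Fin d)) (f : XX d → ℝ) :
    dw (bs xx tt) (l.map Sum.inl) f = dw xx l f := by
  induction l with
  | nil => rfl
  | cons i l ih => rw [List.map_cons, dw_cons, dw_cons, ih]; rfl

theorem dd_slice_Y {d : ℕ} {f : YY d → ℝ} {q : YY d} (hf : DifferentiableAt ℝ f q) (e : Fin d → ℝ) (s : ℝ) :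
    dd (e, s, 0) f q = dd (e, s) (fun p : XX d => f (p.1, p.2, q.2.2)) (q.1, q.2.1) := by
  have h1 : HasFDerivAt (fun p : XX d => ((p.1, p.2, q.2.2) : YY d))
      ((ContinuousLinearMap.fst ℝ (Fin d → ℝ) ℝ).prod ((ContinuousLinearMap.snd ℝ (Fin d → ℝ) ℝ).prod 0))
      (q.1, q.2.1) :=
    hasFDerivAt_fst.prodMk (hasFDerivAt_snd.prodMk (hasFDerivAt_const _ _))
  have h2 : HasFDerivAt f (fderiv ℝ f q) (q.1, q.2.1, q.2.2) := hf.hasFDerivAt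
  have h3 := (HasFDerivAt.comp (q.1, q.2.1) (g := f) h2 h1).fderiv
  simp only [Function.comp_def] at h3
  simp only [dd]
  rw [h3]
  simp

section translate
variable {d : ℕ} {Ω : Set (Fin d → ℝ)} {I : Set ℝ}

theorem pd_eq (hΩ : IsOpen Ω) (hI : IsOpen I) {u : XX d → ℝ} (hu : Sm (Ω ×ˢ I) u) {x : Fin d → ℝ} {t : ℝ}
    (hx : x ∈ Ω) (ht : t ∈ I) (i : Fin d) : pd i (fun y => u (y, t)) x = dd (xx i) u (x, t) :=
  fderiv_slice (hu.diffAt (hΩ.prod hI) (show (x, t) ∈ Ω ×ˢ I from ⟨hx, ht⟩)) _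

theorem lap_eq (hΩ : IsOpen Ω) (hI : IsOpen I) {u : XX d → ℝ} (hu : Sm (Ω ×ˢ I) u) {x : Fin d → ℝ} {t : ℝ}
    (hx : x ∈ Ω) (ht : t ∈ I) : lap (fun y => u (y, t)) x = ∑ i, dd (xx i) (dd (xx i) u) (x, t) := by
  refine Finset.sum_congr rfl fun i _ => ?_
  rw [← pd_eq hΩ hI (hu.dd (hΩ.prod hI) (xx i)) hx ht i]
  have : pd i (fun y => u (y, t)) =ᶠ[𝓝 x] fun y => dd (xx i) u (y, t) := by
    filter_upwards [hΩ.mem_nhds hx] with y hy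
    exact pd_eq hΩ hI hu hy ht i
  simp only [pd] at this ⊢
  rw [this.fderiv_eq]
end translate

end SN

/-- Theorem `th-Intro-nodalset` / `th-nodalset` part 1:
the singular nodal set of a family of solutions of a linear parabolic equation with
parameter is contained in a countable union of `d`-dimensional `C^r` graphs. -/
theorem singular_nodal_set_structure
    (d : ℕ) (hd : 2 ≤ d)
    (Ω : Set (Fin d → ℝ)) (hΩo : IsOpen Ω) (hΩc : IsConnected Ω)
    (hΩb : Bornology.IsBounded Ω)
    (I J : Set ℝ) (hIo : IsOpen I) (hIc : I.OrdConnected)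
    (hJo : IsOpen J) (hJc : J.OrdConnected)
    (a : (Fin d → ℝ) → ℝ → ℝ → ℝ) (b : (Fin d → ℝ) → ℝ → ℝ → Fin d → ℝ)
    (ha : ContDiffOn ℝ (⊤ : ℕ∞)
      (fun q : (Fin d → ℝ) × ℝ × ℝ => a q.1 q.2.1 q.2.2) (Ω ×ˢ (I ×ˢ J)))
    (hb : ContDiffOn ℝ (⊤ : ℕ∞)
      (fun q : (Fin d → ℝ) × ℝ × ℝ => b q.1 q.2.1 q.2.2) (Ω ×ˢ (I ×ˢ J)))
    (hab : ∃ C : ℝ, ∀ x ∈ Ω, ∀ t ∈ I, ∀ τ ∈ J, |a x t τ| ≤ C ∧ ‖b x t τ‖ ≤ C)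
    (r : ℕ) (hr : 1 ≤ r)
    (v : (Fin d → ℝ) → ℝ → ℝ → ℝ)
    -- `v` is smooth in `(x,t)` for each parameter `τ`
    (hv_xt : ∀ τ ∈ J, ContDiffOn ℝ (⊤ : ℕ∞)
      (fun q : (Fin d → ℝ) × ℝ => v q.1 q.2 τ) (Ω ×ˢ I))
    -- `v` is of class `C^r` with respect to the parameter `τ`
    (hv_r : ContDiffOn ℝ r
      (fun q : (Fin d → ℝ) × ℝ × ℝ => v q.1 q.2.1 q.2.2) (Ω ×ˢ (I ×ˢ J)))
    -- `v` extends continuously to the closure of `Ω` and satisfies Dirichlet b.c.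
    (hv_cont : ∀ τ ∈ J, ContinuousOn
      (fun q : (Fin d → ℝ) × ℝ => v q.1 q.2 τ) (closure Ω ×ˢ I))
    (hv_bc : ∀ τ ∈ J, ∀ x ∈ frontier Ω, ∀ t ∈ I, v x t τ = 0)
    -- the parabolic equation
    (hv_eq : ∀ τ ∈ J, ∀ x ∈ Ω, ∀ t ∈ I,
      deriv (fun s => v x s τ) t
        = lap (fun y => v y t τ) x + a x t τ * v x t τ
          + ∑ i, b x t τ i * pd i (fun y => v y t τ) x)
    -- the null solution is not part of the family
    (hv_nt : ¬ ∃ t ∈ I, ∃ τ ∈ J, ∀ x ∈ Ω, v x t τ = 0) :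
    ∃ S : ℕ → Set ((Fin d → ℝ) × ℝ × ℝ),
      {q : (Fin d → ℝ) × ℝ × ℝ | q ∈ Ω ×ˢ (I ×ˢ J) ∧ v q.1 q.2.1 q.2.2 = 0 ∧
          ∀ i, pd i (fun y => v y q.2.1 q.2.2) q.1 = 0} ⊆ ⋃ n, S n ∧
      ∀ n,
        -- either a graph expressing `(x_i, x_j)` as a `C^r` function of `(t, τ)` and the
        -- other `d-2` components of `x`
        (∃ i j : Fin d, i ≠ j ∧ ∃ Φ : ((Fin d → ℝ) × ℝ × ℝ) → ℝ × ℝ,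
            ContDiff ℝ r Φ ∧
            (∀ (x : Fin d → ℝ) (t τ s s' : ℝ),
              Φ (Function.update (Function.update x i s) j s', t, τ) = Φ (x, t, τ)) ∧
            S n = {q : (Fin d → ℝ) × ℝ × ℝ | q ∈ Ω ×ˢ (I ×ˢ J) ∧
              q.1 i = (Φ q).1 ∧ q.1 j = (Φ q).2})
        ∨
        -- or a graph expressing `(x_i, t)` as a `C^r` function of `τ` and the other
        -- `d-1` components of `x`
        (∃ i : Fin d, ∃ Φ : ((Fin d → ℝ) × ℝ) → ℝ × ℝ,
            ContDiff ℝ r Φ ∧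
            (∀ (x : Fin d → ℝ) (τ s : ℝ), Φ (Function.update x i s, τ) = Φ (x, τ)) ∧
            S n = {q : (Fin d → ℝ) × ℝ × ℝ | q ∈ Ω ×ˢ (I ×ˢ J) ∧
              q.1 i = (Φ (q.1, q.2.2)).1 ∧ q.2.1 = (Φ (q.1, q.2.2)).2}) := by
  classical
  have hU : IsOpen (Ω ×ˢ I) := hΩo.prod hIo
  have hD : IsOpen (Ω ×ˢ (I ×ˢ J)) := hΩo.prod (hIo.prod hJo)
  -- reassociation
  have hasc : ContDiff ℝ (⊤ : ℕ∞) (fun z : SN.XX d × ℝ => ((z.1.1, z.1.2, z.2) : SN.YY d)) := by fun_prop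
  have hasm : MapsTo (fun z : SN.XX d × ℝ => ((z.1.1, z.1.2, z.2) : SN.YY d)) ((Ω ×ˢ I) ×ˢ J)
      (Ω ×ˢ (I ×ˢ J)) := fun z hz => ⟨hz.1.1, hz.1.2, hz.2⟩
  have ha' : SN.Sm ((Ω ×ˢ I) ×ˢ J) (fun z : SN.XX d × ℝ => a z.1.1 z.1.2 z.2) :=
    ha.comp hasc.contDiffOn hasm
  have hb' : ∀ i, SN.Sm ((Ω ×ˢ I) ×ˢ J) (fun z : SN.XX d × ℝ => b z.1.1 z.1.2 z.2 i) := fun i =>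
    (contDiffOn_pi.1 hb i).comp hasc.contDiffOn hasm
  have hvr' : ContDiffOn ℝ r (fun z : SN.XX d × ℝ => v z.1.1 z.1.2 z.2) ((Ω ×ˢ I) ×ˢ J) :=
    hv_r.comp (hasc.of_le (by exact_mod_cast le_top)).contDiffOn hasm
  have hsl : ∀ τ ∈ J, ContDiffOn ℝ (⊤ : ℕ∞) (fun p : SN.XX d => (p, τ)) (Ω ×ˢ I) := fun τ hτ => by fun_prop
  have has : ∀ τ ∈ J, SN.Sm (Ω ×ˢ I) (fun p : SN.XX d => a p.1 p.2 τ) := fun τ hτ =>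
    ContDiffOn.comp ha' (hsl τ hτ) (fun p hp => ⟨hp, hτ⟩)
  have hbs : ∀ τ ∈ J, ∀ i, SN.Sm (Ω ×ˢ I) (fun p : SN.XX d => b p.1 p.2 τ i) := fun τ hτ i =>
    ContDiffOn.comp (hb' i) (hsl τ hτ) (fun p hp => ⟨hp, hτ⟩)
  -- the equation
  have heq : ∀ τ ∈ J, ∀ q ∈ Ω ×ˢ I, SN.heat SN.xx SN.tt (fun p : SN.XX d => v p.1 p.2 τ) q
      = a q.1 q.2 τ * v q.1 q.2 τ
        + ∑ i, b q.1 q.2 τ i * SN.dd (SN.xx i) (fun p : SN.XX d => v p.1 p.2 τ) q := by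
    rintro τ hτ ⟨x, t⟩ ⟨hx, ht⟩
    have hs := hv_xt τ hτ
    have h := hv_eq τ hτ x hx t ht
    have e1 := (SN.hasDerivAt_slice (SN.Sm.diffAt hU hs (show (x, t) ∈ Ω ×ˢ I from ⟨hx, ht⟩))).deriv
    have e2 := SN.lap_eq hΩo hIo hs hx ht
    have e3 := fun i => SN.pd_eq hΩo hIo hs hx ht i
    simp only at e1 e2 e3
    rw [e1, e2] at h
    simp only [e3] at h
    simp only [SN.heat]
    linarith
  have hKC : SN.KC (SN.bs (SN.xx (d := d)) SN.tt) (Ω ×ˢ I) J r (fun τ (p : SN.XX d) => v p.1 p.2 τ) := by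
    refine SN.KC_of_eq (SN.XXb d) (SN.XXb_eq d) hU hJo (ContinuousLinearMap.snd ℝ (Fin d → ℝ) ℝ)
      (by simp [SN.tt]) r (a := fun τ p => a p.1 p.2 τ) (c := fun i τ p => b p.1 p.2 τ i)
      (f := fun _ _ => 0) (fun τ hτ => hv_xt τ hτ) hvr' (SN.KC.of_smooth hU hJo r ha')
      (fun i => SN.KC.of_smooth hU hJo r (hb' i))
      (SN.KC.of_smooth hU hJo r (f := fun _ => 0) contDiffOn_const) ?_
    intro τ hτ q hq
    rw [add_zero]
    exact heq τ hτ q hq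
  have hW1 : ∀ l : List (Fin d), ContDiffOn ℝ r
      (fun q : SN.YY d => SN.dw SN.xx l (fun p : SN.XX d => v p.1 p.2 q.2.2) (q.1, q.2.1))
      (Ω ×ˢ (I ×ˢ J)) := by
    intro l
    rw [← SN.XXb_eq d] at hKC
    have h := SN.KC.contDiffOn (SN.XXb d) hU hJo hKC (l.map Sum.inl)
    simp only [SN.XXb_eq, SN.dw_map_inl] at h
    have hc : ContDiff ℝ r (fun q : SN.YY d => (((q.1, q.2.1), q.2.2) : SN.XX d × ℝ)) := by fun_prop
    exact ContDiffOn.comp h hc.contDiffOn (fun q hq => ⟨⟨hq.1, hq.2.1⟩, hq.2.2⟩)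
  have hr0 : (r : WithTop ℕ∞) ≠ 0 := by
    have : r ≠ 0 := by omega
    exact_mod_cast this
  have hWd : ∀ (l : List (Fin d)) (e : Fin d → ℝ) (s : ℝ), ∀ q ∈ Ω ×ˢ (I ×ˢ J),
      SN.dd (e, s, 0)
        (fun q : SN.YY d => SN.dw SN.xx l (fun p : SN.XX d => v p.1 p.2 q.2.2) (q.1, q.2.1)) q
      = SN.dd (e, s) (SN.dw SN.xx l (fun p : SN.XX d => v p.1 p.2 q.2.2)) (q.1, q.2.1) :=
    fun l e s q hq => SN.dd_slice_Y (((hW1 l).contDiffAt (hD.mem_nhds hq)).differentiableAt hr0) e s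
  obtain ⟨S, hS, hG⟩ := SN.global_graph hd hr hD hW1 (fun l i q hq => hWd l (Pi.single i 1) 0 q hq)
    (fun l q hq hl => (hWd l 0 1 q hq).trans (SN.ddt_eq_trace hU (hv_xt _ hq.2.2) (has _ hq.2.2)
      (hbs _ hq.2.2) (heq _ hq.2.2) (show (q.1, q.2.1) ∈ Ω ×ˢ I from ⟨hq.1, hq.2.1⟩) l hl))
    (fun l i j q hq => SN.dd_comm hU (SN.Sm.dw hU (hv_xt _ hq.2.2) l) _ _
      (show (q.1, q.2.1) ∈ Ω ×ˢ I from ⟨hq.1, hq.2.1⟩))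
    (fun q hq => by
      by_contra hcon
      push Not at hcon
      exact hv_nt ⟨q.2.1, hq.2.1, q.2.2, hq.2.2, SN.slice_zero hΩo hΩc hIo (hv_xt _ hq.2.2)
        (has _ hq.2.2) (hbs _ hq.2.2) (heq _ hq.2.2) hq.1 hq.2.1 hcon⟩)
  refine ⟨S, ?_, hG⟩
  rintro q ⟨hqD, hq0, hq1⟩
  refine hS ⟨hqD, hq0, fun i => ?_⟩
  have := hq1 i
  rw [← this]
  exact (SN.pd_eq hΩo hIo (hv_xt _ hqD.2.2) hqD.1 hqD.2.1 i).symm
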